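/- arXiv:2102.01543 — 5 statements merged into one kernel-verified Lean document; each statement's English description precedes it below -/
import Mathlib

section
/- There exist absolute constants C₂, C₃ > 0 such that the following holds. Let r be sufficiently large, D = C₃r², ρ = D^{−4}, N > D^{C₂D²} an integer, X = N^{1/r}, and let x₁,…,x_M ∈ 𝕋^D be any points satisfying properties (1) and (2) of well-distributed centres. Let θ ∈ Θ be diophantine, let d be an integer with 1 ≤ d ≤ N/X, and let n₀ be a positive integer such that n₀ + dn ≤ N for all integers 1 ≤ n ≤ X/2. Then there exist an integer 1 ≤ n ≤ X/2 and an index j ∈ {1,…,M} such that θ(n₀ + dn) ∈ x_j + π(B_{ρ/10}(0)), where B_{ρ/10}(0) ⊆ ℝ^D is the Euclidean ball of radius ρ/10 centred at 0. -/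
noncomputable section

/-- The Euclidean norm on `ℝ^D`. -/
def l2 {D : ℕ} (v : Fin D → ℝ) : ℝ := Real.sqrt (∑ i, v i ^ 2)

/-- The natural projection `π : ℝ^D → 𝕋^D`. -/
def torusProj {D : ℕ} (v : Fin D → ℝ) : Fin D → AddCircle (1 : ℝ) :=
  fun i => (v i : AddCircle (1 : ℝ))

/-- Well-distributed centres for `(D, r, ρ)`. -/
def Centres (r D M : ℕ) (ρ : ℝ) (x : Fin M → (Fin D → AddCircle (1 : ℝ))) : Prop :=
  (∀ i₁ i₂ i₃ : Fin M, ¬ (i₁ = i₂ ∧ i₂ = i₃) →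
      10 * ρ ≤ ‖x i₁ - (2 : ℤ) • x i₂ + x i₃‖) ∧
  (∀ V : Submodule ℚ (Fin D → ℚ), Module.finrank ℚ V ≤ 4 * r →
    ∀ y : Fin D → AddCircle (1 : ℝ), ∃ j : Fin M,
      ∀ ξ : Fin D → ℤ, (fun i => (ξ i : ℚ)) ∈ V → (∀ i, (|ξ i| : ℝ) ≤ ρ⁻¹ ^ 3) →
        ‖∑ i, ξ i • (x j i - y i)‖ ≤ 1 / 100)

/-- The diophantine condition on `θ ∈ 𝕋^D` (with `X = N^{1/r}`). -/
def Diophantine (C₂ : ℝ) (r D N : ℕ) (θ : Fin D → AddCircle (1 : ℝ)) : Prop :=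
  (∀ n : ℕ, 1 ≤ n → n ≤ N →
    Module.finrank ℚ (Submodule.span ℚ
      ((fun ξ : Fin D → ℤ => fun i => (ξ i : ℚ)) ''
        {ξ : Fin D → ℤ | (∀ i, (|ξ i| : ℝ) ≤ (D : ℝ) ^ C₂) ∧
          ‖(n : ℤ) • ∑ i, ξ i • θ i‖ ≤ (D : ℝ) ^ (C₂ * D) / (N : ℝ) ^ ((1 : ℝ) / r)}))
      < 4 * r) ∧
  (∀ d : ℕ, 1 ≤ d → (d : ℝ) ≤ (N : ℝ) / (N : ℝ) ^ ((1 : ℝ) / r) →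
    ({n : ℕ | 1 ≤ n ∧ (n : ℝ) ≤ (N : ℝ) ^ ((1 : ℝ) / r) ∧
        ‖(d * n) • θ‖ ≤ ((N : ℝ) ^ ((1 : ℝ) / r)) ^ (-(1 : ℝ) / D)}.ncard : ℝ)
      ≤ ((N : ℝ) ^ ((1 : ℝ) / r)) ^ ((9 : ℝ) / 10))

/-- The additive character `e(α)`. -/
def ee (α : AddCircle (1 : ℝ)) : ℂ := (AddCircle.toCircle α : ℂ)

lemma ee_add (a b : AddCircle (1 : ℝ)) : ee (a + b) = ee a * ee b := by
  simp [ee, AddCircle.toCircle_add]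

lemma ee_zero : ee 0 = 1 := by simp [ee]

lemma ee_nsmul (n : ℕ) (a : AddCircle (1 : ℝ)) : ee (n • a) = ee a ^ n := by
  simp [ee, AddCircle.toCircle_nsmul]

lemma ee_neg (a : AddCircle (1 : ℝ)) : ee (-a) = (starRingEnd ℂ) (ee a) := by
  simp [ee, AddCircle.toCircle_neg, ← Circle.coe_inv_eq_conj]

lemma ee_norm (a : AddCircle (1 : ℝ)) : ‖ee a‖ = 1 := Circle.norm_coe _

lemma ee_sum {ι : Type*} (s : Finset ι) (f : ι → AddCircle (1 : ℝ)) :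
    ee (∑ i ∈ s, f i) = ∏ i ∈ s, ee (f i) := by
  classical
  induction s using Finset.induction_on with
  | empty => simp [ee_zero]
  | insert a s ha ih => rw [Finset.sum_insert ha, Finset.prod_insert ha, ee_add, ih]

lemma exists_rep (a : AddCircle (1 : ℝ)) :
    ∃ t : ℝ, (t : AddCircle (1 : ℝ)) = a ∧ ‖a‖ = |t| ∧ |t| ≤ 1 / 2 := by
  induction a using QuotientAddGroup.induction_on with
  | H t =>
    refine ⟨t - round t, by simp, ?_, abs_sub_round t⟩
    have := AddCircle.norm_eq (1 : ℝ) (x := t)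
    simpa using this

lemma ee_re (t : ℝ) : (ee (t : AddCircle (1 : ℝ))).re = Real.cos (2 * Real.pi * t) := by
  simp only [ee, AddCircle.toCircle_apply_mk, Circle.coe_exp]
  rw [Complex.exp_ofReal_mul_I_re]; simp

lemma one_sub_cos_ge (t : ℝ) (ht : |t| ≤ 1 / 2) :
    8 * t ^ 2 ≤ 1 - Real.cos (2 * Real.pi * t) := by
  have hpi := Real.pi_pos
  have h1 : |Real.pi * t| ≤ Real.pi / 2 := by
    rw [abs_mul, abs_of_pos hpi]; nlinarith
  have h2 := Real.mul_abs_le_abs_sin h1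
  have h3 : 2 / Real.pi * |Real.pi * t| = 2 * |t| := by
    rw [abs_mul, abs_of_pos hpi]; field_simp
  rw [h3] at h2
  have h4 : Real.cos (2 * Real.pi * t) = 1 - 2 * Real.sin (Real.pi * t) ^ 2 := by
    rw [mul_assoc, Real.cos_two_mul, Real.cos_sq']; ring
  have h5 : (2 * |t|) ^ 2 ≤ |Real.sin (Real.pi * t)| ^ 2 :=
    pow_le_pow_left₀ (by positivity) h2 2
  rw [sq_abs, mul_pow, sq_abs] at h5
  rw [h4]; linarith

/-- `∑_{a<H} e(aα)`. -/
def SS (H : ℕ) (α : AddCircle (1 : ℝ)) : ℂ := ∑ a ∈ Finset.range H, ee α ^ a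

/-- The Fejer kernel. -/
def fej (H : ℕ) (α : AddCircle (1 : ℝ)) : ℝ := Complex.normSq (SS H α)

lemma fej_nonneg (H : ℕ) (α : AddCircle (1 : ℝ)) : 0 ≤ fej H α := Complex.normSq_nonneg _

lemma fej_expand (H : ℕ) (α : AddCircle (1 : ℝ)) :
    (fej H α : ℂ) = ∑ p ∈ Finset.range H ×ˢ Finset.range H, ee (((p.1 : ℤ) - p.2) • α) := by
  rw [fej, ← Complex.mul_conj, SS, map_sum, Finset.sum_mul_sum, ← Finset.sum_product']
  refine Finset.sum_congr rfl fun p _ => ?_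
  rw [sub_smul, sub_eq_add_neg, ee_add, ee_neg, natCast_zsmul, natCast_zsmul, ee_nsmul, ee_nsmul]

lemma normSq_one_sub (α : AddCircle (1 : ℝ)) : Complex.normSq (ee α - 1) = 2 - 2 * (ee α).re := by
  have h := ee_norm α
  have h2 : Complex.normSq (ee α) = 1 := by rw [Complex.normSq_eq_norm_sq, h]; norm_num
  rw [Complex.normSq_sub, h2]; simp; ring

lemma fej_mul (H : ℕ) (α : AddCircle (1 : ℝ)) :
    fej H α * (1 - (ee α).re) = 1 - (ee (H • α)).re := by
  have h : SS H α * (ee α - 1) = ee (H • α) - 1 := by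
    rw [SS, geom_sum_mul, ee_nsmul]
  have h2 := congrArg Complex.normSq h
  rw [map_mul, normSq_one_sub, normSq_one_sub] at h2
  rw [fej]; linarith

lemma fej_zero (H : ℕ) : fej H 0 = (H : ℝ) ^ 2 := by
  simp [fej, SS, ee_zero, Complex.normSq_apply]; ring

lemma fej_le (H : ℕ) (α : AddCircle (1 : ℝ)) : fej H α * (4 * ‖α‖ ^ 2) ≤ 1 := by
  obtain ⟨t, rfl, hn, ht⟩ := exists_rep α
  have h := fej_mul H (t : AddCircle (1 : ℝ))
  have h1 : -1 ≤ (ee (H • (t : AddCircle (1 : ℝ)))).re := by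
    have := Complex.abs_re_le_norm (ee (H • (t : AddCircle (1 : ℝ))))
    rw [ee_norm] at this
    exact (abs_le.1 this).1
  have h2 := one_sub_cos_ge t ht
  rw [← ee_re] at h2
  rw [hn, sq_abs]
  have := mul_le_mul_of_nonneg_left h2 (fej_nonneg H (t : AddCircle (1 : ℝ)))
  nlinarith

/-- Fejer coefficients. -/
def kk (L : ℕ) (m : ℤ) : ℝ :=
  (((Finset.range L ×ˢ Finset.range L).filter fun p => (p.1 : ℤ) - p.2 = m).card : ℝ)

lemma fej_coeff (L : ℕ) (α : AddCircle (1 : ℝ)) :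
    (fej L α : ℂ) = ∑ m ∈ Finset.Icc (-(L : ℤ)) L, (kk L m : ℂ) * ee (m • α) := by
  rw [fej_expand, ← Finset.sum_fiberwise_of_maps_to (t := Finset.Icc (-(L : ℤ)) L)
    (g := fun p : ℕ × ℕ => (p.1 : ℤ) - p.2)]
  · refine Finset.sum_congr rfl fun m _ => ?_
    rw [Finset.sum_congr rfl (g := fun _ => ee (m • α))]
    · simp [kk]
    · intro p hp
      rw [(Finset.mem_filter.1 hp).2]
  · intro p hp
    simp only [Finset.mem_product, Finset.mem_range] at hp
    simp only [Finset.mem_Icc]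
    omega

lemma kk_nonneg (L : ℕ) (m : ℤ) : 0 ≤ kk L m := Nat.cast_nonneg _

lemma kk_zero (L : ℕ) : kk L 0 = L := by
  have : ((Finset.range L ×ˢ Finset.range L).filter fun p : ℕ × ℕ => (p.1 : ℤ) - p.2 = 0)
      = (Finset.range L).image fun i => (i, i) := by
    ext ⟨a, b⟩
    simp only [Finset.mem_filter, Finset.mem_product, Finset.mem_range, Finset.mem_image,
      Prod.mk.injEq]
    constructor
    · rintro ⟨⟨h1, h2⟩, h3⟩
      exact ⟨a, h1, rfl, by omega⟩
    · rintro ⟨c, h, rfl, rfl⟩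
      exact ⟨⟨h, h⟩, by omega⟩
  rw [kk, this, Finset.card_image_of_injective _ (fun a b h => (Prod.mk.inj h).1)]
  simp

/-- Coefficients of `F(t)(cos 2πt - 1 + ε)`. -/
def aa (L : ℕ) (ε : ℝ) (m : ℤ) : ℝ :=
  ε * kk L m - (if m = 0 then 1 else 0) + (if m = L then 1 / 2 else 0)
    + (if m = -L then 1 / 2 else 0)

lemma aa_coeff (L : ℕ) (ε : ℝ) (α : AddCircle (1 : ℝ)) :
    ((fej L α * ((ee α).re - 1 + ε) : ℝ) : ℂ) =
      ∑ m ∈ Finset.Icc (-(L : ℤ)) L, (aa L ε m : ℂ) * ee (m • α) := by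
  have h : fej L α * ((ee α).re - 1 + ε) = ε * fej L α - 1 + (ee (L • α)).re := by
    have := fej_mul L α
    linarith
  rw [h]
  have h0 : (0 : ℤ) ∈ Finset.Icc (-(L : ℤ)) L := by simp
  have h1 : (L : ℤ) ∈ Finset.Icc (-(L : ℤ)) L := by simp
  have h2 : -(L : ℤ) ∈ Finset.Icc (-(L : ℤ)) L := by simp
  have key : ∑ m ∈ Finset.Icc (-(L : ℤ)) L, (aa L ε m : ℂ) * ee (m • α) =
      ε * (fej L α : ℂ) - 1 + 1 / 2 * ee ((L : ℤ) • α) + 1 / 2 * ee ((-(L : ℤ)) • α) := by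
    have hs : ∀ m : ℤ, (aa L ε m : ℂ) * ee (m • α) =
        ε * ((kk L m : ℂ) * ee (m • α)) - (if m = 0 then ee (m • α) else 0)
        + (if m = L then 1 / 2 * ee (m • α) else 0)
        + (if m = -L then 1 / 2 * ee (m • α) else 0) := by
      intro m
      rw [aa]
      push_cast
      split_ifs <;> push_cast <;> ring
    rw [Finset.sum_congr rfl fun m _ => hs m, Finset.sum_add_distrib, Finset.sum_add_distrib,
      Finset.sum_sub_distrib, ← Finset.mul_sum, ← fej_coeff, Finset.sum_ite_eq', Finset.sum_ite_eq',
      Finset.sum_ite_eq', if_pos h0, if_pos h1, if_pos h2]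
    simp [ee_zero]
  rw [key, neg_smul, ee_neg, natCast_zsmul]
  have hc : ((ee (L • α)).re : ℂ) = 1 / 2 * ee (L • α) + 1 / 2 * (starRingEnd ℂ) (ee (L • α)) := by
    rw [Complex.re_eq_add_conj]; ring
  push_cast
  rw [hc]; ring

lemma aa_nonneg (L : ℕ) (ε : ℝ) (hε : 0 ≤ ε) (h : 2 ≤ ε * L) (m : ℤ) : 0 ≤ aa L ε m := by
  have hk := mul_nonneg hε (kk_nonneg L m)
  rw [aa]
  rcases eq_or_ne m 0 with rfl | hm
  · rw [kk_zero]; split_ifs <;> linarith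
  · rw [if_neg hm]; split_ifs <;> linarith

lemma aa_zero (L : ℕ) (ε : ℝ) (h : 2 ≤ ε * L) : 1 ≤ aa L ε 0 := by
  rw [aa, kk_zero]; split_ifs <;> linarith

/-- The coefficients of the minorant. -/
def cc (D L : ℕ) (ε : ℝ) (ξ : Fin D → ℤ) : ℝ :=
  ∑ i : Fin D, ∏ j : Fin D, (if j = i then aa L ε (ξ j) else kk L (ξ j))

lemma cc_coeff (D L : ℕ) (ε : ℝ) (z : Fin D → AddCircle (1 : ℝ)) :
    (((∏ i, fej L (z i)) * ∑ i, ((ee (z i)).re - 1 + ε) : ℝ) : ℂ) =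
      ∑ ξ ∈ Fintype.piFinset (fun _ : Fin D => Finset.Icc (-(L : ℤ)) L),
        (cc D L ε ξ : ℂ) * ee (∑ i, ξ i • z i) := by
  have h1 : ∀ i : Fin D, (((∏ i, fej L (z i)) * ((ee (z i)).re - 1 + ε) : ℝ) : ℂ) =
      ∏ j : Fin D, ∑ m ∈ Finset.Icc (-(L : ℤ)) L,
        (((if j = i then aa L ε m else kk L m : ℝ) : ℂ) * ee (m • z j)) := by
    intro i
    have : ∀ j : Fin D, ∑ m ∈ Finset.Icc (-(L : ℤ)) L,
        (((if j = i then aa L ε m else kk L m : ℝ) : ℂ) * ee (m • z j)) =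
        (fej L (z j) : ℂ) * (if j = i then (((ee (z j)).re - 1 + ε : ℝ) : ℂ) else 1) := by
      intro j
      by_cases hj : j = i
      · simp only [hj, if_true]
        rw [← aa_coeff]; push_cast; ring
      · simp only [hj, if_false]
        rw [← fej_coeff]; ring
    rw [Finset.prod_congr rfl fun j _ => this j, Finset.prod_mul_distrib, Finset.prod_ite_eq']
    simp
  rw [Finset.mul_sum, Complex.ofReal_sum, Finset.sum_congr rfl fun i _ => h1 i]
  simp only [cc, Complex.ofReal_sum, Finset.sum_mul]
  rw [Finset.sum_comm]
  refine Finset.sum_congr rfl fun i _ => ?_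
  rw [Finset.prod_univ_sum]
  refine Finset.sum_congr rfl fun ξ _ => ?_
  rw [Finset.prod_mul_distrib, ee_sum, Complex.ofReal_prod]

lemma cc_nonneg (D L : ℕ) (ε : ℝ) (hε : 0 ≤ ε) (h : 2 ≤ ε * L) (ξ : Fin D → ℤ) :
    0 ≤ cc D L ε ξ := by
  refine Finset.sum_nonneg fun i _ => Finset.prod_nonneg fun j _ => ?_
  split_ifs
  · exact aa_nonneg L ε hε h _
  · exact kk_nonneg L _

lemma cc_zero (D L : ℕ) (hD : 0 < D) (hL : 1 ≤ L) (ε : ℝ) (h : 2 ≤ ε * L) :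
    1 ≤ cc D L ε 0 := by
  have h1 : ∀ i : Fin D, (1 : ℝ) ≤ ∏ j : Fin D,
      (if j = i then aa L ε ((0 : Fin D → ℤ) j) else kk L ((0 : Fin D → ℤ) j)) := by
    intro i
    have := Finset.prod_le_prod (s := (Finset.univ : Finset (Fin D))) (f := fun _ => (1 : ℝ))
      (g := fun j => (if j = i then aa L ε ((0 : Fin D → ℤ) j) else kk L ((0 : Fin D → ℤ) j)))
      (fun _ _ => zero_le_one) ?_
    · simpa using this
    · intro j _
      dsimp only [Pi.zero_apply]
      split_ifs
      · exact aa_zero L ε h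
      · rw [kk_zero]; exact_mod_cast hL
  have h2 := Finset.sum_le_sum fun i (_ : i ∈ (Finset.univ : Finset (Fin D))) => h1 i
  have h3 : (1 : ℝ) ≤ ∑ i : Fin D, (1 : ℝ) := by
    simp; exact_mod_cast hD
  exact h3.trans h2

lemma cc_sum (D L : ℕ) (ε : ℝ) :
    ∑ ξ ∈ Fintype.piFinset (fun _ : Fin D => Finset.Icc (-(L : ℤ)) L), cc D L ε ξ
      = (L : ℝ) ^ (2 * D) * (D * ε) := by
  have h := cc_coeff D L ε 0
  simp only [Pi.zero_apply, smul_zero, Finset.sum_const_zero, ee_zero, mul_one, fej_zero] at h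
  have h' : (∏ i : Fin D, (L : ℝ) ^ 2) * ∑ i : Fin D, ((1 : ℂ).re - 1 + ε) = 
    ∑ ξ ∈ Fintype.piFinset (fun _ : Fin D => Finset.Icc (-(L : ℤ)) L), cc D L ε ξ := by
    exact_mod_cast h
  rw [← h']
  simp [pow_mul]

lemma sum_expand (D L H : ℕ) (ε : ℝ) (y β : Fin D → AddCircle (1 : ℝ)) :
    ∑ p ∈ Finset.range H ×ˢ Finset.range H,
      ((∏ i, fej L ((y + ((p.1 : ℤ) - p.2) • β) i)) *
        ∑ i, ((ee ((y + ((p.1 : ℤ) - p.2) • β) i)).re - 1 + ε)) =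
    ∑ ξ ∈ Fintype.piFinset (fun _ : Fin D => Finset.Icc (-(L : ℤ)) L),
      cc D L ε ξ * (fej H (∑ i, ξ i • β i) * (ee (∑ i, ξ i • y i)).re) := by
  have h : ((∑ p ∈ Finset.range H ×ˢ Finset.range H,
      ((∏ i, fej L ((y + ((p.1 : ℤ) - p.2) • β) i)) *
        ∑ i, ((ee ((y + ((p.1 : ℤ) - p.2) • β) i)).re - 1 + ε)) : ℝ) : ℂ) =
    ∑ ξ ∈ Fintype.piFinset (fun _ : Fin D => Finset.Icc (-(L : ℤ)) L),
      ((cc D L ε ξ * fej H (∑ i, ξ i • β i) : ℝ) : ℂ) * ee (∑ i, ξ i • y i) := by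
    rw [Complex.ofReal_sum, Finset.sum_congr rfl fun p _ => cc_coeff D L ε _, Finset.sum_comm]
    refine Finset.sum_congr rfl fun ξ _ => ?_
    rw [Complex.ofReal_mul, fej_expand, Finset.mul_sum, Finset.sum_mul]
    refine Finset.sum_congr rfl fun p _ => ?_
    rw [mul_assoc, ← ee_add]
    congr 2
    rw [Finset.smul_sum, ← Finset.sum_add_distrib]
    refine Finset.sum_congr rfl fun i _ => ?_
    simp only [Pi.add_apply, Pi.smul_apply]
    rw [smul_add, add_comm, smul_comm]
  have h2 := congrArg Complex.re h
  rw [Complex.ofReal_re, Complex.re_sum] at h2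
  rw [h2]
  refine Finset.sum_congr rfl fun ξ _ => ?_
  rw [Complex.re_ofReal_mul, mul_assoc]

lemma main_pos (D L H : ℕ) (ε η : ℝ) (hD : 0 < D) (hL : 1 ≤ L) (hε : 0 ≤ ε) (h2 : 2 ≤ ε * L)
    (hη : 0 ≤ η) (y β : Fin D → AddCircle (1 : ℝ))
    (hξ : ∀ ξ : Fin D → ℤ, (∀ i, |ξ i| ≤ L) →
      0 ≤ (ee (∑ i, ξ i • y i)).re ∨ fej H (∑ i, ξ i • β i) ≤ η)
    (hb : η * ((L : ℝ) ^ (2 * D) * (D * ε)) < (H : ℝ) ^ 2) :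
    ∃ a < H, ∃ b < H, 0 < ∑ i, ((ee ((y + ((a : ℤ) - b) • β) i)).re - 1 + ε) := by
  by_contra hcon
  push Not at hcon
  have hle : ∑ p ∈ Finset.range H ×ˢ Finset.range H,
      ((∏ i, fej L ((y + ((p.1 : ℤ) - p.2) • β) i)) *
        ∑ i, ((ee ((y + ((p.1 : ℤ) - p.2) • β) i)).re - 1 + ε)) ≤ 0 := by
    refine Finset.sum_nonpos fun p hp => ?_
    simp only [Finset.mem_product, Finset.mem_range] at hp
    exact mul_nonpos_of_nonneg_of_nonpos (Finset.prod_nonneg fun i _ => fej_nonneg _ _)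
      (hcon p.1 hp.1 p.2 hp.2)
  rw [sum_expand] at hle
  have h0 : (0 : Fin D → ℤ) ∈ Fintype.piFinset (fun _ : Fin D => Finset.Icc (-(L : ℤ)) L) := by
    simp
  have hlow : ∑ ξ ∈ Fintype.piFinset (fun _ : Fin D => Finset.Icc (-(L : ℤ)) L),
      (cc D L ε ξ * (if ξ = 0 then (H : ℝ) ^ 2 else 0) - cc D L ε ξ * η) ≤
      ∑ ξ ∈ Fintype.piFinset (fun _ : Fin D => Finset.Icc (-(L : ℤ)) L),
      cc D L ε ξ * (fej H (∑ i, ξ i • β i) * (ee (∑ i, ξ i • y i)).re) := by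
    refine Finset.sum_le_sum fun ξ hm => ?_
    rw [← mul_sub]
    refine mul_le_mul_of_nonneg_left ?_ (cc_nonneg D L ε hε h2 ξ)
    rcases eq_or_ne ξ 0 with rfl | hne
    · simp [ee_zero, fej_zero, hη]
    · rw [if_neg hne]
      have hb : ∀ i, |ξ i| ≤ L := by
        intro i
        have := Fintype.mem_piFinset.1 hm i
        rw [Finset.mem_Icc] at this
        exact abs_le.2 this
      have hf := fej_nonneg H (∑ i, ξ i • β i)
      rcases hξ ξ hb with h | h
      · have := mul_nonneg hf h
        linarith
      · have h1 : -1 ≤ (ee (∑ i, ξ i • y i)).re := by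
          have := Complex.abs_re_le_norm (ee (∑ i, ξ i • y i))
          rw [ee_norm] at this
          exact (abs_le.1 this).1
        nlinarith
  rw [Finset.sum_sub_distrib, ← Finset.sum_mul, cc_sum] at hlow
  simp only [mul_ite, mul_zero] at hlow
  rw [Finset.sum_ite_eq', if_pos h0] at hlow
  have hc := cc_zero D L hD hL ε h2
  nlinarith [sq_nonneg (H : ℝ)]

lemma re_nonneg_of_small (a : AddCircle (1 : ℝ)) (h : ‖a‖ ≤ 1 / 100) : 0 ≤ (ee a).re := by
  obtain ⟨t, rfl, hn, ht⟩ := exists_rep a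
  rw [ee_re]
  rw [hn, abs_le] at h
  have := Real.pi_pos
  apply Real.cos_nonneg_of_neg_pi_div_two_le_of_le <;> nlinarith

lemma finish (D : ℕ) (ρ ε : ℝ) (hρ : 0 < ρ) (hε : D * ε = 8 * (ρ / 10) ^ 2)
    (z : Fin D → AddCircle (1 : ℝ)) (h : 0 < ∑ i, ((ee (z i)).re - 1 + ε)) :
    ∃ v : Fin D → ℝ, l2 v < ρ / 10 ∧ torusProj v = z := by
  choose v hv hn hle using fun i => exists_rep (z i)
  refine ⟨v, ?_, funext hv⟩
  rw [l2, Real.sqrt_lt' (by positivity)]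
  have h1 : ∀ i, (ee (z i)).re - 1 + ε ≤ ε - 8 * v i ^ 2 := by
    intro i
    have := one_sub_cos_ge (v i) (hle i)
    rw [← hv i, ee_re]; linarith
  have h2 := h.trans_le (Finset.sum_le_sum fun i _ => h1 i)
  rw [Finset.sum_sub_distrib, ← Finset.mul_sum] at h2
  simp only [Finset.sum_const, Finset.card_univ, Fintype.card_fin, nsmul_eq_mul] at h2
  linarith

theorem statement6 :
    ∃ C₂ : ℝ, 0 < C₂ ∧ ∃ C₃ : ℕ, 0 < C₃ ∧
    ∃ r₀ : ℕ, ∀ r : ℕ, r₀ ≤ r → ∀ D : ℕ, D = C₃ * r ^ 2 →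
    ∀ ρ : ℝ, ρ = (D : ℝ) ^ (-4 : ℤ) →
    ∀ N : ℕ, (N : ℝ) > (D : ℝ) ^ (C₂ * (D : ℝ) ^ 2) →
    ∀ X : ℝ, X = (N : ℝ) ^ ((1 : ℝ) / r) →
    ∀ M : ℕ, ∀ x : Fin M → (Fin D → AddCircle (1 : ℝ)), Centres r D M ρ x →
    ∀ θ : Fin D → AddCircle (1 : ℝ), Diophantine C₂ r D N θ →
    ∀ d : ℕ, 1 ≤ d → (d : ℝ) ≤ (N : ℝ) / X →
    ∀ n₀ : ℕ, 1 ≤ n₀ → (∀ n : ℕ, 1 ≤ n → (n : ℝ) ≤ X / 2 → n₀ + d * n ≤ N) →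
    ∃ n : ℕ, 1 ≤ n ∧ (n : ℝ) ≤ X / 2 ∧ ∃ j : Fin M, ∃ v : Fin D → ℝ,
      l2 v < ρ / 10 ∧ (n₀ + d * n) • θ = x j + torusProj v := by
  refine ⟨12, by norm_num, 1, one_pos, 10, ?_⟩
  intro r hr D hD ρ hρ N hN X hX M x hx θ hθ d hd1 hd n₀ hn₀ hn
  have hDN : 100 ≤ D := by nlinarith
  have hDr : r ≤ D := by nlinarith
  have hDR : (100 : ℝ) ≤ D := by exact_mod_cast hDN
  have hD1 : (1 : ℝ) ≤ D := by linarith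
  have hD0 : (0 : ℝ) < D := by linarith
  have hr0 : (0 : ℝ) < r := by exact_mod_cast (by omega : 0 < r)
  -- X is large
  have hX100 : (100 : ℝ) ≤ X := by
    have h1 : (D : ℝ) ^ (r : ℝ) ≤ N := by
      refine le_trans ?_ hN.le
      apply Real.rpow_le_rpow_of_exponent_le hD1
      have : (r : ℝ) ≤ D := by exact_mod_cast hDr
      nlinarith
    have h2 := Real.rpow_le_rpow (by positivity) h1 (by positivity : (0 : ℝ) ≤ 1 / r)
    rw [← Real.rpow_mul hD0.le, mul_one_div_cancel hr0.ne', Real.rpow_one, ← hX] at h2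
    linarith
  have hX0 : 0 < X := by linarith
  have hdN : d ≤ N := by
    have : (d : ℝ) ≤ N := hd.trans (div_le_self (Nat.cast_nonneg _) (by linarith))
    exact_mod_cast this
  have hpow : (D : ℝ) ^ ((12 : ℝ) * D) = (D : ℝ) ^ (12 * D) := by
    rw [← Real.rpow_natCast]; push_cast; rfl
  have hpow12 : (D : ℝ) ^ (12 : ℝ) = (D : ℝ) ^ 12 := by
    rw [← Real.rpow_natCast]; norm_num
  have hρ' : ρ = ((D : ℝ) ^ 4)⁻¹ := by rw [hρ, zpow_neg]; rfl
  have hρ0 : 0 < ρ := by rw [hρ']; positivity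
  have hρ3 : ρ⁻¹ ^ 3 = (D : ℝ) ^ 12 := by rw [hρ', inv_inv, ← pow_mul]
  set L : ℕ := D ^ 10 with hL
  have hLR : (L : ℝ) = (D : ℝ) ^ 10 := by rw [hL]; push_cast; rfl
  have hL12 : (L : ℝ) ≤ (D : ℝ) ^ 12 := by
    rw [hLR]; exact pow_le_pow_right₀ hD1 (by norm_num)
  set ε : ℝ := 8 * (ρ / 10) ^ 2 / D with hε
  have hDε : D * ε = 8 * (ρ / 10) ^ 2 := by rw [hε]; field_simp
  have hε0 : 0 ≤ ε := by positivity
  have hεL : 2 ≤ ε * L := by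
    have : ε * L = 8 / 100 * D := by
      rw [hε, hρ', hLR]; field_simp; norm_num
    rw [this]; linarith
  have hDε1 : D * ε ≤ 1 := by
    rw [hDε]
    have : ρ ≤ 1 := by rw [hρ']; exact inv_le_one_of_one_le₀ (one_le_pow₀ hD1)
    nlinarith
  -- the subspace
  obtain ⟨hθ1, -⟩ := hθ
  have hV := hθ1 d hd1 hdN
  rw [← hX] at hV
  set A : Set (Fin D → ℤ) := {ξ : Fin D → ℤ | (∀ i, (|ξ i| : ℝ) ≤ (D : ℝ) ^ (12 : ℝ)) ∧
          ‖(d : ℤ) • ∑ i, ξ i • θ i‖ ≤ (D : ℝ) ^ ((12 : ℝ) * D) / X} with hA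
  set H : ℕ := ⌊X / 4⌋₊ with hH
  have hH1 : (H : ℝ) ≤ X / 4 := Nat.floor_le (by positivity)
  have hH2 : X / 4 - 1 < H := Nat.sub_one_lt_floor _
  obtain ⟨j, hj⟩ := hx.2 _ hV.le ((n₀ + d * H) • θ)
  set Q : ℝ := (D : ℝ) ^ (12 * D) / X with hQ
  have hQ0 : 0 < Q := by positivity
  have hmain : ∃ a < H, ∃ b < H, 0 < ∑ i,
      ((ee ((((n₀ + d * H) • θ - x j) + ((a : ℤ) - b) • (d • θ)) i)).re - 1 + ε) := by
    refine main_pos D L H ε (1 / (4 * Q ^ 2)) (by omega)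
      (Nat.one_le_pow _ _ (by omega)) hε0 hεL (by positivity)
      ((n₀ + d * H) • θ - x j) (d • θ) ?_ ?_
    · intro ξ hξL
      have hξR : ∀ i, (|ξ i| : ℝ) ≤ (D : ℝ) ^ 12 := by
        intro i
        refine le_trans ?_ hL12
        exact_mod_cast hξL i
      by_cases hmem : ξ ∈ A
      · left
        have h := hj ξ (Submodule.subset_span ⟨ξ, hmem, rfl⟩) (by rw [hρ3]; exact hξR)
        apply re_nonneg_of_small
        have he : ∑ i, ξ i • ((n₀ + d * H) • θ - x j) i =
            -∑ i, ξ i • (x j i - ((n₀ + d * H) • θ) i) := by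
          rw [← Finset.sum_neg_distrib]
          refine Finset.sum_congr rfl fun i _ => ?_
          rw [← smul_neg, neg_sub, Pi.sub_apply]
        rw [he, norm_neg]
        exact h
      · right
        have hgt : Q < ‖∑ i, ξ i • (d • θ) i‖ := by
          rw [hA, Set.mem_ofPred_eq, hpow12, hpow] at hmem
          push Not at hmem
          have he : ∑ i, ξ i • (d • θ) i = (d : ℤ) • ∑ i, ξ i • θ i := by
            rw [Finset.smul_sum]
            refine Finset.sum_congr rfl fun i _ => ?_
            rw [Pi.smul_apply, natCast_zsmul, smul_comm]
          rw [he]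
          exact hmem hξR
        have hf := fej_le H (∑ i, ξ i • (d • θ) i)
        have hf0 := fej_nonneg H (∑ i, ξ i • (d • θ) i)
        rw [le_div_iff₀ (by positivity)]
        refine le_trans (mul_le_mul_of_nonneg_left ?_ hf0) hf
        have := pow_le_pow_left₀ hQ0.le hgt.le 2
        linarith
    · have hLp : (L : ℝ) ^ (2 * D) = (D : ℝ) ^ (20 * D) := by
        rw [hLR, ← pow_mul]; congr 1; ring
      have h24 : ((D : ℝ) ^ (12 * D)) ^ 2 = (D : ℝ) ^ (20 * D) * (D : ℝ) ^ (4 * D) := by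
        rw [← pow_mul, ← pow_add]; congr 1; ring
      have hbig : (D : ℝ) ≤ (D : ℝ) ^ (4 * D) := le_self_pow₀ hD1 (by omega)
      have hp : (0 : ℝ) < (D : ℝ) ^ (20 * D) := by positivity
      have e1 : 1 / (4 * Q ^ 2) * (L : ℝ) ^ (2 * D) = X ^ 2 / (4 * (D : ℝ) ^ (4 * D)) := by
        rw [hQ, div_pow, h24, hLp]; field_simp
      rw [← mul_assoc, e1]
      have h5 : X ^ 2 / (4 * (D : ℝ) ^ (4 * D)) ≤ X ^ 2 / 400 := by
        apply div_le_div_of_nonneg_left (by positivity) (by norm_num); linarith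
      have h6 : X / 5 ≤ H := by linarith
      have h7 : (X / 5) ^ 2 ≤ (H : ℝ) ^ 2 := pow_le_pow_left₀ (by positivity) h6 2
      have h8 : X ^ 2 / (4 * (D : ℝ) ^ (4 * D)) * (D * ε) ≤ X ^ 2 / (4 * (D : ℝ) ^ (4 * D)) * 1 :=
        mul_le_mul_of_nonneg_left hDε1 (by positivity)
      nlinarith [pow_pos hX0 2]
  obtain ⟨a, ha, b, hb, hpos⟩ := hmain
  · obtain ⟨v, hv1, hv2⟩ := finish D ρ ε hρ0 hDε _ hpos
    refine ⟨H + a - b, by omega, ?_, j, v, hv1, ?_⟩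
    · have h1 : H + a - b ≤ 2 * H := by omega
      have h2 : ((H + a - b : ℕ) : ℝ) ≤ 2 * H := by exact_mod_cast h1
      linarith
    · rw [hv2, ← natCast_zsmul, ← natCast_zsmul, ← natCast_zsmul]
      rw [Nat.cast_add, Nat.cast_mul, Nat.cast_sub (by omega)]
      push_cast
      module

end
end

section
/- There exist absolute constants C₂, C₃, C > 0 such that the following holds. Let r be sufficiently large, D = C₃r², and N ≥ D^{D²} an integer, and set X = N^{1/r}. Then the set Θ ⊆ 𝕋^D of all θ satisfying: (1) for all integers 1 ≤ n ≤ N, the set {ξ ∈ ℤ^D : |ξ| ≤ D^{C₂}, ‖n(ξ·θ)‖_𝕋 ≤ D^{C₂D}X^{−1}} spans a ℚ-vector space of dimension < 4r; and (2) for all integers 1 ≤ d ≤ N/X, #{1 ≤ n ≤ X : ‖θdn‖_{𝕋^D} ≤ X^{−1/D}} ≤ X^{9/10}; has Haar measure at least 1 − C/N. -/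
open MeasureTheory

noncomputable section

lemma aux_int_fourier (n : ℤ) :
    ∫ x : AddCircle (1 : ℝ), fourier n x = if n = 0 then (1 : ℂ) else 0 := by
  rw [AddCircle.volume_eq_smul_haarAddCircle, ENNReal.ofReal_one, one_smul]
  have h := (orthonormal_iff_ite.mp (orthonormal_fourier (T := 1))) 0 n
  rw [ContinuousMap.inner_toLp] at h
  simp only [fourier_zero, map_one, mul_one] at h
  rw [h]
  simp only [eq_comm]

lemma aux_int_mFourier {D : ℕ} (ξ : Fin D → ℤ) :
    ∫ x : Fin D → AddCircle (1 : ℝ), UnitAddTorus.mFourier ξ x = if ξ = 0 then (1 : ℂ) else 0 := by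
  simp only [UnitAddTorus.mFourier, ContinuousMap.coe_mk]
  rw [MeasureTheory.integral_fintype_prod_volume_eq_prod]
  simp only [aux_int_fourier]
  split_ifs with h
  · simp [h]
  · obtain ⟨i, hi⟩ := Function.ne_iff.mp h
    apply Finset.prod_eq_zero (Finset.mem_univ i)
    simpa using hi

lemma aux_norm_sq {D : ℕ} {α : Type*} (S : Finset α) (φ : α → Fin D → ℤ)
    (hφ : Set.InjOn φ S) :
    ∫ x : Fin D → AddCircle (1 : ℝ), ‖∑ m ∈ S, UnitAddTorus.mFourier (φ m) x‖ ^ 2 = S.card := by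
  classical
  have h1 : ∀ x : Fin D → AddCircle (1 : ℝ),
      ((‖∑ m ∈ S, UnitAddTorus.mFourier (φ m) x‖ ^ 2 : ℝ) : ℂ) =
      ∑ m ∈ S, ∑ m' ∈ S, UnitAddTorus.mFourier (φ m + - φ m') x := by
    intro x
    rw [Complex.ofReal_pow, ← Complex.mul_conj', map_sum, Finset.sum_mul_sum]
    simp only [UnitAddTorus.mFourier_add, UnitAddTorus.mFourier_neg]
  have hint : ∀ ξ : Fin D → ℤ, Integrable (fun x : Fin D → AddCircle (1 : ℝ) =>
      UnitAddTorus.mFourier ξ x) := fun ξ =>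
    (UnitAddTorus.mFourier ξ).continuous.integrable_of_hasCompactSupport
      (HasCompactSupport.of_compactSpace _)
  have h2 : ((∫ x : Fin D → AddCircle (1 : ℝ),
      ‖∑ m ∈ S, UnitAddTorus.mFourier (φ m) x‖ ^ 2 : ℝ) : ℂ) = (S.card : ℂ) := by
    rw [← integral_complex_ofReal]
    simp only [h1]
    rw [integral_finsetSum _ (fun m _ => integrable_finsetSum _ (fun m' _ => hint _))]
    simp only [integral_finsetSum _ (fun m' _ => hint _), aux_int_mFourier]
    have : ∀ m ∈ S, (∑ m' ∈ S, if φ m + -φ m' = 0 then (1 : ℂ) else 0) = 1 := by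
      intro m hm
      rw [Finset.sum_eq_single m]
      · simp
      · intro b hb hbm
        rw [if_neg]
        intro h
        exact hbm (hφ hb hm (by rw [← sub_eq_add_neg, sub_eq_zero] at h; exact h.symm))
      · simp [hm]
    rw [Finset.sum_congr rfl this]
    simp
  exact_mod_cast h2

lemma aux_re {s : AddCircle (1 : ℝ)} (hs : ‖s‖ ≤ 1 / 8) :
    √2 / 2 ≤ ((AddCircle.toCircle s : Circle) : ℂ).re := by
  induction s using QuotientAddGroup.induction_on with
  | H x =>
    have hx : ‖((x : ℝ) : UnitAddCircle)‖ = |x - round x| := UnitAddCircle.norm_eq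
    have hx' : |x - round x| ≤ 1 / 8 := by rw [← hx]; exact hs
    have e : ((x : ℝ) : AddCircle (1 : ℝ)) = ((x - round x : ℝ) : AddCircle (1 : ℝ)) := by
      have h := AddCircle.coe_period (1 : ℝ)
      rw [AddCircle.coe_sub, eq_comm, sub_eq_self]
      rw [show ((round x : ℤ) : ℝ) = (round x : ℤ) • (1 : ℝ) by simp, AddCircle.coe_zsmul, h,
        smul_zero]
    change _ ≤ ((AddCircle.toCircle ((x : ℝ) : AddCircle (1 : ℝ)) : Circle) : ℂ).re
    rw [e, AddCircle.toCircle_apply_mk, Circle.coe_exp, Complex.exp_ofReal_mul_I_re,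
      ← Real.cos_pi_div_four, ← Real.cos_abs (_ * _)]
    have hp := Real.pi_pos
    apply Real.cos_le_cos_of_nonneg_of_le_pi (abs_nonneg _) (by linarith)
    rw [abs_mul, div_one, abs_of_pos (by positivity)]
    nlinarith

lemma aux_dir {L : ℕ} {t : AddCircle (1 : ℝ)} (ht : ‖t‖ ≤ 1 / (8 * L)) :
    (L : ℝ) ^ 2 / 2 ≤ ‖∑ m ∈ Finset.range L, ((AddCircle.toCircle (m • t) : Circle) : ℂ)‖ ^ 2 := by
  have h1 : (L : ℝ) * (√2 / 2) ≤
      (∑ m ∈ Finset.range L, ((AddCircle.toCircle (m • t) : Circle) : ℂ)).re := by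
    rw [Complex.re_sum]
    calc (L : ℝ) * (√2 / 2) = ∑ m ∈ Finset.range L, (√2 / 2) := by simp
      _ ≤ _ := by
        apply Finset.sum_le_sum
        intro m hm
        apply aux_re
        have hm' : m < L := Finset.mem_range.mp hm
        have hL : (0 : ℝ) < L := by exact_mod_cast (by omega : 0 < L)
        calc ‖m • t‖ ≤ m * ‖t‖ := norm_nsmul_le
          _ ≤ L * (1 / (8 * L)) := by gcongr
          _ = 1 / 8 := by field_simp
  have h2 := h1.trans (Complex.re_le_norm _)
  calc (L : ℝ) ^ 2 / 2 = (L * (√2 / 2)) ^ 2 := by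
        rw [mul_pow, div_pow, Real.sq_sqrt (by norm_num)]; ring
    _ ≤ _ := by gcongr

lemma aux_mFourier_eq {D : ℕ} (ξ : Fin D → ℤ) (x : Fin D → AddCircle (1 : ℝ)) :
    UnitAddTorus.mFourier ξ x = ((AddCircle.toCircle (∑ i, ξ i • x i) : Circle) : ℂ) := by
  simp only [UnitAddTorus.mFourier, ContinuousMap.coe_mk, fourier_apply]
  have : ∀ S : Finset (Fin D), ((AddCircle.toCircle (∑ i ∈ S, ξ i • x i) : Circle) : ℂ) =
      ∏ i ∈ S, ((AddCircle.toCircle (ξ i • x i) : Circle) : ℂ) := by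
    intro S
    induction S using Finset.induction_on with
    | empty => simp
    | insert a S ha ih => rw [Finset.sum_insert ha, Finset.prod_insert ha, AddCircle.toCircle_add,
        Circle.coe_mul, ih]
  rw [this]

/-- Key lemma. -/
lemma aux_key {D : ℕ} {ι : Type*} [Fintype ι] (ξ : ι → Fin D → ℤ) (L : ℕ) (hL : 1 ≤ L)
    (hinj : Set.InjOn (fun m : ι → ℕ => ∑ j, m j • ξ j) {m | ∀ j, m j < L}) {δ : ℝ}
    (hδ : δ ≤ 1 / (8 * L)) :
    (volume : Measure (Fin D → AddCircle (1 : ℝ))) {θ | ∀ j, ‖∑ i, ξ j i • θ i‖ ≤ δ} ≤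
      ENNReal.ofReal ((2 / L) ^ (Fintype.card ι)) := by
  classical
  have hL0 : (0 : ℝ) < L := by exact_mod_cast hL
  set S : Finset (ι → ℕ) := Fintype.piFinset (fun _ => Finset.range L) with hS
  have hn := aux_norm_sq S (fun m => ∑ j, m j • ξ j) (by
    convert hinj using 1
    ext m; simp [hS])
  have hcard : S.card = L ^ Fintype.card ι := by simp [hS]
  set F : (Fin D → AddCircle (1 : ℝ)) → ℝ := fun x =>
    ‖∑ m ∈ S, UnitAddTorus.mFourier (∑ j, m j • ξ j) x‖ ^ 2 with hF
  have hint : Integrable F := by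
    apply Continuous.integrable_of_hasCompactSupport
    · fun_prop
    · exact HasCompactSupport.of_compactSpace _
  have hprod : ∀ x, F x = ∏ j, ‖∑ m ∈ Finset.range L,
      ((AddCircle.toCircle (m • ∑ i, ξ j i • x i) : Circle) : ℂ)‖ ^ 2 := by
    intro x
    rw [Finset.prod_pow, ← norm_prod, Finset.prod_univ_sum]
    simp only [hF]
    congr 2
    apply Finset.sum_congr rfl
    intro m _
    have h0 : ∀ T : Finset ι, UnitAddTorus.mFourier (∑ j ∈ T, m j • ξ j) x =
        ∏ j ∈ T, ((AddCircle.toCircle (m j • ∑ i, ξ j i • x i) : Circle) : ℂ) := by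
      intro T
      induction T using Finset.induction_on with
      | empty => simp [UnitAddTorus.mFourier_zero]
      | insert a T ha ih =>
        rw [Finset.sum_insert ha, Finset.prod_insert ha, UnitAddTorus.mFourier_add, ih,
          aux_mFourier_eq]
        congr 4
        rw [Finset.smul_sum]
        apply Finset.sum_congr rfl
        intro i _
        simp [mul_smul]
    exact h0 _
  have hM := mul_meas_ge_le_integral_of_nonneg (μ := volume) (f := F)
    (Filter.Eventually.of_forall (fun x => by positivity)) hint
    (((L : ℝ) ^ 2 / 2) ^ Fintype.card ι)
  have hsub : {θ : Fin D → AddCircle (1 : ℝ) | ∀ j, ‖∑ i, ξ j i • θ i‖ ≤ δ} ⊆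
      {x | ((L : ℝ) ^ 2 / 2) ^ Fintype.card ι ≤ F x} := by
    intro θ hθ
    simp only [Set.mem_ofPred_eq] at hθ ⊢
    rw [hprod]
    calc ((L : ℝ) ^ 2 / 2) ^ Fintype.card ι = ∏ j : ι, ((L : ℝ) ^ 2 / 2) := (by
          rw [Finset.prod_const, Finset.card_univ])
      _ ≤ _ := Finset.prod_le_prod (fun _ _ => by positivity)
        (fun j _ => aux_dir ((hθ j).trans hδ))
  refine (measure_mono hsub).trans ?_
  rw [← ENNReal.ofReal_toReal (measure_ne_top volume {x | ((L : ℝ) ^ 2 / 2) ^ Fintype.card ι ≤ F x})]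
  apply ENNReal.ofReal_le_ofReal
  have hn' : ∫ x, F x = (L : ℝ) ^ Fintype.card ι := by
    rw [hn, hcard]; push_cast; rfl
  rw [hn'] at hM
  rw [measureReal_def] at hM
  have hpos : 0 < ((L : ℝ) ^ 2 / 2) ^ Fintype.card ι := by positivity
  rw [← le_div_iff₀' hpos, ← div_pow] at hM
  refine hM.trans (le_of_eq ?_)
  congr 1
  field_simp

/-- No nontrivial linear relation with coefficients in `[-L, L)`. -/
def AuxGood {k : ℕ} (L : ℕ) (n : Fin k → ℕ) : Prop :=
  ∀ a : Fin k → ℤ, (∀ j, a j ∈ Finset.Ico (-(L : ℤ)) L) → ∑ j, a j * (n j : ℤ) = 0 → a = 0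

lemma aux_rel_count {k : ℕ} (A : Finset ℕ) (a : Fin (k + 1) → ℤ) (ha : a ≠ 0) :
    ((Fintype.piFinset (fun _ : Fin (k + 1) => A)).filter
      (fun n => ∑ j, a j * (n j : ℤ) = 0)).card ≤ A.card ^ k := by
  classical
  obtain ⟨i, hi⟩ := Function.ne_iff.mp ha
  have hi' : a i ≠ 0 := by simpa using hi
  have hc : (Fintype.piFinset (fun _ : Fin k => A)).card = A.card ^ k := by simp
  rw [← hc]
  apply Finset.card_le_card_of_injOn (fun n => i.removeNth n)
  · intro n hn
    simp only [Finset.coe_filter, Fintype.mem_piFinset, Set.mem_ofPred_eq] at hn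
    simp only [Finset.mem_coe, Fintype.mem_piFinset]
    intro j
    exact hn.1 _
  · intro n hn n' hn' h
    simp only [Finset.coe_filter, Fintype.mem_piFinset, Set.mem_ofPred_eq] at hn hn'
    have h1 := hn.2
    have h2 := hn'.2
    have h' : ∀ j, n (i.succAbove j) = n' (i.succAbove j) := fun j => congrFun h j
    rw [Fin.sum_univ_succAbove _ i] at h1 h2
    simp only [h'] at h1
    have h3 : a i * (n i : ℤ) = a i * (n' i : ℤ) := by linarith
    have h4 : n i = n' i := by exact_mod_cast mul_left_cancel₀ hi' h3
    funext j
    rcases Fin.eq_self_or_eq_succAbove i j with rfl | ⟨j', rfl⟩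
    · exact h4
    · exact h' j'

open Classical in
lemma aux_good_count {k : ℕ} (L : ℕ) (A : Finset ℕ) (hA : 2 * (2 * L) ^ (k + 1) ≤ A.card) :
    A.card ^ (k + 1) ≤ 2 * ((Fintype.piFinset (fun _ : Fin (k + 1) => A)).filter
      (fun n => AuxGood L n)).card := by
  set P := Fintype.piFinset (fun _ : Fin (k + 1) => A) with hP
  have hPc : P.card = A.card ^ (k + 1) := by simp [hP]
  set Q := (Fintype.piFinset (fun _ : Fin (k + 1) => Finset.Ico (-(L : ℤ)) L)).filter
    (fun a => a ≠ 0) with hQ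
  have hQc : Q.card ≤ (2 * L) ^ (k + 1) := by
    refine (Finset.card_filter_le _ _).trans ?_
    simp only [Fintype.card_piFinset, Int.card_Ico, Finset.prod_const, Finset.card_univ,
      Fintype.card_fin]
    apply Nat.pow_le_pow_left
    omega
  have hbad : (P.filter (fun n => ¬ AuxGood L n)).card ≤ (2 * L) ^ (k + 1) * A.card ^ k := by
    have hsub : P.filter (fun n => ¬ AuxGood L n) ⊆
        Q.biUnion (fun a => P.filter (fun n => ∑ j, a j * (n j : ℤ) = 0)) := by
      intro n hn
      simp only [Finset.mem_filter, AuxGood, not_forall] at hn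
      obtain ⟨hnP, a, ha1, ha2, ha3⟩ := hn
      simp only [Finset.mem_biUnion, Finset.mem_filter, hQ, Fintype.mem_piFinset]
      exact ⟨a, ⟨ha1, ha3⟩, hnP, ha2⟩
    refine (Finset.card_le_card hsub).trans ?_
    refine (Finset.card_biUnion_le_card_mul _ _ (A.card ^ k) ?_).trans ?_
    · intro a ha
      exact aux_rel_count A a (Finset.mem_filter.mp ha).2
    · gcongr
  have hsum := Finset.card_filter_add_card_filter_not (s := P) (fun n => AuxGood L n)
  have : 2 * ((2 * L) ^ (k + 1) * A.card ^ k) ≤ A.card ^ (k + 1) := by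
    rw [pow_succ' A.card, ← mul_assoc]
    gcongr
  omega

lemma aux_good_measure {D k : ℕ} (d : ℕ) (hd : 1 ≤ d) (L : ℕ) (hL : 1 ≤ L) {ε : ℝ}
    (hε : ε ≤ 1 / (8 * L)) (n : Fin k → ℕ) (hn : AuxGood L n) :
    (volume : Measure (Fin D → AddCircle (1 : ℝ))) {θ | ∀ j, ‖(d * n j) • θ‖ ≤ ε} ≤
      ENNReal.ofReal ((2 / L) ^ (k * D)) := by
  classical
  have key := aux_key (D := D) (ι := Fin k × Fin D)
    (fun p => Pi.single p.2 ((d * n p.1 : ℕ) : ℤ)) L hL ?_ hε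
  · rw [Fintype.card_prod, Fintype.card_fin, Fintype.card_fin] at key
    refine (measure_mono ?_).trans key
    intro θ hθ
    simp only [Set.mem_ofPred_eq] at hθ ⊢
    rintro ⟨j, i⟩
    rw [Finset.sum_eq_single i]
    · simp only [Pi.single_eq_same]
      rw [natCast_zsmul]
      exact (norm_le_pi_norm ((d * n j) • θ) i).trans (hθ j)
    · intro b _ hb
      simp [Pi.single_eq_of_ne hb]
    · simp
  · intro m hm m' hm' h
    simp only [Set.mem_ofPred_eq] at hm hm'
    have hcomp : ∀ (m : Fin k × Fin D → ℕ) (i : Fin D),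
        (∑ p, m p • (Pi.single p.2 ((d * n p.1 : ℕ) : ℤ) : Fin D → ℤ)) i =
          (d : ℤ) * ∑ j, (m (j, i) : ℤ) * (n j : ℤ) := by
      intro m i
      rw [Finset.sum_apply, Fintype.sum_prod_type, Finset.mul_sum]
      apply Finset.sum_congr rfl
      intro j _
      rw [Finset.sum_eq_single i]
      · simp; ring
      · intro b _ hb
        simp [Pi.single_eq_of_ne hb.symm]
      · simp
    funext ⟨j, i⟩
    have h1 := congrFun h i
    simp only [hcomp] at h1
    have hd' : (d : ℤ) ≠ 0 := by exact_mod_cast (by omega : d ≠ 0)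
    have h2 := mul_left_cancel₀ hd' h1
    have h3 := hn (fun j => (m (j, i) : ℤ) - m' (j, i)) (by
      intro j
      have := hm (j, i)
      have := hm' (j, i)
      simp only [Finset.mem_Ico]
      omega) (by
      simp only [sub_mul, Finset.sum_sub_distrib, h2, sub_self])
    have h4 := congrFun h3 j
    simp only [Pi.zero_apply] at h4
    omega

open Classical in
lemma aux_part2 {D k : ℕ} (d : ℕ) (hd : 1 ≤ d) (L : ℕ) (hL : 1 ≤ L) {ε : ℝ}
    (hε : ε ≤ 1 / (8 * L)) (M : ℕ) (T : ℝ) (hT : 2 * (2 * (L : ℝ)) ^ (k + 1) ≤ T) :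
    (volume : Measure (Fin D → AddCircle (1 : ℝ)))
      {θ | T < (((Finset.Icc 1 M).filter (fun n : ℕ => ‖(d * n) • θ‖ ≤ ε)).card : ℝ)} ≤
      ENNReal.ofReal (2 * (M : ℝ) ^ (k + 1) * (2 / L) ^ ((k + 1) * D) / T ^ (k + 1)) := by
  have hL0 : (0 : ℝ) < L := by exact_mod_cast hL
  have hT0 : 0 < T := lt_of_lt_of_le (by positivity) hT
  set G := (Fintype.piFinset (fun _ : Fin (k + 1) => Finset.Icc 1 M)).filter
    (fun n => AuxGood L n) with hG
  have hGc : G.card ≤ M ^ (k + 1) := by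
    refine (Finset.card_filter_le _ _).trans ?_
    simp
  let E : (Fin (k + 1) → ℕ) → Set (Fin D → AddCircle (1 : ℝ)) :=
    fun n => {θ | ∀ j, ‖(d * n j) • θ‖ ≤ ε}
  have hE : ∀ n, MeasurableSet (E n) := by
    intro n
    have : E n = ⋂ j, {θ | ‖(d * n j) • θ‖ ≤ ε} := by ext; simp [E]
    rw [this]
    apply MeasurableSet.iInter
    intro j
    apply IsClosed.measurableSet
    exact isClosed_le (by fun_prop) continuous_const
  let F : (Fin D → AddCircle (1 : ℝ)) → ENNReal := fun θ => ∑ n ∈ G, (E n).indicator 1 θ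
  have hFm : Measurable F :=
    Finset.measurable_sum _ (fun n _ => measurable_one.indicator (hE n))
  have hFint : ∫⁻ θ, F θ ≤ ENNReal.ofReal ((M : ℝ) ^ (k + 1) * (2 / L) ^ ((k + 1) * D)) := by
    rw [lintegral_finsetSum _ (fun n _ => measurable_one.indicator (hE n))]
    have : ∀ n ∈ G, ∫⁻ θ, (E n).indicator 1 θ ≤
        ENNReal.ofReal ((2 / L) ^ ((k + 1) * D)) := by
      intro n hn
      rw [lintegral_indicator_one (hE n)]
      exact aux_good_measure d hd L hL hε n (Finset.mem_filter.mp hn).2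
    refine (Finset.sum_le_sum this).trans ?_
    rw [Finset.sum_const, nsmul_eq_mul, ENNReal.ofReal_mul (by positivity)]
    gcongr
    rw [← ENNReal.ofReal_natCast]
    apply ENNReal.ofReal_le_ofReal
    exact_mod_cast hGc
  have hsub : {θ | T < (((Finset.Icc 1 M).filter (fun n : ℕ => ‖(d * n) • θ‖ ≤ ε)).card : ℝ)} ⊆
      {θ | ENNReal.ofReal (T ^ (k + 1) / 2) ≤ F θ} := by
    intro θ hθ
    simp only [Set.mem_ofPred_eq] at hθ ⊢
    set A := (Finset.Icc 1 M).filter (fun n : ℕ => ‖(d * n) • θ‖ ≤ ε) with hA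
    have h1 := aux_good_count (k := k) L A (by
      have := hT.trans hθ.le
      exact_mod_cast this)
    have h2 : F θ = ((G.filter (fun n => θ ∈ E n)).card : ENNReal) := by
      simp only [F, Set.indicator_apply, Pi.one_apply]
      rw [Finset.sum_boole]
    have h3 : (Fintype.piFinset (fun _ : Fin (k + 1) => A)).filter (fun n => AuxGood L n) ⊆
        G.filter (fun n => θ ∈ E n) := by
      intro n hn
      simp only [Finset.mem_filter, Fintype.mem_piFinset, hA, hG, E, Set.mem_ofPred_eq] at hn ⊢
      exact ⟨⟨fun j => (hn.1 j).1, hn.2⟩, fun j => (hn.1 j).2⟩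
    have h4 := Finset.card_le_card h3
    rw [h2, ← ENNReal.ofReal_natCast]
    apply ENNReal.ofReal_le_ofReal
    have h5 : (A.card : ℝ) ^ (k + 1) ≤ 2 * ((G.filter (fun n => θ ∈ E n)).card : ℝ) := by
      exact_mod_cast h1.trans (by omega)
    have h6 : T ^ (k + 1) ≤ (A.card : ℝ) ^ (k + 1) := by gcongr
    linarith
  refine (measure_mono hsub).trans ?_
  have hM := mul_meas_ge_le_lintegral (μ := volume) hFm (ENNReal.ofReal (T ^ (k + 1) / 2))
  have hpos : 0 < T ^ (k + 1) / 2 := by positivity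
  have h7 : volume {θ | ENNReal.ofReal (T ^ (k + 1) / 2) ≤ F θ} ≤
      ENNReal.ofReal ((M : ℝ) ^ (k + 1) * (2 / L) ^ ((k + 1) * D)) /
        ENNReal.ofReal (T ^ (k + 1) / 2) := by
    rw [ENNReal.le_div_iff_mul_le (Or.inl (by simpa using hpos)) (Or.inl ENNReal.ofReal_ne_top),
      mul_comm]
    exact hM.trans hFint
  rw [← ENNReal.ofReal_div_of_pos hpos] at h7
  refine h7.trans (le_of_eq ?_)
  congr 1
  field_simp

lemma aux_part1 {D k : ℕ} (n : ℕ) (hn : 1 ≤ n) (L : ℕ) (hL : 1 ≤ L) {δ : ℝ}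
    (hδ : δ ≤ 1 / (8 * L)) (B : ℕ) :
    (volume : Measure (Fin D → AddCircle (1 : ℝ)))
      {θ | k ≤ Module.finrank ℚ (Submodule.span ℚ
      ((fun ξ : Fin D → ℤ => fun i => (ξ i : ℚ)) ''
        {ξ : Fin D → ℤ | (∀ i, (|ξ i| : ℝ) ≤ (B : ℝ)) ∧ ‖(n : ℤ) • ∑ i, ξ i • θ i‖ ≤ δ}))} ≤
      ENNReal.ofReal ((2 * (B : ℝ) + 1) ^ (D * k) * (2 / L) ^ k) := by
  classical
  have hL0 : (0 : ℝ) < L := by exact_mod_cast hL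
  set box : Finset (Fin D → ℤ) := Fintype.piFinset (fun _ => Finset.Icc (-(B : ℤ)) B) with hbox
  set W : Finset (Fin k → Fin D → ℤ) := (Fintype.piFinset (fun _ => box)).filter
    (fun v => LinearIndependent ℚ (fun j => fun i => ((v j i : ℤ) : ℚ))) with hW
  have hWc : (W.card : ℝ) ≤ (2 * (B : ℝ) + 1) ^ (D * k) := by
    have : W.card ≤ (2 * B + 1) ^ (D * k) := by
      refine (Finset.card_filter_le _ _).trans ?_
      simp only [hbox, Fintype.card_piFinset, Int.card_Icc, Finset.prod_const, Finset.card_univ,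
        Fintype.card_fin, ← pow_mul]
      apply Nat.pow_le_pow_left
      omega
    exact_mod_cast this
  have hsub : {θ : Fin D → AddCircle (1 : ℝ) | k ≤ Module.finrank ℚ (Submodule.span ℚ
      ((fun ξ : Fin D → ℤ => fun i => (ξ i : ℚ)) ''
        {ξ : Fin D → ℤ | (∀ i, (|ξ i| : ℝ) ≤ (B : ℝ)) ∧ ‖(n : ℤ) • ∑ i, ξ i • θ i‖ ≤ δ}))} ⊆
      ⋃ v ∈ W, {θ | ∀ j, ‖∑ i, ((n : ℤ) • v j) i • θ i‖ ≤ δ} := by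
    intro θ hθ
    simp only [Set.mem_ofPred_eq] at hθ
    obtain ⟨f, hf1, -, hf3⟩ := Submodule.exists_fun_fin_finrank_span_eq ℚ
      ((fun ξ : Fin D → ℤ => fun i => (ξ i : ℚ)) ''
        {ξ : Fin D → ℤ | (∀ i, (|ξ i| : ℝ) ≤ (B : ℝ)) ∧ ‖(n : ℤ) • ∑ i, ξ i • θ i‖ ≤ δ})
    choose g hg1 hg2 using hf1
    simp only [Set.mem_iUnion]
    refine ⟨fun j => g (Fin.castLE hθ j), ?_, ?_⟩
    · simp only [hW, Finset.mem_filter, Fintype.mem_piFinset, hbox, Finset.mem_Icc]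
      refine ⟨fun j i => ?_, ?_⟩
      · have := (hg1 (Fin.castLE hθ j)).1 i
        rw [← abs_le]
        exact_mod_cast this
      · have h := hf3.comp (Fin.castLE hθ) (Fin.castLE_injective hθ)
        have h' : (f ∘ Fin.castLE hθ) =
            fun j => fun i => ((g (Fin.castLE hθ j) i : ℤ) : ℚ) := by
          funext j
          exact (hg2 _).symm
        rw [h'] at h
        exact h
    · simp only [Set.mem_ofPred_eq]
      intro j
      have := (hg1 (Fin.castLE hθ j)).2
      rw [Finset.smul_sum] at this
      simpa only [Pi.smul_apply, smul_assoc] using this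
  have hv : ∀ v ∈ W, (volume : Measure (Fin D → AddCircle (1 : ℝ)))
      {θ | ∀ j, ‖∑ i, ((n : ℤ) • v j) i • θ i‖ ≤ δ} ≤ ENNReal.ofReal ((2 / L) ^ k) := by
    intro v hv
    have hli := (Finset.mem_filter.mp hv).2
    have key := aux_key (D := D) (fun j => (n : ℤ) • v j) L hL ?_ hδ
    · rwa [Fintype.card_fin] at key
    · intro m _ m' _ h
      have h1 : ∑ j, ((m j : ℚ) - m' j) • (fun i => ((v j i : ℤ) : ℚ)) = 0 := by
        funext i
        have h2 := congrFun h i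
        simp only [Finset.sum_apply, Pi.smul_apply] at h2
        simp only [smul_eq_mul, nsmul_eq_mul] at h2
        have h3 : ∀ m : Fin k → ℕ, ∑ j, (m j : ℤ) * ((n : ℤ) * v j i) =
            (n : ℤ) * ∑ j, (m j : ℤ) * v j i := by
          intro m
          rw [Finset.mul_sum]
          exact Finset.sum_congr rfl (fun j _ => by ring)
        rw [h3, h3] at h2
        have h4 := mul_left_cancel₀ (by exact_mod_cast (by omega : n ≠ 0)) h2
        have h5 : ∑ j, (m j : ℚ) * (v j i : ℚ) = ∑ j, (m' j : ℚ) * (v j i : ℚ) := by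
          exact_mod_cast h4
        simp only [Finset.sum_apply, Pi.smul_apply, smul_eq_mul, Pi.zero_apply, sub_mul,
          Finset.sum_sub_distrib, h5, sub_self]
      have h6 := Fintype.linearIndependent_iff.mp hli _ h1
      funext j
      have := h6 j
      rw [sub_eq_zero] at this
      exact_mod_cast this
  refine (measure_mono hsub).trans ?_
  refine (measure_biUnion_finset_le _ _).trans ?_
  refine (Finset.sum_le_sum hv).trans ?_
  rw [Finset.sum_const, nsmul_eq_mul, ENNReal.ofReal_mul (by positivity)]
  gcongr
  rw [← ENNReal.ofReal_natCast]
  exact ENNReal.ofReal_le_ofReal hWc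

lemma aux_floor {y : ℝ} (hy : 1 ≤ y) : 1 ≤ ⌊y⌋₊ ∧ (⌊y⌋₊ : ℝ) ≤ y ∧ y / 2 ≤ (⌊y⌋₊ : ℝ) := by
  have h1 : 1 ≤ ⌊y⌋₊ := Nat.one_le_floor_iff _ |>.mpr hy
  have h2 := Nat.floor_le (by linarith : 0 ≤ y)
  have h3 := Nat.lt_floor_add_one y
  have h4 : (1 : ℝ) ≤ (⌊y⌋₊ : ℝ) := by exact_mod_cast h1
  exact ⟨h1, h2, by linarith⟩

lemma aux_num1 {r D N L : ℕ} {X : ℝ} (hr : 100 ≤ r) (hD : D = r ^ 2)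
    (hN : (D : ℝ) ^ (D ^ 2) ≤ N) (hX : 0 < X) (hXr : X ^ r = N)
    (hL1 : X / (8 * (D : ℝ) ^ D) / 2 ≤ L) :
    (N : ℝ) * ((2 * (D : ℝ) + 1) ^ (D * (4 * r)) * (2 / L) ^ (4 * r)) ≤ 1 / N := by
  have hDn : 10000 ≤ D := by rw [hD]; nlinarith
  have hDr : (10000 : ℝ) ≤ D := by exact_mod_cast hDn
  have hD1 : (1 : ℝ) ≤ D := by linarith
  have hN1 : (1 : ℝ) ≤ N := (one_le_pow₀ hD1).trans hN
  have hDD : (0 : ℝ) < (D : ℝ) ^ D := by positivity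
  have hX4 : X ^ (4 * r) = (N : ℝ) ^ 4 := by rw [mul_comm, pow_mul, hXr]
  have h1 : (2 : ℝ) / L ≤ 32 * (D : ℝ) ^ D / X := by
    calc (2 : ℝ) / L ≤ 2 / (X / (8 * (D : ℝ) ^ D) / 2) := by gcongr
      _ = 32 * (D : ℝ) ^ D / X := by field_simp; norm_num
  have h2 : (32 * (D : ℝ) ^ D / X) ≤ (D : ℝ) ^ (D + 1) / X := by
    rw [pow_succ']; gcongr; linarith
  have h3 : ((2 : ℝ) / L) ^ (4 * r) ≤ (D : ℝ) ^ ((D + 1) * (4 * r)) / (N : ℝ) ^ 4 := by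
    calc ((2 : ℝ) / L) ^ (4 * r) ≤ ((D : ℝ) ^ (D + 1) / X) ^ (4 * r) := by
          exact pow_le_pow_left₀ (by positivity) (h1.trans h2) _
      _ = _ := by rw [div_pow, hX4, ← pow_mul]
  have h4 : (2 * (D : ℝ) + 1) ^ (D * (4 * r)) ≤ (D : ℝ) ^ (2 * (D * (4 * r))) := by
    rw [pow_mul (D : ℝ) 2]
    gcongr
    nlinarith
  have h5 : (D : ℝ) ^ (2 * (D * (4 * r))) * (D : ℝ) ^ ((D + 1) * (4 * r)) ≤ N := by
    rw [← pow_add]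
    refine le_trans ?_ hN
    apply pow_le_pow_right₀ hD1
    have : 16 * r ≤ D := by rw [hD]; nlinarith
    nlinarith
  calc (N : ℝ) * ((2 * (D : ℝ) + 1) ^ (D * (4 * r)) * (2 / L) ^ (4 * r))
      ≤ N * ((D : ℝ) ^ (2 * (D * (4 * r))) * ((D : ℝ) ^ ((D + 1) * (4 * r)) / (N : ℝ) ^ 4)) := by
        gcongr
    _ = N * (((D : ℝ) ^ (2 * (D * (4 * r))) * (D : ℝ) ^ ((D + 1) * (4 * r))) / (N : ℝ) ^ 4) := by
        rw [mul_div_assoc]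
    _ ≤ N * (N / (N : ℝ) ^ 4) := by gcongr
    _ = 1 / (N : ℝ) ^ 2 := by field_simp
    _ ≤ 1 / N := by
        apply one_div_le_one_div_of_le (by linarith)
        nlinarith

lemma aux_num2 {r D N L M : ℕ} {X Y T : ℝ} (hr : 100 ≤ r) (hD : D = r ^ 2)
    (hN : (D : ℝ) ^ (D ^ 2) ≤ N) (hX : 0 < X) (hXr : X ^ r = N) (hY : 0 < Y) (hYD : Y ^ D = X)
    (hM : (M : ℝ) ≤ X) (hL1 : Y / 8 / 2 ≤ L) (hT : 0 < T) (hTN : (N : ℝ) ^ 3 ≤ T ^ (4 * r)) :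
    (N : ℝ) * (2 * (M : ℝ) ^ (4 * r) * (2 / L) ^ (4 * r * D) / T ^ (4 * r)) ≤ 1 / N := by
  have hDn : 10000 ≤ D := by rw [hD]; nlinarith
  have hDr : (10000 : ℝ) ≤ D := by exact_mod_cast hDn
  have hD1 : (1 : ℝ) ≤ D := by linarith
  have hN1 : (1 : ℝ) ≤ N := (one_le_pow₀ hD1).trans hN
  have hX4 : X ^ (4 * r) = (N : ℝ) ^ 4 := by rw [mul_comm, pow_mul, hXr]
  have hM4 : (M : ℝ) ^ (4 * r) ≤ (N : ℝ) ^ 4 := by rw [← hX4]; gcongr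
  have h1 : (2 : ℝ) / L ≤ D / Y := by
    calc (2 : ℝ) / L ≤ 2 / (Y / 8 / 2) := by gcongr
      _ = 32 / Y := by field_simp; norm_num
      _ ≤ D / Y := by gcongr; linarith
  have h3 : ((2 : ℝ) / L) ^ (4 * r * D) ≤ (D : ℝ) ^ (4 * r * D) / (N : ℝ) ^ 4 := by
    calc ((2 : ℝ) / L) ^ (4 * r * D) ≤ (D / Y) ^ (4 * r * D) := by gcongr
      _ = _ := by rw [div_pow, mul_comm (4 * r) D, pow_mul Y, hYD, hX4]
  have h5 : 2 * (D : ℝ) ^ (4 * r * D) ≤ N := by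
    calc 2 * (D : ℝ) ^ (4 * r * D) ≤ D * (D : ℝ) ^ (4 * r * D) := by gcongr; linarith
      _ = (D : ℝ) ^ (4 * r * D + 1) := by rw [pow_succ']
      _ ≤ (D : ℝ) ^ (D ^ 2) := by
        apply pow_le_pow_right₀ hD1
        have : 16 * r ≤ D := by rw [hD]; nlinarith
        nlinarith
      _ ≤ N := hN
  calc (N : ℝ) * (2 * (M : ℝ) ^ (4 * r) * (2 / L) ^ (4 * r * D) / T ^ (4 * r))
      ≤ N * (2 * (N : ℝ) ^ 4 * ((D : ℝ) ^ (4 * r * D) / (N : ℝ) ^ 4) / (N : ℝ) ^ 3) := by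
        gcongr
    _ = N * ((2 * (D : ℝ) ^ (4 * r * D)) / (N : ℝ) ^ 3) := by field_simp
    _ ≤ N * (N / (N : ℝ) ^ 3) := by gcongr
    _ = 1 / N := by field_simp

theorem statement9 :
    ∃ C₂ C : ℝ, 0 < C₂ ∧ 0 < C ∧ ∃ C₃ : ℕ, 0 < C₃ ∧
    ∃ r₀ : ℕ, ∀ r : ℕ, r₀ ≤ r → ∀ D : ℕ, D = C₃ * r ^ 2 →
    ∀ N : ℕ, (N : ℝ) ≥ (D : ℝ) ^ ((D : ℝ) ^ 2) →
    (volume : Measure (Fin D → AddCircle (1 : ℝ)))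
        {θ : Fin D → AddCircle (1 : ℝ) | Diophantine C₂ r D N θ}
      ≥ 1 - ENNReal.ofReal (C / N) := by
  refine ⟨1, 2, one_pos, two_pos, 1, one_pos, 100, ?_⟩
  intro r hr D hD N hN
  rw [one_mul] at hD
  classical
  have hr0 : r ≠ 0 := by omega
  have hDn : 10000 ≤ D := by rw [hD]; nlinarith
  have hD0 : D ≠ 0 := by omega
  have hDr : (10000 : ℝ) ≤ D := by exact_mod_cast hDn
  have hD1 : (1 : ℝ) ≤ D := by linarith
  have hN' : (D : ℝ) ^ (D ^ 2) ≤ N := by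
    rw [ge_iff_le] at hN
    have : (D : ℝ) ^ ((D : ℝ) ^ 2) = (D : ℝ) ^ (D ^ 2) := by
      rw [← Real.rpow_natCast (D : ℝ) (D ^ 2)]; push_cast; rfl
    rwa [this] at hN
  have hN1 : (1 : ℝ) ≤ N := (one_le_pow₀ hD1).trans hN'
  unfold Diophantine
  set X : ℝ := (N : ℝ) ^ ((1 : ℝ) / r) with hXdef
  have hX0 : 0 < X := Real.rpow_pos_of_pos (by linarith) _
  have hXr : X ^ r = N := by
    rw [hXdef, one_div]; exact Real.rpow_inv_natCast_pow (by linarith) hr0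
  have hXbig : (D : ℝ) ^ (r * D) ≤ X := by
    rw [← pow_le_pow_iff_left₀ (by positivity) hX0.le hr0, hXr, ← pow_mul]
    refine le_trans (le_of_eq ?_) hN'
    congr 1
    rw [hD]; ring
  have hX1 : 1 ≤ X := (one_le_pow₀ hD1).trans hXbig
  -- part 1 constants
  have hy1 : 1 ≤ X / (8 * (D : ℝ) ^ D) := by
    rw [one_le_div (by positivity)]
    calc 8 * (D : ℝ) ^ D ≤ D * (D : ℝ) ^ D := by gcongr; linarith
      _ = (D : ℝ) ^ (D + 1) := by rw [pow_succ']
      _ ≤ (D : ℝ) ^ (r * D) := by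
        apply pow_le_pow_right₀ hD1
        nlinarith
      _ ≤ X := hXbig
  obtain ⟨hL1, hL2, hL3⟩ := aux_floor hy1
  set L := ⌊X / (8 * (D : ℝ) ^ D)⌋₊ with hLdef
  have hδ : (D : ℝ) ^ ((1 : ℝ) * D) / X ≤ 1 / (8 * L) := by
    rw [one_mul, Real.rpow_natCast]
    have hL0 : (0 : ℝ) < L := by exact_mod_cast hL1
    rw [div_le_div_iff₀ hX0 (by positivity)]
    rw [le_div_iff₀ (by positivity)] at hL2
    linarith
  -- part 2 constants
  set Y : ℝ := X ^ ((1 : ℝ) / D) with hYdef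
  have hY0 : 0 < Y := Real.rpow_pos_of_pos hX0 _
  have hYD : Y ^ D = X := by
    rw [hYdef, one_div]; exact Real.rpow_inv_natCast_pow hX0.le hD0
  have hYbig : (D : ℝ) ^ r ≤ Y := by
    rw [← pow_le_pow_iff_left₀ (by positivity) hY0.le hD0, hYD, ← pow_mul]
    exact hXbig
  have hY8 : 8 ≤ Y := by
    have := le_self_pow₀ hD1 hr0
    linarith
  obtain ⟨hK1, hK2, hK3⟩ := aux_floor (show 1 ≤ Y / 8 by linarith)
  set K := ⌊Y / 8⌋₊ with hKdef
  have hε : X ^ (-(1 : ℝ) / D) ≤ 1 / (8 * K) := by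
    have hK0 : (0 : ℝ) < K := by exact_mod_cast hK1
    rw [neg_div, Real.rpow_neg hX0.le, ← one_div]
    apply one_div_le_one_div_of_le (by positivity)
    linarith
  set T : ℝ := X ^ ((9 : ℝ) / 10) with hTdef
  have hT0 : 0 < T := Real.rpow_pos_of_pos hX0 _
  have hrr : (100 : ℝ) ≤ r := by exact_mod_cast hr
  have hTN : (N : ℝ) ^ 3 ≤ T ^ (4 * r) := by
    rw [← hXr, ← pow_mul, hTdef, ← Real.rpow_natCast, ← Real.rpow_natCast, ← Real.rpow_mul hX0.le]
    apply Real.rpow_le_rpow_of_exponent_le hX1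
    push_cast
    linarith
  have hTK : 2 * (2 * (K : ℝ)) ^ (4 * r) ≤ T := by
    have hDD : (D : ℝ) = (r : ℝ) ^ 2 := by rw [hD]; push_cast; rfl
    calc 2 * (2 * (K : ℝ)) ^ (4 * r) ≤ Y * Y ^ (4 * r) := by
          gcongr
          · linarith
          · linarith
      _ = Y ^ (4 * r + 1) := by rw [pow_succ']
      _ = Y ^ (((4 * r + 1 : ℕ)) : ℝ) := (Real.rpow_natCast _ _).symm
      _ ≤ Y ^ ((D : ℝ) * (9 / 10)) := by
          apply Real.rpow_le_rpow_of_exponent_le (by linarith)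
          push_cast
          rw [hDD]
          nlinarith
      _ = T := by rw [Real.rpow_mul hY0.le, Real.rpow_natCast, hYD]
  obtain ⟨k, hk⟩ : ∃ k, 4 * r = k + 1 := ⟨4 * r - 1, by omega⟩
  set M := ⌊X⌋₊ with hMdef
  have hMX : (M : ℝ) ≤ X := Nat.floor_le hX0.le
  let B1 : ℕ → Set (Fin D → AddCircle (1 : ℝ)) := fun n =>
    {θ | 4 * r ≤ Module.finrank ℚ (Submodule.span ℚ
      ((fun ξ : Fin D → ℤ => fun i => (ξ i : ℚ)) ''
        {ξ : Fin D → ℤ | (∀ i, (|ξ i| : ℝ) ≤ (D : ℝ)) ∧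
          ‖(n : ℤ) • ∑ i, ξ i • θ i‖ ≤ (D : ℝ) ^ ((1 : ℝ) * D) / X}))}
  let B2 : ℕ → Set (Fin D → AddCircle (1 : ℝ)) := fun d =>
    {θ | T < (((Finset.Icc 1 M).filter
      (fun n : ℕ => ‖(d * n) • θ‖ ≤ X ^ (-(1 : ℝ) / D))).card : ℝ)}
  have hB1 : volume (⋃ n ∈ Finset.Icc 1 N, B1 n) ≤ ENNReal.ofReal (1 / N) := by
    refine (measure_biUnion_finset_le _ _).trans ?_
    refine (Finset.sum_le_sum (fun n hn =>
      aux_part1 n (Finset.mem_Icc.mp hn).1 L hL1 hδ D)).trans ?_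
    rw [Finset.sum_const, nsmul_eq_mul, Nat.card_Icc, Nat.add_sub_cancel, ← ENNReal.ofReal_natCast,
      ← ENNReal.ofReal_mul (by positivity)]
    exact ENNReal.ofReal_le_ofReal (aux_num1 hr hD hN' hX0 hXr hL3)
  have hB2 : volume (⋃ d ∈ Finset.Icc 1 N, B2 d) ≤ ENNReal.ofReal (1 / N) := by
    refine (measure_biUnion_finset_le _ _).trans ?_
    refine (Finset.sum_le_sum (fun d hd =>
      aux_part2 (k := k) d (Finset.mem_Icc.mp hd).1 K hK1 hε M T (by rw [← hk]; exact hTK))).trans ?_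
    rw [Finset.sum_const, nsmul_eq_mul, Nat.card_Icc, Nat.add_sub_cancel, ← ENNReal.ofReal_natCast,
      ← ENNReal.ofReal_mul (by positivity), ← hk]
    exact ENNReal.ofReal_le_ofReal (aux_num2 hr hD hN' hX0 hXr hY0 hYD hMX hK3 hT0 hTN)
  rw [ge_iff_le, tsub_le_iff_right]
  have hcover : (Set.univ : Set (Fin D → AddCircle (1 : ℝ))) ⊆
      {θ | (∀ n : ℕ, 1 ≤ n → n ≤ N →
    Module.finrank ℚ (Submodule.span ℚ
      ((fun ξ : Fin D → ℤ => fun i => (ξ i : ℚ)) ''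
        {ξ : Fin D → ℤ | (∀ i, (|ξ i| : ℝ) ≤ (D : ℝ) ^ (1 : ℝ)) ∧
          ‖(n : ℤ) • ∑ i, ξ i • θ i‖ ≤ (D : ℝ) ^ ((1 : ℝ) * D) / X}))
      < 4 * r) ∧
  (∀ d : ℕ, 1 ≤ d → (d : ℝ) ≤ (N : ℝ) / X →
    ({n : ℕ | 1 ≤ n ∧ (n : ℝ) ≤ X ∧
        ‖(d * n) • θ‖ ≤ X ^ (-(1 : ℝ) / D)}.ncard : ℝ)
      ≤ T)} ∪ ((⋃ n ∈ Finset.Icc 1 N, B1 n) ∪ (⋃ d ∈ Finset.Icc 1 N, B2 d)) := by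
    intro θ _
    by_contra hcon
    simp only [Set.mem_union, not_or, Set.mem_iUnion, not_exists, Finset.mem_Icc] at hcon
    obtain ⟨h0, h1, h2⟩ := hcon
    apply h0
    refine ⟨fun n hn1 hn2 => ?_, fun d hd1 hd2 => ?_⟩
    · have := h1 n ⟨hn1, hn2⟩
      simp only [B1, Set.mem_ofPred_eq, not_le] at this
      rw [Real.rpow_one]
      exact this
    · have hdN : d ≤ N := by
        have : (d : ℝ) ≤ N := hd2.trans (div_le_self (by linarith) hX1)
        exact_mod_cast this
      have := h2 d ⟨hd1, hdN⟩
      simp only [B2, Set.mem_ofPred_eq, not_lt] at this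
      refine le_trans (le_of_eq ?_) this
      rw [← Set.ncard_coe_finset]
      congr 2
      ext n
      simp only [Set.mem_ofPred_eq, Finset.coe_filter, Finset.mem_Icc, hMdef,
        Nat.le_floor_iff hX0.le, and_assoc]
  calc (1 : ENNReal) = volume (Set.univ : Set (Fin D → AddCircle (1 : ℝ))) := by
        rw [volume_pi, Measure.pi_univ]; simp
    _ ≤ _ := measure_mono hcover
    _ ≤ _ := measure_union_le _ _
    _ ≤ _ := by
      gcongr
      refine (measure_union_le _ _).trans ((add_le_add hB1 hB2).trans ?_)
      rw [← ENNReal.ofReal_add (by positivity) (by positivity)]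
      apply ENNReal.ofReal_le_ofReal
      apply le_of_eq
      ring

end
end

section
/- There exist absolute constants C₁, C₂, C₃ > 0 such that the following holds. Let r be sufficiently large, D = C₃r², N ≥ D^{C₂D²} an integer, X = N^{1/r}, let d be an integer with 1 ≤ d ≤ N/X, and suppose θ ∈ Θ is diophantine. Then there exist an integer 1 ≤ s ≤ D and positive integers n₁,…,n_s with ‖θdn_i‖_{𝕋^D} > 0 for all i such that, writing L_i := ‖θdn_i‖_{𝕋^D}^{−1}: (1) ∏_{i=1}^s L_i ≥ X^{1/80}; (2) ∑_{i=1}^s n_i L_i ≤ X/2; (3) setting v_i := π^{−1}(θdn_i) ∈ (−½, ½]^D (the unique representative of θdn_i in (−½,½]^D) and w_i := v_i/‖v_i‖₂, one has vol(w₁,…,w_s) ≥ D^{−C₁D}; and (4) L_i ≤ X^{C₁/D} for all i. -/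
noncomputable section

lemma gram_bound {D s : ℕ} (e w : Fin s → EuclideanSpace ℝ (Fin D)) (κ : ℝ) (hκ : 0 ≤ κ)
    (hexp : ∀ i, w i = ∑ j, inner ℝ (e j) (w i) • e j)
    (htri : ∀ i j, i < j → inner ℝ (e j) (w i) = 0)
    (hpos : ∀ i, 0 < ‖w i‖)
    (hdiag : ∀ i, κ * ‖w i‖ ≤ inner ℝ (e i) (w i)) :
    κ ^ s ≤ Real.sqrt (Matrix.det (Matrix.of fun i j : Fin s =>
          ∑ k, (w i k / ‖w i‖) * (w j k / ‖w j‖))) := by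
  set A : Matrix (Fin s) (Fin s) ℝ := Matrix.of fun i j => inner ℝ (e j) (w i) / ‖w i‖ with hA
  have hG : (Matrix.of fun i j : Fin s => ∑ k, (w i k / ‖w i‖) * (w j k / ‖w j‖)) = A * A.transpose := by
    ext i l
    rw [Matrix.mul_apply]
    simp only [hA, Matrix.of_apply, Matrix.transpose_apply]
    have h1 : inner ℝ (w i) (w l) = ∑ j, inner ℝ (e j) (w i) * inner ℝ (e j) (w l) := by
      conv_lhs => rw [hexp i]
      rw [sum_inner]
      simp only [real_inner_smul_left]
    have h2 : inner ℝ (w i) (w l) = ∑ k, w i k * w l k := by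
      rw [PiLp.inner_apply]
      refine Finset.sum_congr rfl fun k _ => ?_
      simp [mul_comm]
    have h3 : ∑ k, (w i k / ‖w i‖) * (w l k / ‖w l‖) = (∑ k, w i k * w l k) / (‖w i‖ * ‖w l‖) := by
      rw [Finset.sum_div]
      exact Finset.sum_congr rfl fun k _ => by rw [div_mul_div_comm]
    rw [h3, ← h2, h1, Finset.sum_div]
    exact Finset.sum_congr rfl fun k _ => by rw [div_mul_div_comm]
  have hdet : A.det = ∏ i, A i i := by
    apply Matrix.det_of_isLowerTriangular
    intro i j hij
    have : i < j := hij
    simp [hA, htri i j this]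
  have hle : κ ^ s ≤ A.det := by
    rw [hdet]
    calc κ ^ s = ∏ _i : Fin s, κ := by simp
      _ ≤ _ := by
        apply Finset.prod_le_prod (fun _ _ => hκ)
        intro i _
        simp only [hA, Matrix.of_apply]
        rw [le_div_iff₀ (hpos i)]
        exact hdiag i
  rw [hG, Matrix.det_mul, Matrix.det_transpose, Real.sqrt_mul_self ((pow_nonneg hκ s).trans hle)]
  exact hle

lemma norm_le_sup {D : ℕ} (x : EuclideanSpace ℝ (Fin D)) (δ : ℝ) (hδ : 0 ≤ δ) (h : ∀ k, |x k| ≤ δ) :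
    ‖x‖ ≤ D * δ := by
  rw [EuclideanSpace.norm_eq]
  apply Real.sqrt_le_iff.2
  refine ⟨by positivity, ?_⟩
  calc ∑ i, ‖x i‖ ^ 2 ≤ ∑ _i : Fin D, δ ^ 2 := by
        gcongr with i _
        exact h i
    _ = D * δ ^ 2 := by simp
    _ ≤ (D * δ) ^ 2 := by
      rw [mul_pow]
      gcongr
      norm_cast
      exact Nat.le_self_pow (by norm_num) D

/-- elements of the Bohr set -/
def BB (p : ℕ → ℝ) (Y : ℕ) (ρ : ℝ) : Finset ℕ := (Finset.range (Y+1)).filter (fun n => p n ≤ ρ)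

lemma cover_step {D s Y Q : ℕ} (hD : 1 ≤ D) (hQ : 1 ≤ Q) (hs : s ≤ D)
    (hQD : 4 * Q * D ^ 2 + 1 ≤ Q ^ 2) (v : ℕ → EuclideanSpace ℝ (Fin D)) (p : ℕ → ℝ)
    (hp : ∀ n k, |v n k| ≤ p n)
    (hdiff : ∀ m n, m ≤ n → ∀ δ, 0 ≤ δ → (∀ k, |v n k - v m k| ≤ δ) → p (n - m) ≤ δ)
    (e : Fin s → EuclideanSpace ℝ (Fin D)) (he : Orthonormal ℝ e) (ρ : ℝ) (hρ : 0 < ρ)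
    (hnear : ∀ n ≤ Y, p n ≤ ρ → ‖v n - ∑ j, inner ℝ (e j) (v n) • e j‖ ≤ ρ / (4 * Q)) :
    (BB p Y ρ).card ≤ Q ^ (2 * s) * (BB p Y (ρ / Q)).card := by
  have hD' : (1:ℝ) ≤ D := by exact_mod_cast hD
  have hQ' : (1:ℝ) ≤ Q := by exact_mod_cast hQ
  set η : ℝ := ρ / (2 * Q * D) with hη
  have hη0 : 0 < η := by positivity
  let M : ℤ := 2 * Q * D ^ 2
  let t : Finset (Fin s → ℤ) := Fintype.piFinset (fun _ => Finset.Icc (-M) M)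
  let f : ℕ → Fin s → ℤ := fun n j => ⌊inner ℝ (e j) (v n) / η⌋
  have ht : t.card ≤ Q ^ (2 * s) := by
    simp only [t, Fintype.card_piFinset, Int.card_Icc, Finset.prod_const, Finset.card_univ, Fintype.card_fin]
    rw [pow_mul]
    apply Nat.pow_le_pow_left
    have : M + 1 - -M = ((4 * Q * D ^ 2 + 1 : ℕ) : ℤ) := by
      simp only [M]; push_cast; ring
    rw [this, Int.toNat_natCast]
    exact hQD
  have hmaps : ∀ n ∈ BB p Y ρ, f n ∈ t := by
    intro n hn
    simp only [BB, Finset.mem_filter, Finset.mem_range] at hn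
    simp only [t, Fintype.mem_piFinset, f]
    intro j
    have h1 : |inner ℝ (e j) (v n)| ≤ D * ρ := by
      calc _ ≤ ‖e j‖ * ‖v n‖ := abs_real_inner_le_norm _ _
        _ = ‖v n‖ := by rw [he.1 j, one_mul]
        _ ≤ D * ρ := norm_le_sup _ _ hρ.le fun k => (hp n k).trans hn.2
    have h2 : |inner ℝ (e j) (v n) / η| ≤ (M : ℝ) := by
      rw [abs_div, abs_of_pos hη0, div_le_iff₀ hη0]
      refine h1.trans (le_of_eq ?_)
      simp only [M, hη]; push_cast; field_simp
    rw [abs_le] at h2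
    rw [Finset.mem_Icc]
    constructor
    · apply Int.le_floor.2; push_cast; exact h2.1
    · have := (Int.floor_le (inner ℝ (e j) (v n) / η)).trans h2.2
      exact_mod_cast this
  have hfib : ∀ b ∈ t, ((BB p Y ρ).filter (fun n => f n = b)).card ≤ (BB p Y (ρ / Q)).card := by
    intro b _
    rcases ((BB p Y ρ).filter (fun n => f n = b)).eq_empty_or_nonempty with h0 | h0
    · rw [h0]; simp
    set F := (BB p Y ρ).filter (fun n => f n = b) with hF
    obtain ⟨m, hm, hmin⟩ : ∃ m ∈ F, ∀ n ∈ F, m ≤ n := ⟨F.min' h0, F.min'_mem h0, fun n hn => F.min'_le n hn⟩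
    apply Finset.card_le_card_of_injOn (fun n => n - m)
    · intro n hn
      have hn : n ∈ F := hn
      have hmn := hmin n hn
      simp only [hF, BB, Finset.mem_filter, Finset.mem_range] at hn hm
      simp only [BB, Finset.coe_filter, Finset.mem_range, Set.mem_ofPred_eq]
      refine ⟨by omega, ?_⟩
      apply hdiff m n hmn _ (by positivity)
      intro k
      have e1 : v n - v m = (v n - ∑ j, inner ℝ (e j) (v n) • e j) - (v m - ∑ j, inner ℝ (e j) (v m) • e j)
          + ∑ j, (inner ℝ (e j) (v n) - inner ℝ (e j) (v m)) • e j := by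
        simp only [sub_smul, Finset.sum_sub_distrib]; abel
      have hsum : ‖∑ j, (inner ℝ (e j) (v n) - inner ℝ (e j) (v m)) • e j‖ ≤ ρ / (2 * Q) := by
        calc _ ≤ ∑ j, ‖(inner ℝ (e j) (v n) - inner ℝ (e j) (v m)) • e j‖ := norm_sum_le _ _
          _ ≤ ∑ _j : Fin s, η := by
            gcongr with j _
            rw [norm_smul, he.1 j, mul_one, Real.norm_eq_abs]
            have hfl : f n j = f m j := by rw [hn.2, hm.2]
            have := Int.abs_sub_lt_one_of_floor_eq_floor hfl
            rw [← sub_div, abs_div, abs_of_pos hη0, div_lt_iff₀ hη0, one_mul] at this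
            exact this.le
          _ = s * η := by simp
          _ ≤ D * η := by gcongr
          _ = ρ / (2 * Q) := by rw [hη]; field_simp
      have h3 := hnear n (by omega) hn.1.2
      have h4 := hnear m (by omega) hm.1.2
      calc |v n k - v m k| = ‖(v n - v m) k‖ := by simp
        _ ≤ ‖v n - v m‖ := PiLp.norm_apply_le _ _
        _ ≤ ρ / (4 * Q) + ρ / (4 * Q) + ρ / (2 * Q) := by
          rw [e1]
          refine (norm_add_le _ _).trans ?_
          have h5 := norm_sub_le (v n - ∑ j, inner ℝ (e j) (v n) • e j) (v m - ∑ j, inner ℝ (e j) (v m) • e j)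
          linarith
        _ = ρ / Q := by field_simp; norm_num
    · intro a ha b hb hab
      have := hmin a ha
      have := hmin b hb
      simp only at hab
      omega
  have := Finset.card_le_mul_card_image_of_maps_to hmaps _ hfib
  rw [mul_comm]
  exact this.trans (Nat.mul_le_mul_left _ ht)

/-- The state of the greedy selection. -/
structure GState {D : ℕ} (v : ℕ → EuclideanSpace ℝ (Fin D)) (p : ℕ → ℝ) (Y : ℕ) (κ R : ℝ) (s : ℕ)
    (n : Fin s → ℕ) (e : Fin s → EuclideanSpace ℝ (Fin D)) : Prop where
  orth : Orthonormal ℝ e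
  le : ∀ i, n i ≤ Y
  expand : ∀ i, v (n i) = ∑ j, inner ℝ (e j) (v (n i)) • e j
  tri : ∀ i j, i < j → inner ℝ (e j) (v (n i)) = 0
  pos : ∀ i, 0 < ‖v (n i)‖
  diag : ∀ i, κ * ‖v (n i)‖ ≤ inner ℝ (e i) (v (n i))
  low : ∀ i, 1 ≤ R * p (n i)

lemma GState.s_le {D : ℕ} {v : ℕ → EuclideanSpace ℝ (Fin D)} {p : ℕ → ℝ} {Y : ℕ} {κ R : ℝ} {s : ℕ}
    {n : Fin s → ℕ} {e : Fin s → EuclideanSpace ℝ (Fin D)} (h : GState v p Y κ R s n e) : s ≤ D := by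
  have := h.orth.linearIndependent.fintype_card_le_finrank
  simpa using this

lemma extend_step {D s Y Q : ℕ} (hD : 1 ≤ D) (hQ : 1 ≤ Q)
    (v : ℕ → EuclideanSpace ℝ (Fin D)) (p : ℕ → ℝ)
    (hp : ∀ n k, |v n k| ≤ p n)
    (R : ℝ) (n : Fin s → ℕ) (e : Fin s → EuclideanSpace ℝ (Fin D))
    (h : GState v p Y (1 / (4 * Q * D)) R s n e) (ρ : ℝ) (hρ : 0 < ρ) (hR : 4 * Q * D ≤ R * ρ)
    (m : ℕ) (hm : m ≤ Y) (hpm : p m ≤ ρ)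
    (hfar : ρ / (4 * Q) < ‖v m - ∑ j, inner ℝ (e j) (v m) • e j‖) :
    ∃ e', GState v p Y (1 / (4 * Q * D)) R (s + 1) (Fin.snoc n m : Fin (s+1) → ℕ) e' := by
  have hD' : (1:ℝ) ≤ D := by exact_mod_cast hD
  have hQ' : (1:ℝ) ≤ Q := by exact_mod_cast hQ
  have hp0 : 0 ≤ p m := (abs_nonneg _).trans (hp m ⟨0, hD⟩)
  set u := v m - ∑ j, inner ℝ (e j) (v m) • e j with hu
  have hu0 : 0 < ‖u‖ := lt_of_le_of_lt (by positivity) hfar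
  have heu : ∀ j, inner ℝ (e j) u = 0 := by
    intro j
    rw [hu, inner_sub_right, h.orth.inner_right_fintype]
    simp
  have hvm : v m = u + ∑ j, inner ℝ (e j) (v m) • e j := by rw [hu]; abel
  have huv : inner ℝ u (v m) = ‖u‖ ^ 2 := by
    rw [hvm, inner_add_right, real_inner_self_eq_norm_sq, inner_sum]
    simp only [real_inner_smul_right]
    have : ∀ j, inner ℝ u (e j) = 0 := fun j => by rw [real_inner_comm]; exact heu j
    simp [this]
  have huvle : ‖u‖ ≤ ‖v m‖ := by
    have h1 := real_inner_le_norm u (v m)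
    rw [huv, sq] at h1
    exact le_of_mul_le_mul_left h1 hu0
  have hvn : ‖v m‖ ≤ D * p m := norm_le_sup _ _ hp0 (hp m)
  have hlast : inner ℝ (‖u‖⁻¹ • u) (v m) = ‖u‖ := by
    rw [real_inner_smul_left, huv]; field_simp
  refine ⟨Fin.snoc (α := fun _ => EuclideanSpace ℝ (Fin D)) e (‖u‖⁻¹ • u), ?_, ?_, ?_, ?_, ?_, ?_, ?_⟩
  · constructor
    · intro i
      refine Fin.lastCases ?_ (fun i => ?_) i
      · simp only [Fin.snoc_last, norm_smul, norm_inv, norm_norm]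
        field_simp
      · simp only [Fin.snoc_castSucc]; exact h.orth.1 i
    · intro i j
      refine Fin.lastCases ?_ (fun i => ?_) i <;> refine Fin.lastCases ?_ (fun j => ?_) j
      · intro hh; exact absurd rfl hh
      · intro _
        simp only [Fin.snoc_last, Fin.snoc_castSucc, real_inner_smul_left]
        rw [real_inner_comm, heu, mul_zero]
      · intro _
        simp only [Fin.snoc_last, Fin.snoc_castSucc, real_inner_smul_right]
        rw [heu, mul_zero]
      · intro hij
        simp only [Fin.snoc_castSucc]
        exact h.orth.2 (fun hh => hij (by rw [hh]))
  · intro i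
    refine Fin.lastCases ?_ (fun i => ?_) i
    · simpa using hm
    · simpa using h.le i
  · intro i
    refine Fin.lastCases ?_ (fun i => ?_) i
    · simp only [Fin.sum_univ_castSucc, Fin.snoc_last, Fin.snoc_castSucc]
      rw [hlast, smul_smul, mul_inv_cancel₀ hu0.ne', one_smul, add_comm]
      exact hvm
    · simp only [Fin.sum_univ_castSucc, Fin.snoc_last, Fin.snoc_castSucc]
      have : inner ℝ (‖u‖⁻¹ • u) (v (n i)) = 0 := by
        rw [h.expand i, inner_sum]
        apply Finset.sum_eq_zero
        intro j _
        rw [real_inner_smul_left, real_inner_smul_right, real_inner_comm (e j) u, heu]; simp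
      rw [this, zero_smul, add_zero]
      exact h.expand i
  · intro i j
    refine Fin.lastCases ?_ (fun i => ?_) i <;> refine Fin.lastCases ?_ (fun j => ?_) j
    · intro hh; exact absurd hh (lt_irrefl _)
    · intro hh; exact absurd hh (not_lt.2 (Fin.le_last _))
    · intro _
      simp only [Fin.snoc_last, Fin.snoc_castSucc]
      rw [h.expand i, inner_sum]
      apply Finset.sum_eq_zero
      intro j _
      rw [real_inner_smul_left, real_inner_smul_right, real_inner_comm (e j) u, heu]; simp
    · intro hij
      simp only [Fin.snoc_castSucc]
      exact h.tri i j (by simpa using hij)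
  · intro i
    refine Fin.lastCases ?_ (fun i => ?_) i
    · simpa using hu0.trans_le huvle
    · simpa using h.pos i
  · intro i
    refine Fin.lastCases ?_ (fun i => ?_) i
    · simp only [Fin.snoc_last]
      rw [hlast]
      refine le_trans ?_ hfar.le
      calc 1 / (4 * Q * D) * ‖v m‖ ≤ 1 / (4 * Q * D) * (D * ρ) := by
            gcongr
            exact hvn.trans (by gcongr)
        _ = _ := by field_simp
    · simpa using h.diag i
  · intro i
    refine Fin.lastCases ?_ (fun i => ?_) i
    · simp only [Fin.snoc_last]
      have h1 : ρ / (4 * Q) ≤ D * p m := hfar.le.trans (huvle.trans hvn)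
      have hR0 : 0 < R := by
        by_contra hc
        push Not at hc
        nlinarith [mul_nonpos_of_nonpos_of_nonneg hc hρ.le, mul_pos (show (0:ℝ) < Q by linarith) (show (0:ℝ) < D by linarith)]
      rw [div_le_iff₀ (by positivity)] at h1
      have h2 : R * ρ ≤ R * (D * p m * (4 * Q)) := by gcongr
      have h3 : (4 * Q * D : ℝ) * 1 ≤ (4 * Q * D) * (R * p m) := by linarith
      exact le_of_mul_le_mul_left h3 (by positivity)
    · simpa using h.low i

lemma greedy {D Y Q : ℕ} (hD : 1 ≤ D) (hQ : 1 ≤ Q)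
    (hQD : 4 * Q * D ^ 2 + 1 ≤ Q ^ 2) (v : ℕ → EuclideanSpace ℝ (Fin D)) (p : ℕ → ℝ)
    (hp : ∀ n k, |v n k| ≤ p n)
    (hdiff : ∀ m n, m ≤ n → ∀ δ, 0 ≤ δ → (∀ k, |v n k - v m k| ≤ δ) → p (n - m) ≤ δ)
    (R : ℝ) (K : ℕ) (hR : ∀ k < K, 4 * Q * D * (Q:ℝ) ^ k ≤ R) :
    ∀ j ≤ K, ∃ s n e, GState v p Y (1 / (4 * Q * D)) R s n e ∧
      ((BB p Y (1 / (Q:ℝ) ^ (K - j))).card : ℝ) * (Q:ℝ) ^ (2 * (K - j) * s) * (∏ i, p (n i)) ^ 2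
        ≤ (BB p Y (1 / (Q:ℝ) ^ K)).card * (Q:ℝ) ^ (2 * s) := by
  have hQ' : (1:ℝ) ≤ Q := by exact_mod_cast hQ
  have hp0 : ∀ m, 0 ≤ p m := fun m => (abs_nonneg _).trans (hp m ⟨0, hD⟩)
  intro j
  induction j with
  | zero =>
    intro _
    refine ⟨0, Fin.elim0, Fin.elim0, ⟨⟨fun i => i.elim0, fun i => i.elim0⟩, fun i => i.elim0, fun i => i.elim0, fun i => i.elim0,
      fun i => i.elim0, fun i => i.elim0, fun i => i.elim0⟩, by simp⟩
  | succ j ih =>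
    intro hj
    obtain ⟨s0, n0, e0, hst, hI⟩ := ih (by omega)
    obtain ⟨k, hk⟩ : ∃ k, K - (j + 1) = k := ⟨_, rfl⟩
    have hk1 : K - j = k + 1 := by omega
    rw [hk1] at hI
    rw [hk]
    set b := ((BB p Y (1 / (Q:ℝ) ^ (k+1))).card : ℝ) with hb
    set bK := ((BB p Y (1 / (Q:ℝ) ^ K)).card : ℝ) with hbK
    let P : ℕ → Prop := fun s => ∃ n e, GState v p Y (1 / (4 * Q * D)) R s n e ∧
      b * (Q:ℝ) ^ (2 * k * s) * (∏ i, p (n i)) ^ 2 ≤ bK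
    have hP0 : P s0 := by
      refine ⟨n0, e0, hst, ?_⟩
      have h1 : (Q:ℝ) ^ (2 * (k + 1) * s0) = (Q:ℝ) ^ (2 * k * s0) * (Q:ℝ) ^ (2 * s0) := by
        rw [← pow_add]; congr 1; ring
      rw [h1] at hI
      have h2 : (0:ℝ) < (Q:ℝ) ^ (2 * s0) := by positivity
      refine le_of_mul_le_mul_right ?_ h2
      linarith
    have hPD : ∀ s, P s → s ≤ D := fun s ⟨n, e, h, _⟩ => h.s_le
    classical
    have hPs : P (Nat.findGreatest P D) := Nat.findGreatest_spec (hPD s0 hP0) hP0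
    have hmax : ¬ P (Nat.findGreatest P D + 1) := by
      intro hc
      have := Nat.le_findGreatest (hPD _ hc) hc
      omega
    generalize Nat.findGreatest P D = s at hPs hmax
    obtain ⟨n, e, hst, hI'⟩ := hPs
    refine ⟨s, n, e, hst, ?_⟩
    have hρ : (0:ℝ) < 1 / (Q:ℝ) ^ k := by positivity
    have hcov := cover_step (Y := Y) hD hQ hst.s_le hQD v p hp hdiff e hst.orth (1 / (Q:ℝ) ^ k) hρ (by
      intro m hm hpm
      by_contra hc
      push Not at hc
      obtain ⟨e', he'⟩ := extend_step hD hQ v p hp R n e hst (1 / (Q:ℝ) ^ k) hρ (by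
        have := hR k (by omega)
        rw [mul_one_div, le_div_iff₀ (by positivity)]
        exact this) m hm hpm hc
      apply hmax
      refine ⟨_, e', he', ?_⟩
      rw [Fin.prod_univ_castSucc]
      simp only [Fin.snoc_castSucc, Fin.snoc_last]
      have h1 : (Q:ℝ) ^ k * p m ≤ 1 := by
        rw [le_div_iff₀ (by positivity)] at hpm; linarith
      have h2 : ((Q:ℝ) ^ k * p m) ^ 2 ≤ 1 := pow_le_one₀ (mul_nonneg (by positivity) (hp0 m)) h1
      calc b * (Q:ℝ) ^ (2 * k * (s + 1)) * ((∏ i, p (n i)) * p m) ^ 2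
          = (b * (Q:ℝ) ^ (2 * k * s) * (∏ i, p (n i)) ^ 2) * ((Q:ℝ) ^ k * p m) ^ 2 := by
            rw [show 2 * k * (s + 1) = 2 * k * s + k * 2 by ring, pow_add, pow_mul _ k 2]; ring
        _ ≤ (b * (Q:ℝ) ^ (2 * k * s) * (∏ i, p (n i)) ^ 2) * 1 := by gcongr
        _ ≤ bK := by linarith)
    rw [div_div, ← pow_succ] at hcov
    have hcov' : ((BB p Y (1 / (Q:ℝ) ^ k)).card : ℝ) ≤ (Q:ℝ) ^ (2 * s) * b := by rw [hb]; exact_mod_cast hcov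
    calc ((BB p Y (1 / (Q:ℝ) ^ k)).card : ℝ) * (Q:ℝ) ^ (2 * k * s) * (∏ i, p (n i)) ^ 2
        ≤ ((Q:ℝ) ^ (2 * s) * b) * (Q:ℝ) ^ (2 * k * s) * (∏ i, p (n i)) ^ 2 := by gcongr
      _ = (b * (Q:ℝ) ^ (2 * k * s) * (∏ i, p (n i)) ^ 2) * (Q:ℝ) ^ (2 * s) := by ring
      _ ≤ bK * (Q:ℝ) ^ (2 * s) := by gcongr

lemma exists_rep0 (x : AddCircle (1:ℝ)) : ∃ y : ℝ, (-(1/2) < y ∧ y ≤ -(1/2) + 1) ∧ (y : AddCircle (1:ℝ)) = x :=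
  ⟨(AddCircle.equivIoc (1:ℝ) (-(1/2)) x).1, (AddCircle.equivIoc (1:ℝ) (-(1/2)) x).2, (AddCircle.equivIoc (1:ℝ) (-(1/2))).left_inv x⟩
lemma norm_rep (y : ℝ) (h : |y| ≤ 1 / 2) : |y| = ‖(y : AddCircle (1:ℝ))‖ := by
  have h0 : (1:ℝ) ≠ 0 := one_ne_zero
  have := (AddCircle.norm_coe_eq_abs_iff (p := (1:ℝ)) (x := y) h0).2 (by rw [abs_one]; exact h)
  exact this.symm
lemma exists_rep_s10 (x : AddCircle (1:ℝ)) : ∃ y ∈ Set.Ioc (-(1/2):ℝ) (1/2), (y : AddCircle (1:ℝ)) = x ∧ |y| = ‖x‖ := by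
  obtain ⟨y, hmem, h1⟩ := exists_rep0 x
  have h2 : y ≤ 1/2 := hmem.2.trans (by norm_num)
  refine ⟨y, ⟨hmem.1, h2⟩, h1, ?_⟩
  rw [← h1]
  exact norm_rep y (abs_le.2 ⟨hmem.1.le, h2⟩)

lemma numerics (r D N : ℕ) (hr : 10 ≤ r) (hD : D = 1 * r ^ 2)
    (hN : (N : ℝ) ≥ (D : ℝ) ^ ((1000:ℝ) * (D : ℝ) ^ 2)) :
    100 ≤ D ∧ (D:ℝ) ^ ((1000:ℝ) * D) ≤ (N : ℝ) ^ ((1 : ℝ) / r) := by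
  have hD100 : 100 ≤ D := by subst hD; nlinarith
  refine ⟨hD100, ?_⟩
  have hD1 : (1:ℝ) ≤ D := by exact_mod_cast (by omega : 1 ≤ D)
  have hr1 : (10:ℝ) ≤ r := by exact_mod_cast hr
  have hrD : (r:ℝ) ≤ D := by
    have : r ≤ D := by subst hD; nlinarith
    exact_mod_cast this
  calc (D:ℝ) ^ ((1000:ℝ) * D) ≤ (D:ℝ) ^ (((1000:ℝ) * (D : ℝ) ^ 2) * (1 / r)) := by
        apply Real.rpow_le_rpow_of_exponent_le hD1
        rw [mul_one_div, le_div_iff₀ (by linarith)]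
        nlinarith
    _ = ((D:ℝ) ^ ((1000:ℝ) * (D : ℝ) ^ 2)) ^ ((1:ℝ) / r) := by rw [Real.rpow_mul (by linarith)]
    _ ≤ _ := Real.rpow_le_rpow (by positivity) hN (by positivity)

/-- powers of `X` dominate powers of `D`. -/
lemma rpow_dom (D : ℕ) (X a b : ℝ) (hD : 100 ≤ D) (hX : (D:ℝ) ^ ((1000:ℝ) * D) ≤ X) (ha : 0 ≤ a)
    (hb : b ≤ 1000 * D * a) : (D:ℝ) ^ b ≤ X ^ a := by
  have hD1 : (1:ℝ) ≤ D := by exact_mod_cast (by omega : 1 ≤ D)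
  calc (D:ℝ) ^ b ≤ (D:ℝ) ^ (1000 * D * a) := Real.rpow_le_rpow_of_exponent_le hD1 hb
    _ = ((D:ℝ) ^ ((1000:ℝ) * D)) ^ a := by rw [Real.rpow_mul (by linarith)]
    _ ≤ _ := Real.rpow_le_rpow (by positivity) hX ha

theorem statement10 :
    ∃ C₁ C₂ : ℝ, 0 < C₁ ∧ 0 < C₂ ∧ ∃ C₃ : ℕ, 0 < C₃ ∧
    ∃ r₀ : ℕ, ∀ r : ℕ, r₀ ≤ r → ∀ D : ℕ, D = C₃ * r ^ 2 →
    ∀ N : ℕ, (N : ℝ) ≥ (D : ℝ) ^ (C₂ * (D : ℝ) ^ 2) →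
    ∀ X : ℝ, X = (N : ℝ) ^ ((1 : ℝ) / r) →
    ∀ d : ℕ, 1 ≤ d → (d : ℝ) ≤ (N : ℝ) / X →
    ∀ θ : Fin D → AddCircle (1 : ℝ), Diophantine C₂ r D N θ →
    ∃ s : ℕ, 1 ≤ s ∧ s ≤ D ∧
    ∃ n : Fin s → ℕ, (∀ i, 0 < n i) ∧ (∀ i, 0 < ‖(d * n i) • θ‖) ∧
    ∃ L : Fin s → ℝ, (∀ i, L i = ‖(d * n i) • θ‖⁻¹) ∧
    ∃ v : Fin s → (Fin D → ℝ),
      (∀ i j, v i j ∈ Set.Ioc (-(1 / 2) : ℝ) (1 / 2)) ∧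
      (∀ i, torusProj (v i) = (d * n i) • θ) ∧
      (X ^ ((1 : ℝ) / 80) ≤ ∏ i, L i) ∧
      ((∑ i, (n i : ℝ) * L i) ≤ X / 2) ∧
      ((D : ℝ) ^ (-(C₁ * D)) ≤ Real.sqrt
        (Matrix.det (Matrix.of fun i j : Fin s =>
          ∑ k, (v i k / l2 (v i)) * (v j k / l2 (v j))))) ∧
      (∀ i, L i ≤ X ^ (C₁ / D)) := by
  refine ⟨5, 1000, by norm_num, by norm_num, 1, by norm_num, 10, ?_⟩
  intro r hr D hD N hN X hX d hd hdX θ hθ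
  obtain ⟨hD100, hXD⟩ := numerics r D N hr hD hN
  rw [← hX] at hXD
  have hcount := hθ.2 d hd (by rw [← hX]; exact hdX)
  rw [← hX] at hcount
  clear hθ hN hD
  have hD1 : 1 ≤ D := by omega
  have hDr : (100:ℝ) ≤ D := by exact_mod_cast hD100
  have hD0 : (0:ℝ) < D := by linarith
  have dom := fun a b ha hb => rpow_dom D X a b hD100 hXD ha hb
  have hX1 : 1 < X := by
    have := dom 1 1 (by norm_num) (by linarith)
    rw [Real.rpow_one, Real.rpow_one] at this
    linarith
  have hX0 : 0 < X := by linarith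
  choose f hf1 hf2 hf3 using exists_rep_s10
  let p : ℕ → ℝ := fun n => ‖(d * n) • θ‖
  let vf : ℕ → Fin D → ℝ := fun n j => f (((d * n) • θ) j)
  let v : ℕ → EuclideanSpace ℝ (Fin D) := fun n => WithLp.toLp 2 (vf n)
  have hp : ∀ n k, |v n k| ≤ p n := by
    intro n k
    simp only [v, vf, p, hf3]
    exact norm_le_pi_norm ((d * n) • θ) k
  have hdiff : ∀ m n, m ≤ n → ∀ δ, 0 ≤ δ → (∀ k, |v n k - v m k| ≤ δ) → p (n - m) ≤ δ := by
    intro m n hmn δ hδ h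
    simp only [p]
    rw [pi_norm_le_iff_of_nonneg hδ]
    intro k
    have h1 : ((d * (n - m)) • θ) k = ((v n k - v m k : ℝ) : AddCircle (1:ℝ)) := by
      rw [AddCircle.coe_sub]
      simp only [v, vf, hf2]
      rw [Nat.mul_sub, ← Pi.sub_apply, sub_nsmul θ (Nat.mul_le_mul_left d hmn), sub_eq_add_neg]
    rw [h1]
    refine le_trans ?_ (h k)
    exact QuotientAddGroup.norm_mk_le_norm
  have hp0 : ∀ n, 0 ≤ p n := fun n => norm_nonneg _
  -- parameters
  obtain ⟨Q, hQ⟩ : ∃ Q, Q = D ^ 3 := ⟨_, rfl⟩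
  have hQ1 : 1 ≤ Q := by rw [hQ]; exact Nat.one_le_pow _ _ hD1
  have hQr : (Q:ℝ) = (D:ℝ) ^ 3 := by rw [hQ]; push_cast; rfl
  have hQD : 4 * Q * D ^ 2 + 1 ≤ Q ^ 2 := by
    have h1 : 5 * D ^ 5 ≤ D ^ 6 := by rw [pow_succ D 5, mul_comm]; gcongr; omega
    have h2 : 1 ≤ D ^ 5 := Nat.one_le_pow _ _ hD1
    rw [hQ]; ring_nf; ring_nf at h1 h2; omega
  have hQ2 : (2:ℝ) ≤ Q := by
    have h1 : 5 ≤ D ^ 3 := le_trans (by omega) (Nat.le_self_pow (by norm_num) D)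
    rw [← hQ] at h1
    exact_mod_cast (by omega : 2 ≤ Q)
  have hQ0 : (0:ℝ) < Q := by linarith
  set Z : ℝ := X ^ ((1:ℝ) / D) with hZ
  have hZ0 : 0 < Z := by positivity
  have hKex : ∃ K, Z ≤ (Q:ℝ) ^ K := by
    obtain ⟨K, hK⟩ := pow_unbounded_of_one_lt Z (by linarith : (1:ℝ) < Q)
    exact ⟨K, hK.le⟩
  classical
  obtain ⟨K, hK, hKmin⟩ : ∃ K, Z ≤ (Q:ℝ) ^ K ∧ ∀ k < K, (Q:ℝ) ^ k ≤ Z :=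
    ⟨Nat.find hKex, Nat.find_spec hKex, fun k hk => (not_le.1 (Nat.find_min hKex hk)).le⟩
  set R : ℝ := 4 * Q * D * Z with hRdef
  have hR : ∀ k < K, 4 * Q * D * (Q:ℝ) ^ k ≤ R := by
    intro k hk
    have := hKmin k hk
    rw [hRdef]
    gcongr
  have hR0 : 0 < R := by positivity
  have h4D : (4:ℝ) * Q * D ≤ (D:ℝ) ^ (5:ℝ) := by
    have : (D:ℝ) ^ (5:ℝ) = D ^ 5 := by exact_mod_cast Real.rpow_natCast (D:ℝ) 5
    rw [this, hQr]
    have : (0:ℝ) < D ^ 4 := by positivity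
    nlinarith
  have hRX : R ≤ X ^ ((2:ℝ) / D) := by
    have h1 : (4:ℝ) * Q * D ≤ Z := h4D.trans (dom (1 / D) 5 (by positivity) (by
      rw [mul_one_div, mul_div_assoc, div_self hD0.ne']; norm_num))
    calc R ≤ Z * Z := by rw [hRdef]; gcongr
      _ = X ^ ((2:ℝ) / D) := by rw [hZ, ← Real.rpow_add hX0]; congr 1; ring
  obtain ⟨Y, hY⟩ : ∃ Y, Y = ⌊X ^ (0.97:ℝ)⌋₊ := ⟨_, rfl⟩
  have hYle : (Y:ℝ) ≤ X ^ (0.97:ℝ) := by rw [hY]; exact Nat.floor_le (by positivity)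
  have hYge : X ^ (0.97:ℝ) ≤ Y + 1 := by rw [hY]; exact (Nat.lt_floor_add_one _).le
  obtain ⟨s, n, e, hst, hI⟩ := greedy (Y := Y) hD1 hQ1 hQD v p hp hdiff R K hR K le_rfl
  have hsD := hst.s_le
  have hpp : ∀ i, 0 < p (n i) := by
    intro i
    rcases (hp0 (n i)).lt_or_eq with h | h
    · exact h
    · have := hst.low i
      rw [← h] at this
      norm_num at this
  have hL : ∀ i, (p (n i))⁻¹ ≤ R := by
    intro i
    rw [inv_le_iff_one_le_mul₀ (hpp i)]
    exact hst.low i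
  -- counting
  have hb0 : (BB p Y (1 / (Q:ℝ) ^ (K - K))).card = Y + 1 := by
    simp only [BB]
    rw [Finset.filter_true_of_mem]
    · simp
    · intro m _
      simp only [Nat.sub_self, pow_zero, div_one, p]
      rw [pi_norm_le_iff_of_nonneg zero_le_one]
      intro k
      rw [← hf3, abs_le]
      have := hf1 (((d * m) • θ) k)
      constructor <;> linarith [this.1, this.2]
  have hbK : ((BB p Y (1 / (Q:ℝ) ^ K)).card : ℝ) ≤ 2 * X ^ ((9:ℝ) / 10) := by
    set S := {n : ℕ | 1 ≤ n ∧ (n : ℝ) ≤ X ∧ ‖(d * n) • θ‖ ≤ X ^ (-(1 : ℝ) / D)} with hS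
    have hSfin : S.Finite := by
      apply (Set.finite_Iic ⌊X⌋₊).subset
      intro m hm
      exact Nat.le_floor hm.2.1
    have hsub : BB p Y (1 / (Q:ℝ) ^ K) ⊆ insert 0 hSfin.toFinset := by
      intro m hm
      simp only [BB, Finset.mem_filter, Finset.mem_range] at hm
      rcases Nat.eq_zero_or_pos m with h | h
      · simp [h]
      · apply Finset.mem_insert_of_mem
        rw [Set.Finite.mem_toFinset]
        refine ⟨h, ?_, ?_⟩
        · have h1 : (m:ℝ) ≤ Y := by exact_mod_cast (by omega : m ≤ Y)
          calc (m:ℝ) ≤ X ^ (0.97:ℝ) := h1.trans hYle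
            _ ≤ X ^ (1:ℝ) := Real.rpow_le_rpow_of_exponent_le hX1.le (by norm_num)
            _ = X := Real.rpow_one X
        · refine hm.2.trans ?_
          rw [neg_div, Real.rpow_neg hX0.le, ← hZ, one_div]
          exact inv_anti₀ hZ0 hK
    have h1 := (Finset.card_le_card hsub).trans (Finset.card_insert_le _ _)
    rw [← Set.ncard_eq_toFinset_card S hSfin] at h1
    have h2 : ((BB p Y (1 / (Q:ℝ) ^ K)).card : ℝ) ≤ S.ncard + 1 := by exact_mod_cast h1
    have h3 : 1 ≤ X ^ ((9:ℝ) / 10) := Real.one_le_rpow hX1.le (by norm_num)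
    linarith
  rw [hb0] at hI
  have hprodpos : 0 < ∏ i, p (n i) := Finset.prod_pos fun i _ => hpp i
  have hI2 : X ^ (0.97:ℝ) * (∏ i, p (n i)) ^ 2 ≤ 2 * X ^ ((9:ℝ) / 10) * (D:ℝ) ^ (6 * (D:ℝ)) := by
    simp only [Nat.sub_self, mul_zero, zero_mul, pow_zero, mul_one] at hI
    push_cast at hI
    calc X ^ (0.97:ℝ) * (∏ i, p (n i)) ^ 2 ≤ (Y + 1) * (∏ i, p (n i)) ^ 2 := by gcongr
      _ ≤ _ := hI
      _ ≤ 2 * X ^ ((9:ℝ) / 10) * (Q:ℝ) ^ (2 * D) := by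
        gcongr
        linarith
      _ = _ := by
        congr 1
        rw [hQr, ← pow_mul, ← Real.rpow_natCast]
        congr 1
        push_cast; ring
  have hprod : X ^ ((1:ℝ) / 80) ≤ ∏ i, (p (n i))⁻¹ := by
    rw [Finset.prod_inv_distrib]
    rw [le_inv_comm₀ (by positivity) hprodpos, ← Real.rpow_neg hX0.le]
    rw [← pow_le_pow_iff_left₀ hprodpos.le (by positivity) two_ne_zero]
    have h1 : 2 * (D:ℝ) ^ (6 * (D:ℝ)) ≤ X ^ (0.045:ℝ) := by
      calc 2 * (D:ℝ) ^ (6 * (D:ℝ)) ≤ (D:ℝ) ^ (1:ℝ) * (D:ℝ) ^ (6 * (D:ℝ)) := by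
            gcongr
            rw [Real.rpow_one]; linarith
        _ = (D:ℝ) ^ (1 + 6 * (D:ℝ)) := by rw [Real.rpow_add hD0]
        _ ≤ _ := dom _ _ (by norm_num) (by linarith)
    have h2 : (X ^ (-((1:ℝ) / 80))) ^ 2 = X ^ (-(0.025:ℝ)) := by
      rw [← Real.rpow_natCast, ← Real.rpow_mul hX0.le]; norm_num
    have h3 : X ^ (0.97:ℝ) * X ^ (-(0.025:ℝ)) = X ^ ((9:ℝ) / 10) * X ^ (0.045:ℝ) := by
      rw [← Real.rpow_add hX0, ← Real.rpow_add hX0]; norm_num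
    have h4 : 0 < X ^ (0.97:ℝ) := by positivity
    have h5 : 0 < X ^ ((9:ℝ) / 10) := by positivity
    rw [h2]
    refine le_of_mul_le_mul_left ?_ h4
    rw [h3]
    refine hI2.trans ?_
    calc _ = X ^ ((9:ℝ) / 10) * (2 * (D:ℝ) ^ (6 * (D:ℝ))) := by ring
      _ ≤ _ := by gcongr
  have hs1 : 1 ≤ s := by
    by_contra hc
    have hs0 : s = 0 := by omega
    subst hs0
    simp only [Finset.univ_eq_empty, Finset.prod_empty] at hprod
    exact absurd hprod (not_le.2 (Real.one_lt_rpow hX1 (by norm_num)))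
  have hv0 : v 0 = 0 := by
    have h1 : p 0 = 0 := by simp [p]
    ext k
    have := hp 0 k
    rw [h1] at this
    simpa using abs_nonpos_iff.1 this
  refine ⟨s, hs1, hsD, n, ?_, hpp, fun i => (p (n i))⁻¹, fun i => rfl, fun i => vf (n i), ?_, ?_, hprod, ?_, ?_, ?_⟩
  · intro i
    rcases Nat.eq_zero_or_pos (n i) with h | h
    · have := hst.pos i
      rw [h, hv0] at this
      simp at this
    · exact h
  · intro i j
    exact hf1 _
  · intro i
    funext j
    exact hf2 _
  · calc ∑ i, (n i : ℝ) * (p (n i))⁻¹ ≤ ∑ _i : Fin s, X ^ (0.97:ℝ) * X ^ ((2:ℝ) / D) := by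
          refine Finset.sum_le_sum fun i _ => mul_le_mul ?_ ?_ (inv_nonneg.2 (hp0 _)) (by positivity)
          · exact le_trans (by exact_mod_cast hst.le i) hYle
          · exact (hL i).trans hRX
      _ = s * (X ^ (0.97:ℝ) * X ^ ((2:ℝ) / D)) := by simp
      _ ≤ D * (X ^ (0.97:ℝ) * X ^ (0.02:ℝ)) := by
          gcongr
          · exact hX1.le
          · rw [div_le_iff₀ hD0]; linarith
      _ = D * X ^ (0.99:ℝ) := by rw [← Real.rpow_add hX0]; norm_num
      _ ≤ X / 2 := by
          have h1 := dom 0.01 2 (by norm_num) (by linarith)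
          have h2 : (D:ℝ) ^ (2:ℝ) = D ^ 2 := by exact_mod_cast Real.rpow_natCast (D:ℝ) 2
          have h3 : X = X ^ (0.01:ℝ) * X ^ (0.99:ℝ) := by
            rw [← Real.rpow_add hX0]; norm_num
          have h4 : 2 * (D:ℝ) ≤ X ^ (0.01:ℝ) := by rw [h2] at h1; nlinarith
          have h5 : 0 < X ^ (0.99:ℝ) := by positivity
          have h6 := mul_le_mul_of_nonneg_right h4 h5.le
          rw [← h3] at h6
          linarith
  · have hg := gram_bound e (fun i => v (n i)) (1 / (4 * Q * D)) (by positivity) hst.expand hst.tri hst.pos hst.diag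
    have hl2 : ∀ i, ‖v (n i)‖ = l2 (vf (n i)) := by
      intro i
      rw [EuclideanSpace.norm_eq, l2]
      simp [v]
    simp only [hl2] at hg
    refine le_trans ?_ hg
    have h1 : (D:ℝ) ^ (-(5:ℝ)) ≤ 1 / (4 * Q * D) := by
      rw [Real.rpow_neg hD0.le, one_div]
      exact inv_anti₀ (by positivity) h4D
    have h2 : (1:ℝ) / (4 * Q * D) ≤ 1 := by
      rw [div_le_one (by positivity)]
      nlinarith
    calc (D:ℝ) ^ (-(5 * (D:ℝ))) = ((D:ℝ) ^ (-(5:ℝ))) ^ D := by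
          rw [← Real.rpow_natCast, ← Real.rpow_mul hD0.le]; congr 1; ring
      _ ≤ (1 / (4 * Q * D)) ^ D := by gcongr
      _ ≤ (1 / (4 * Q * D)) ^ s := pow_le_pow_of_le_one (by positivity) h2 hsD
  · intro i
    refine (hL i).trans (hRX.trans ?_)
    apply Real.rpow_le_rpow_of_exponent_le hX1.le
    gcongr
    norm_num

end
end

section
/- Let D be a sufficiently large integer, let X ≥ 1 be a real number, and let α ∈ 𝕋^D. Then there exist positive integers n₁,…,n_{D+1} and positive reals L'₁,…,L'_{D+1} such that: (1) the sums ∑_{i=1}^{D+1} ℓ_i n_i, taken over integer tuples (ℓ₁,…,ℓ_{D+1}) with 0 ≤ ℓ_i < L'_i, are pairwise distinct and each at most D^{−D}X; (2) ‖α n_i‖_{𝕋^D} ≤ 1/L'_i for each i; and (3) ∏_{i=1}^{D+1} L'_i ≥ D^{−3D}X. -/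
noncomputable section

open MeasureTheory Module

lemma volume_box {d : ℕ} (e : OrthonormalBasis (Fin d) ℝ (EuclideanSpace ℝ (Fin d)))
    (c : Fin d → ℝ) :
    volume {x : EuclideanSpace ℝ (Fin d) | ∀ i, |e.repr x i| < c i} =
      ∏ i, ENNReal.ofReal (2 * c i) := by
  have h2 : volume (Set.univ.pi fun i => Set.Ioo (-c i) (c i)) = ∏ i, ENNReal.ofReal (2 * c i) := by
    rw [volume_pi, Measure.pi_pi]
    refine Finset.prod_congr rfl fun i _ => ?_
    rw [Real.volume_Ioo]; congr 1; ring
  rw [← h2]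
  have hm := (EuclideanSpace.volume_preserving_symm_measurableEquiv_toLp (Fin d)).comp
    e.measurePreserving_repr
  rw [← hm.measure_preimage (MeasurableSet.univ_pi fun i => measurableSet_Ioo).nullMeasurableSet]
  congr 1
  ext x
  simp [abs_lt, Set.mem_pi]

lemma minkowski_box {d : ℕ} (b : Basis (Fin d) ℝ (EuclideanSpace ℝ (Fin d)))
    (e : OrthonormalBasis (Fin d) ℝ (EuclideanSpace ℝ (Fin d)))
    (c : Fin d → ℝ) (hc : ∀ i, 0 < c i)
    (h : |(EuclideanSpace.basisFun (Fin d) ℝ).toBasis.det b| < ∏ i, c i) :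
    ∃ x ∈ Submodule.span ℤ (Set.range b), x ≠ 0 ∧ ∀ i, |e.repr x i| < c i := by
  have hcount : Countable (Submodule.span ℤ (Set.range b)) := inferInstance
  have : Countable (Submodule.span ℤ (Set.range b)).toAddSubgroup := hcount
  have key := exists_ne_zero_mem_lattice_of_measure_mul_two_pow_lt_measure
    (s := {x : EuclideanSpace ℝ (Fin d) | ∀ i, |e.repr x i| < c i})
    (ZSpan.isAddFundamentalDomain' b volume) ?_ ?_ ?_
  · obtain ⟨x, hx, hs⟩ := key
    exact ⟨x, x.2, by simpa using hx, hs⟩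
  · intro x hx i
    simpa using hx i
  · intro x hx y hy s t hs ht hst i
    have h1 := hx i
    have h2 := hy i
    simp only [map_add, map_smul, PiLp.add_apply, PiLp.smul_apply, smul_eq_mul]
    rw [abs_lt] at *
    rcases hs.eq_or_lt with rfl | hs'
    · have : t = 1 := by linarith
      subst this
      constructor <;> linarith
    · have h3 : c i = s * c i + t * c i := by rw [← add_mul, hst, one_mul]
      constructor <;> nlinarith [mul_lt_mul_of_pos_left h1.1 hs', mul_lt_mul_of_pos_left h1.2 hs',
         mul_le_mul_of_nonneg_left h2.1.le ht, mul_le_mul_of_nonneg_left h2.2.le ht]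
  · rw [volume_box, ZSpan.measure_fundamentalDomain b volume (EuclideanSpace.basisFun (Fin d) ℝ).toBasis,
      measure_congr (ZSpan.fundamentalDomain_ae_parallelepiped _ volume),
      OrthonormalBasis.coe_toBasis, OrthonormalBasis.volume_parallelepiped, mul_one,
      finrank_euclideanSpace_fin, ← ENNReal.ofReal_prod_of_nonneg (fun i _ => by linarith [hc i]),
      Finset.prod_mul_distrib, Finset.prod_const, Finset.card_univ, Fintype.card_fin,
      mul_comm, ENNReal.ofReal_mul (by positivity)]
    have : ENNReal.ofReal (2 ^ d) = 2 ^ d := by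
      rw [ENNReal.ofReal_pow (by norm_num)]; simp
    rw [this]
    refine ENNReal.mul_lt_mul_right (by simp) (by simp) ?_
    exact (ENNReal.ofReal_lt_ofReal_iff (Finset.prod_pos fun i _ => hc i)).2 h

lemma greedy_s14 {d : ℕ} (b : Basis (Fin d) ℝ (EuclideanSpace ℝ (Fin d))) (k : ℕ) (hk : k ≤ d) :
    ∃ v : Fin k → EuclideanSpace ℝ (Fin d), (∀ i, v i ∈ Submodule.span ℤ (Set.range b)) ∧
      LinearIndependent ℝ v ∧ ∀ x ∈ Submodule.span ℤ (Set.range b), ∀ j : Fin k,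
        x ∉ Submodule.span ℝ (v '' {i | i < j}) → ‖v j‖ ≤ ‖x‖ := by
  induction k with
  | zero => exact ⟨Fin.elim0, fun i => i.elim0, linearIndependent_empty_type, fun _ _ j => j.elim0⟩
  | succ k ih =>
    obtain ⟨v, hv, hli, hmin⟩ := ih (by omega)
    have hex : ∃ x ∈ Submodule.span ℤ (Set.range b), x ∉ Submodule.span ℝ (Set.range v) := by
      by_contra! hcon
      have h1 : (⊤ : Submodule ℝ (EuclideanSpace ℝ (Fin d))) ≤ Submodule.span ℝ (Set.range v) := by
        rw [← b.span_eq, Submodule.span_le]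
        rintro _ ⟨i, rfl⟩
        exact hcon _ (Submodule.subset_span ⟨i, rfl⟩)
      have h2 := finrank_range_le_card (R := ℝ) v
      rw [Set.finrank, top_le_iff.1 h1, finrank_top, finrank_euclideanSpace_fin] at h2
      simp at h2; omega
    obtain ⟨x₀, hx₀, hx₀'⟩ := hex
    have hfin : ((Metric.closedBall 0 ‖x₀‖ ∩ Submodule.span ℤ (Set.range b)) ∩
        {x | x ∉ Submodule.span ℝ (Set.range v)} : Set (EuclideanSpace ℝ (Fin d))).Finite :=
      (ZSpan.setFinite_inter b Metric.isBounded_closedBall).subset Set.inter_subset_left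
    obtain ⟨y, ⟨⟨hy1, hy2⟩, hy3⟩, hymin⟩ := Set.exists_min_image _ (fun x => ‖x‖) hfin
      ⟨x₀, ⟨by simp, hx₀⟩, hx₀'⟩
    refine ⟨Fin.snoc v y, ?_, linearIndependent_finSnoc.2 ⟨hli, hy3⟩, ?_⟩
    · intro i
      refine Fin.lastCases ?_ (fun i => ?_) i
      · simpa using hy2
      · simpa using hv i
    · intro x hx j
      have himg : ∀ j : Fin k, (Fin.snoc v y : Fin (k+1) → _) '' {i | i < j.castSucc} = v '' {i | i < j} := by
        intro j
        ext z
        constructor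
        · rintro ⟨i, hi, rfl⟩
          induction i using Fin.lastCases with
          | last => exact absurd (show Fin.last k < j.castSucc from hi) (by simp [Fin.le_last])
          | cast i => exact ⟨i, by simpa using hi, by simp⟩
        · rintro ⟨i, hi, rfl⟩
          exact ⟨i.castSucc, by simpa using hi, by simp⟩
      induction j using Fin.lastCases with
      | cast j =>
        rw [himg]
        simpa using hmin x hx j
      | last =>
        have : (Fin.snoc v y : Fin (k+1) → _) '' {i | i < Fin.last k} = Set.range v := by
          ext z
          constructor
          · rintro ⟨i, hi, rfl⟩
            induction i using Fin.lastCases with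
            | last => exact absurd hi (by simp)
            | cast i => exact ⟨i, by simp⟩
          · rintro ⟨i, rfl⟩
            exact ⟨i.castSucc, by simp [Fin.castSucc_lt_last], by simp⟩
        rw [this]
        intro hxs
        simp only [Fin.snoc_last]
        by_cases hxn : ‖x‖ ≤ ‖x₀‖
        · exact hymin x ⟨⟨by simpa using hxn, hx⟩, hxs⟩
        · have := hymin x₀ ⟨⟨by simp, hx₀⟩, hx₀'⟩
          exact this.trans (not_le.1 hxn).le

lemma lattice_succ_min {d : ℕ} (b : Basis (Fin d) ℝ (EuclideanSpace ℝ (Fin d))) :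
    ∃ v : Fin d → EuclideanSpace ℝ (Fin d), (∀ i, v i ∈ Submodule.span ℤ (Set.range b)) ∧
      LinearIndependent ℝ v ∧
      ∏ i, ‖v i‖ ≤ √d ^ d * |(EuclideanSpace.basisFun (Fin d) ℝ).toBasis.det b| := by
  obtain ⟨v, hv, hli, hmin⟩ := greedy_s14 b d le_rfl
  refine ⟨v, hv, hli, ?_⟩
  by_contra! hcon
  have hpos : ∀ i, 0 < ‖v i‖ := fun i => norm_pos_iff.2 (hli.ne_zero i)
  rcases Nat.eq_zero_or_pos d with rfl | hd
  · simp at hcon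
  have hd' : (0 : ℝ) < √d := Real.sqrt_pos.2 (by exact_mod_cast hd)
  have hcard : finrank ℝ (EuclideanSpace ℝ (Fin d)) = Fintype.card (Fin d) := by simp
  set e := InnerProductSpace.gramSchmidtOrthonormalBasis hcard v with he
  obtain ⟨x, hx, hx0, hxe⟩ := minkowski_box b e (fun i => ‖v i‖ / √d)
    (fun i => div_pos (hpos i) hd') (by
      rw [Finset.prod_div_distrib, lt_div_iff₀ (by simp; positivity)]
      simpa [mul_comm] using hcon)
  -- the least k such that x lies in the span of the vectors with index at most k
  have htop : Submodule.span ℝ (Set.range v) = ⊤ :=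
    hli.span_eq_top_of_card_eq_finrank' (by simp)
  have hP : ∃ k : ℕ, ∃ hk : k < d, x ∈ Submodule.span ℝ (v '' {i | i ≤ ⟨k, hk⟩}) := by
    refine ⟨d - 1, by omega, ?_⟩
    have : {i : Fin d | i ≤ ⟨d - 1, by omega⟩} = Set.univ := by
      ext i; simp [Fin.le_def]; omega
    rw [this, Set.image_univ, htop]; trivial
  classical
  obtain ⟨hk, hxk⟩ := Nat.find_spec hP
  have hlt := fun m => Nat.find_min hP (m := m)
  set k := Nat.find hP with hkdef
  have hnot : x ∉ Submodule.span ℝ (v '' {i | i < ⟨k, hk⟩}) := by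
    intro hmem
    rcases Nat.eq_zero_or_pos k with h0 | h0
    · have : {i : Fin d | i < ⟨k, hk⟩} = ∅ := by
        ext i; simp [Fin.lt_def]; omega
      rw [this] at hmem
      simp at hmem
      exact hx0 hmem
    · refine hlt (k - 1) (by omega) ⟨by omega, ?_⟩
      have hset : {i : Fin d | i ≤ ⟨k - 1, by omega⟩} = {i : Fin d | i < ⟨k, hk⟩} := by
        ext i
        simp only [Set.mem_setOf_eq, Fin.le_def, Fin.lt_def]
        omega
      rw [hset]
      exact hmem
  have hnorm := hmin x hx ⟨k, hk⟩ hnot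
  have hzero : ∀ j : Fin d, (⟨k, hk⟩ : Fin d) < j → e.repr x j = 0 := by
    intro j hj
    refine Submodule.span_induction (p := fun y _ => e.repr y j = 0) ?_ ?_ ?_ ?_ hxk
    · rintro _ ⟨i, hi, rfl⟩
      exact InnerProductSpace.gramSchmidtOrthonormalBasis_inv_triangular' hcard v (lt_of_le_of_lt hi hj)
    · simp
    · intro y z _ _ h1 h2; simp [h1, h2]
    · intro a y _ h1; simp [h1]
  have hmono : ∀ j : Fin d, j ≤ ⟨k, hk⟩ → ‖v j‖ ≤ ‖x‖ := by
    intro j hj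
    refine hmin x hx j fun hmem => hnot ?_
    exact Submodule.span_mono (Set.image_mono fun i hi => lt_of_lt_of_le hi hj) hmem
  have hxpos : 0 < ‖x‖ := norm_pos_iff.2 hx0
  have hb : ∀ j, |e.repr x j| < ‖x‖ / √d := by
    intro j
    rcases le_or_gt j ⟨k, hk⟩ with h | h
    · exact (hxe j).trans_le (by have := hmono j h; gcongr)
    · rw [hzero j h, abs_zero]; positivity
  have h3 : ‖x‖ ^ 2 < ‖x‖ ^ 2 := by
    calc ‖x‖ ^ 2 = ∑ j, (e.repr x j) ^ 2 := by
          rw [← e.repr.norm_map x, EuclideanSpace.real_norm_sq_eq]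
      _ < ∑ j : Fin d, (‖x‖ / √d) ^ 2 := by
          refine Finset.sum_lt_sum_of_nonempty ⟨⟨0, hd⟩, Finset.mem_univ _⟩ fun j _ => ?_
          rw [← sq_abs]
          exact pow_lt_pow_left₀ (hb j) (abs_nonneg _) (by norm_num)
      _ = ‖x‖ ^ 2 := by
          have : (d : ℝ) ≠ 0 := by positivity
          simp [div_pow]
          field_simp
  exact lt_irrefl _ h3

lemma final_bound (D : ℕ) (hD : 6 ≤ D) :
    √((D + 1 : ℕ) : ℝ) ^ (D + 1) * ((D + 1 : ℕ) : ℝ) ^ (D + 1) ≤ (D : ℝ) ^ (2 * D) := by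
  have hD' : (6 : ℝ) ≤ D := by exact_mod_cast hD
  have h0 : (0 : ℝ) < D := by linarith
  have h1 : ((D : ℝ) + 1) ^ D ≤ 3 * (D : ℝ) ^ D := by
    have h2 : (1 + 1 / (D : ℝ)) ^ D ≤ 3 := by
      have := Real.add_one_le_exp (1 / (D : ℝ))
      calc (1 + 1 / (D : ℝ)) ^ D ≤ (Real.exp (1 / D)) ^ D := by
            rw [add_comm]; gcongr
        _ = Real.exp 1 := by rw [← Real.exp_nat_mul]; congr 1; field_simp
        _ ≤ 3 := by linarith [Real.exp_one_lt_d9]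
    have h3 : ((D : ℝ) + 1) = (1 + 1 / (D : ℝ)) * D := by field_simp
    rw [h3, mul_pow]; gcongr
  refine (sq_le_sq₀ (by positivity) (by positivity)).1 ?_
  push_cast
  have hs : √((D : ℝ) + 1) ^ 2 = D + 1 := Real.sq_sqrt (by positivity)
  calc (√((D : ℝ) + 1) ^ (D + 1) * ((D : ℝ) + 1) ^ (D + 1)) ^ 2
      = (√((D : ℝ) + 1) ^ 2) ^ (D + 1) * (((D : ℝ) + 1) ^ (D + 1)) ^ 2 := by ring
    _ = (((D : ℝ) + 1) ^ D) ^ 3 * ((D : ℝ) + 1) ^ 3 := by rw [hs]; ring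
    _ ≤ (3 * (D : ℝ) ^ D) ^ 3 * (2 * (D : ℝ)) ^ 3 := by gcongr; linarith
    _ = 6 ^ 3 * (D : ℝ) ^ (3 * D + 3) := by ring
    _ ≤ (D : ℝ) ^ 3 * (D : ℝ) ^ (3 * D + 3) := by gcongr
    _ = (D : ℝ) ^ (3 * D + 6) := by ring
    _ ≤ (D : ℝ) ^ (4 * D) := by
        apply pow_le_pow_right₀ (by linarith); omega
    _ = ((D : ℝ) ^ (2 * D)) ^ 2 := by ring

lemma approx_basis (D : ℕ) (N : ℝ) (hN : 0 < N) (a : Fin D → ℝ) :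
    ∃ v : Fin (D + 1) → EuclideanSpace ℝ (Fin (D + 1)),
      ∃ n : Fin (D + 1) → ℤ, ∃ m : Fin (D + 1) → Fin D → ℤ,
      (∀ i, v i 0 = n i / N) ∧ (∀ i j, v i (Fin.succ j) = n i * a j + m i j) ∧
      LinearIndependent ℝ v ∧ ∏ i, ‖v i‖ ≤ √((D + 1 : ℕ) : ℝ) ^ (D + 1) * (1 / N) := by
  let A : Matrix (Fin (D + 1)) (Fin (D + 1)) ℝ := Matrix.of
    (Fin.cons (Fin.cons (1 / N) a) (fun k => Fin.cons 0 (Pi.single k 1)))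
  let w : Fin (D + 1) → EuclideanSpace ℝ (Fin (D + 1)) := fun i => WithLp.toLp 2 (A i)
  let S := (EuclideanSpace.basisFun (Fin (D + 1)) ℝ).toBasis
  have hdet : S.det w = 1 / N := by
    have h1 : S.toMatrix w = A.transpose := by
      ext i j
      simp [S, w, Basis.toMatrix_apply]
    rw [Basis.det_apply, h1, Matrix.det_transpose, Matrix.det_of_upperTriangular]
    · simp [Fin.prod_univ_succ, A]
    · intro i j hij
      induction i using Fin.cases with
      | zero => exact absurd hij (by simp)
      | succ i =>
        induction j using Fin.cases with
        | zero => simp [A]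
        | succ j =>
          have : j ≠ i := by rintro rfl; simp at hij
          simp [A, this]
  have hunit : IsUnit (S.det w) := by
    rw [hdet]; exact (isUnit_iff_ne_zero).2 (by positivity)
  obtain ⟨hw1, hw2⟩ := (Basis.is_basis_iff_det S).2 hunit
  let b := Basis.mk hw1 hw2.ge
  have hb : (b : Fin (D + 1) → _) = w := Basis.coe_mk _ _
  obtain ⟨v, hv, hli, hprod⟩ := lattice_succ_min b
  have hmem : ∀ x ∈ Submodule.span ℤ (Set.range b), ∃ n : ℤ, ∃ m : Fin D → ℤ,
      x 0 = n / N ∧ ∀ j, x (Fin.succ j) = n * a j + m j := by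
    intro x hx
    rw [hb] at hx
    induction hx using Submodule.span_induction with
    | mem x hx =>
      obtain ⟨i, rfl⟩ := hx
      induction i using Fin.cases with
      | zero => exact ⟨1, 0, by simp [w, A], by simp [w, A]⟩
      | succ i =>
        refine ⟨0, Pi.single i 1, by simp [w, A], fun j => ?_⟩
        by_cases h : j = i
        · subst h; simp [w, A]
        · simp [w, A, h]
    | zero => exact ⟨0, 0, by simp, by simp⟩
    | add x y _ _ hx hy =>
      obtain ⟨n, m, h1, h2⟩ := hx
      obtain ⟨n', m', h1', h2'⟩ := hy
      refine ⟨n + n', m + m', ?_, fun j => ?_⟩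
      · simp [h1, h1']; ring
      · simp [h2, h2']; ring
    | smul c x _ hx =>
      obtain ⟨n, m, h1, h2⟩ := hx
      refine ⟨c * n, c • m, ?_, fun j => ?_⟩
      · simp [h1]; ring
      · simp [h2]; ring
  choose n m h1 h2 using fun i => hmem (v i) (hv i)
  refine ⟨v, n, m, h1, h2, hli, ?_⟩
  rw [hb] at hprod
  change _ ≤ _ * |S.det w| at hprod
  rwa [hdet, abs_of_pos (by positivity)] at hprod

theorem statement14 :
    ∃ D₀ : ℕ, ∀ D : ℕ, D₀ ≤ D → ∀ X : ℝ, 1 ≤ X →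
    ∀ α : Fin D → AddCircle (1 : ℝ),
    ∃ n : Fin (D + 1) → ℕ, (∀ i, 0 < n i) ∧
    ∃ L : Fin (D + 1) → ℝ, (∀ i, 0 < L i) ∧
      (∀ ℓ ℓ' : Fin (D + 1) → ℕ, (∀ i, (ℓ i : ℝ) < L i) → (∀ i, (ℓ' i : ℝ) < L i) →
        (∑ i, ℓ i * n i) = (∑ i, ℓ' i * n i) → ℓ = ℓ') ∧
      (∀ ℓ : Fin (D + 1) → ℕ, (∀ i, (ℓ i : ℝ) < L i) →
        ((∑ i, ℓ i * n i : ℕ) : ℝ) ≤ (D : ℝ) ^ (-(D : ℝ)) * X) ∧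
      (∀ i, ‖(n i) • α‖ ≤ 1 / L i) ∧
      ((D : ℝ) ^ (-(3 : ℝ) * D) * X ≤ ∏ i, L i) := by
  refine ⟨6, fun D hD X hX α => ?_⟩
  have hD' : (6 : ℝ) ≤ D := by exact_mod_cast hD
  have hD0 : (0 : ℝ) < D := by linarith
  have hNpos : 0 < (D : ℝ) ^ (-(D : ℝ)) * X := by positivity
  set N : ℝ := (D : ℝ) ^ (-(D : ℝ)) * X with hN
  have hα : ∀ j, ∃ r : ℝ, (r : AddCircle (1 : ℝ)) = α j := fun j => QuotientAddGroup.mk_surjective (α j)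
  choose a ha using hα
  obtain ⟨v, n, m, h0, hs, hli, hprod⟩ := approx_basis D N hNpos a
  have hpos : ∀ i, 0 < ‖v i‖ := fun i => norm_pos_iff.2 (hli.ne_zero i)
  have hd : (0 : ℝ) < ((D + 1 : ℕ) : ℝ) := by positivity
  have hcoord : ∀ i j, |v i j| ≤ ‖v i‖ := fun i j => by
    simpa using PiLp.norm_apply_le (v i) j
  set L : Fin (D + 1) → ℝ := fun i => 1 / (((D + 1 : ℕ) : ℝ) * ‖v i‖) with hL
  have hLpos : ∀ i, 0 < L i := fun i => by have := hpos i; simp only [hL]; positivity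
  have hLv : ∀ i, L i * ‖v i‖ = 1 / ((D + 1 : ℕ) : ℝ) := fun i => by
    have := (hpos i).ne'
    simp only [hL]; field_simp
  have hLsum : ∑ i, L i * ‖v i‖ = 1 := by
    simp only [hLv, Finset.sum_const, Finset.card_univ, Fintype.card_fin, nsmul_eq_mul]
    field_simp
  -- a vector with zero first coordinate is an integer vector, hence long
  have hzero : ∀ i, n i = 0 → 1 ≤ ‖v i‖ := by
    intro i hi
    by_contra! hlt
    refine hli.ne_zero i ?_
    ext j
    induction j using Fin.cases with
    | zero => simp [h0, hi]
    | succ j =>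
      have h1 := (hcoord i j.succ).trans_lt hlt
      rw [hs, hi] at h1
      have h2 : |m i j| < 1 := by
        have : |(m i j : ℝ)| < 1 := by simpa using h1
        exact_mod_cast this
      have h3 : m i j = 0 := Int.abs_lt_one_iff.1 h2
      simp [hs, hi, h3]
  have hL1 : ∀ i, n i = 0 → L i ≤ 1 / ((D + 1 : ℕ) : ℝ) := by
    intro i hi
    have := hzero i hi
    simp only [hL]
    gcongr
    nlinarith
  have hℓ0 : ∀ ℓ : Fin (D + 1) → ℕ, (∀ i, (ℓ i : ℝ) < L i) → ∀ i,
      ℓ i * (max 1 (n i).natAbs) = ℓ i * (n i).natAbs := by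
    intro ℓ hℓ i
    by_cases hi : n i = 0
    · have h1 := (hℓ i).trans_le (hL1 i hi)
      have h2 : 1 / ((D + 1 : ℕ) : ℝ) ≤ 1 := by
        rw [div_le_one hd]; push_cast; linarith
      have h3 : (ℓ i : ℝ) < 1 := by linarith
      have h4 : ℓ i = 0 := by
        have : ℓ i < 1 := by exact_mod_cast h3
        omega
      simp [h4]
    · rw [max_eq_right]
      have := Int.natAbs_pos.2 hi
      omega
  have hnv : ∀ i, ((n i).natAbs : ℝ) ≤ N * ‖v i‖ := by
    intro i
    have h1 := hcoord i 0
    rw [h0, abs_div, abs_of_pos hNpos, div_le_iff₀ hNpos] at h1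
    rw [Nat.cast_natAbs, Int.cast_abs]
    linarith
  refine ⟨fun i => max 1 (n i).natAbs, fun i => by simp, L, hLpos, ?_, ?_, ?_, ?_⟩
  · intro ℓ ℓ' hℓ hℓ' heq
    simp only [hℓ0 ℓ hℓ, hℓ0 ℓ' hℓ'] at heq
    have hsgn : ∃ s : Fin (D + 1) → ℤ, ∀ i, |s i| = 1 ∧ s i * n i = (n i).natAbs := by
      refine ⟨fun i => if 0 ≤ n i then 1 else -1, fun i => ?_⟩
      by_cases h : 0 ≤ n i
      · simp [h, abs_of_nonneg]
      · simp [h, abs_of_neg (not_le.1 h)]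
    obtain ⟨s, hs'⟩ := hsgn
    let δ : Fin (D + 1) → ℤ := fun i => ((ℓ i : ℤ) - ℓ' i) * s i
    have hδn : ∑ i, δ i * n i = 0 := by
      have h1 : ∀ i, δ i * n i = ((ℓ i : ℤ) * (n i).natAbs) - ℓ' i * (n i).natAbs := fun i => by
        rw [← (hs' i).2]; simp only [δ]; ring
      simp only [h1, Finset.sum_sub_distrib]
      rw [sub_eq_zero]
      exact_mod_cast heq
    have hδL : ∀ i, |(δ i : ℝ)| < L i := by
      intro i
      have h1 : |(s i : ℝ)| = 1 := by exact_mod_cast (hs' i).1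
      simp only [δ]
      push_cast
      rw [abs_mul, h1, mul_one, abs_lt]
      have h2 := hℓ i
      have h3 := hℓ' i
      have h4 : (0 : ℝ) ≤ ℓ i := by positivity
      have h5 : (0 : ℝ) ≤ ℓ' i := by positivity
      constructor <;> linarith
    have hsum : ∑ i, (δ i : ℝ) • v i = 0 := by
      have happ : ∀ j, (∑ i, (δ i : ℝ) • v i) j = ∑ i, (δ i : ℝ) * v i j := fun j => by simp
      have hδn' : ∑ i, (δ i : ℝ) * n i = 0 := by exact_mod_cast hδn
      ext j
      rw [happ]
      induction j using Fin.cases with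
      | zero =>
        simp only [h0, ← mul_div_assoc]
        rw [← Finset.sum_div, hδn']; simp
      | succ j =>
        have h1 : ∑ i, (δ i : ℝ) * v i j.succ = ((∑ i, δ i * m i j : ℤ) : ℝ) := by
          simp only [hs, mul_add, ← mul_assoc]
          rw [Finset.sum_add_distrib, ← Finset.sum_mul, hδn']
          push_cast; simp
        have h2 : |∑ i, (δ i : ℝ) * v i j.succ| < 1 := by
          calc |∑ i, (δ i : ℝ) * v i j.succ| ≤ ∑ i, |(δ i : ℝ) * v i j.succ| :=
                Finset.abs_sum_le_sum_abs _ _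
            _ < ∑ i, L i * ‖v i‖ := by
                refine Finset.sum_lt_sum_of_nonempty Finset.univ_nonempty fun i _ => ?_
                rw [abs_mul]
                calc |(δ i : ℝ)| * |v i j.succ| ≤ |(δ i : ℝ)| * ‖v i‖ := by
                      have := hcoord i j.succ; gcongr
                  _ < L i * ‖v i‖ := mul_lt_mul_of_pos_right (hδL i) (hpos i)
            _ = 1 := hLsum
        rw [h1] at h2 ⊢
        have h3 : |∑ i, δ i * m i j| < 1 := by exact_mod_cast h2
        rw [Int.abs_lt_one_iff.1 h3]; simp
    have hδ0 := Fintype.linearIndependent_iff.1 hli _ hsum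
    funext i
    have h1 : δ i = 0 := by exact_mod_cast hδ0 i
    have h2 : s i ≠ 0 := by
      intro h; have := (hs' i).1; rw [h] at this; simp at this
    have h3 : (ℓ i : ℤ) - ℓ' i = 0 := (mul_eq_zero.1 h1).resolve_right h2
    omega
  · intro ℓ hℓ
    simp only [hℓ0 ℓ hℓ]
    push_cast [-Nat.cast_natAbs]
    calc ∑ i, (ℓ i : ℝ) * ((n i).natAbs : ℝ) ≤ ∑ i, N * (L i * ‖v i‖) := by
          refine Finset.sum_le_sum fun i _ => ?_
          calc (ℓ i : ℝ) * ((n i).natAbs : ℝ) ≤ L i * (N * ‖v i‖) :=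
                mul_le_mul (hℓ i).le (hnv i) (by positivity) (hLpos i).le
            _ = N * (L i * ‖v i‖) := by ring
      _ = N := by rw [← Finset.mul_sum, hLsum, mul_one]
  · intro i
    have hLi : 0 < 1 / L i := one_div_pos.2 (hLpos i)
    rw [pi_norm_le_iff_of_nonneg hLi.le]
    intro j
    by_cases hi : n i = 0
    · have h1 : ‖((fun i => max 1 (n i).natAbs) i • α) j‖ ≤ |(1 : ℝ)| / 2 :=
        AddCircle.norm_le_half_period 1 one_ne_zero
      have h2 : ((D + 1 : ℕ) : ℝ) ≤ 1 / L i := by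
        rw [le_one_div hd (hLpos i)]; exact hL1 i hi
      push_cast at h2
      rw [abs_one] at h1
      linarith
    · have hmax : max 1 (n i).natAbs = (n i).natAbs := by
        rw [max_eq_right]
        have := Int.natAbs_pos.2 hi
        omega
      have h1 : ‖(n i).natAbs • α j‖ = ‖(n i) • α j‖ := by
        rcases Int.natAbs_eq (n i) with h | h
        · conv_rhs => rw [h]
          rw [natCast_zsmul]
        · conv_rhs => rw [h]
          rw [neg_smul, natCast_zsmul, norm_neg]
      have h2 : ‖(n i) • α j‖ ≤ ‖v i‖ := by
        rw [← ha j, ← AddCircle.coe_zsmul, UnitAddCircle.norm_eq]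
        refine (round_le _ (-(m i j))).trans ?_
        have := hcoord i j.succ
        rw [hs] at this
        simpa using this
      have h3 : 1 / L i = ((D + 1 : ℕ) : ℝ) * ‖v i‖ := by simp [hL]
      simp only [Pi.smul_apply, hmax]
      rw [h1, h3]
      have := hpos i
      push_cast
      nlinarith
  · have hP : 0 < ∏ i, ‖v i‖ := Finset.prod_pos fun i _ => hpos i
    have h1 : ∏ i, L i = 1 / (((D + 1 : ℕ) : ℝ) ^ (D + 1) * ∏ i, ‖v i‖) := by
      simp only [hL]
      rw [Finset.prod_div_distrib, Finset.prod_mul_distrib]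
      simp
    have h2 : (D : ℝ) ^ (-(3 : ℝ) * D) * X = N / (D : ℝ) ^ (2 * D) := by
      rw [hN, eq_div_iff (by positivity), ← Real.rpow_natCast, mul_right_comm, ← Real.rpow_add hD0]
      congr 2; push_cast; ring
    rw [h1, h2, div_le_div_iff₀ (by positivity) (by positivity), one_mul]
    calc N * (((D + 1 : ℕ) : ℝ) ^ (D + 1) * ∏ i, ‖v i‖)
        ≤ N * (((D + 1 : ℕ) : ℝ) ^ (D + 1) * (√((D + 1 : ℕ) : ℝ) ^ (D + 1) * (1 / N))) := by gcongr
      _ = √((D + 1 : ℕ) : ℝ) ^ (D + 1) * ((D + 1 : ℕ) : ℝ) ^ (D + 1) := by field_simp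
      _ ≤ _ := final_bound D hD

end
end

section
/- Let m be a sufficiently large integer, let Q ≥ 1 and δ > 0 be reals, and fix reals a₁₁,…,a_{mm} with 1 ≤ a_{ii} ≤ Q for all i. Let a be the random m×m upper-triangular matrix with these fixed diagonal entries, with zero entries below the diagonal, and with strictly upper-triangular entries a_{ij} (i < j) chosen independently and uniformly at random from [−Q, Q]. Then P(|det(a + aᵀ)| ≤ δ) ≤ (Qm)^{5m²}·δ, uniformly in the fixed choice of the diagonal entries a_{ii}. -/
open MeasureTheory

noncomputable section

/-- Index type for the strictly upper-triangular entries. -/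
abbrev StrIdx (m : ℕ) := {p : Fin m × Fin m // p.1 < p.2}

/-- The upper-triangular matrix with diagonal `dg`, strictly upper-triangular entries `u`,
and zeros below the diagonal. -/
def upperTri {m : ℕ} (dg : Fin m → ℝ) (u : StrIdx m → ℝ) : Matrix (Fin m) (Fin m) ℝ :=
  fun i j => if i = j then dg i else if h : i < j then u ⟨(i, j), h⟩ else 0

/-- The uniform probability measure on the cube `[-a, a]^ι`. -/
def unifCube (ι : Type*) [Fintype ι] (a : ℝ) : Measure (ι → ℝ) :=
  (volume (Set.univ.pi fun _ : ι => Set.Icc (-a) a))⁻¹ •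
    volume.restrict (Set.univ.pi fun _ : ι => Set.Icc (-a) a)

lemma layerL {α : Type*} [MeasurableSpace α] (μ : Measure α) (X : α → ℝ) (hX : Measurable X)
    (s T K : ℝ) (hs0 : 0 < s) (hs1 : s < 1) (hT : 0 ≤ T) (hK : 0 ≤ K)
    (hμ : μ Set.univ ≤ ENNReal.ofReal T)
    (h : ∀ ε : ℝ, 0 < ε → μ {a | |X a| ≤ ε} ≤ ENNReal.ofReal (K * ε)) :
    ∫⁻ a, (ENNReal.ofReal |X a|) ^ (-s) ∂μ ≤ ENNReal.ofReal (T + K * (s / (1 - s))) := by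
  have hnull : μ {a | X a = 0} = 0 := by
    have h1 : ∀ ε : ℝ, 0 < ε → μ {a | X a = 0} ≤ ENNReal.ofReal (K * ε) := fun ε hε =>
      le_trans (measure_mono (fun a ha => by
        simp only [Set.mem_ofPred_eq] at ha ⊢; rw [ha]; simpa using hε.le)) (h ε hε)
    have h2 : Filter.Tendsto (fun ε : ℝ => ENNReal.ofReal (K * ε)) (nhdsWithin 0 (Set.Ioi 0))
        (nhds 0) := by
      have : Filter.Tendsto (fun ε : ℝ => ENNReal.ofReal (K * ε)) (nhds 0)
        (nhds (ENNReal.ofReal (K * 0))) := by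
        apply (ENNReal.continuous_ofReal.comp (by fun_prop : Continuous fun ε : ℝ => K * ε)).tendsto
      simp only [mul_zero, ENNReal.ofReal_zero] at this
      exact this.mono_left nhdsWithin_le_nhds
    have h3 := ge_of_tendsto h2 (b := μ {a | X a = 0}) (by
      filter_upwards [self_mem_nhdsWithin] with ε hε using h1 ε hε)
    exact le_antisymm h3 zero_le
  have hae : ∀ᵐ a ∂μ, X a ≠ 0 := by
    rw [ae_iff]; simpa using hnull
  have e1 : ∫⁻ a, (ENNReal.ofReal |X a|) ^ (-s) ∂μ = ∫⁻ a, ENNReal.ofReal (|X a| ^ (-s)) ∂μ := by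
    apply lintegral_congr_ae
    filter_upwards [hae] with a ha
    rw [ENNReal.ofReal_rpow_of_pos (abs_pos.2 ha)]
  rw [e1, lintegral_eq_lintegral_meas_lt μ (Filter.Eventually.of_forall fun a => by positivity)
    (by fun_prop)]
  have hsub : ∀ t : ℝ, 0 < t → μ {a | t < |X a| ^ (-s)} ≤ ENNReal.ofReal (K * t ^ (-(1/s))) := by
    intro t ht
    refine le_trans (measure_mono ?_) (h (t ^ (-(1/s))) (by positivity))
    intro a ha
    simp only [Set.mem_ofPred_eq] at ha ⊢
    by_cases hx : |X a| = 0
    · rw [hx]; positivity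
    have hxp : 0 < |X a| := lt_of_le_of_ne (abs_nonneg _) (Ne.symm hx)
    have : (|X a| ^ (-s)) ^ (-(1/s)) ≤ t ^ (-(1/s)) :=
      Real.rpow_le_rpow_of_nonpos ht ha.le (by rw [neg_nonpos]; positivity)
    rwa [← Real.rpow_mul hxp.le, show -s * -(1/s) = 1 by field_simp, Real.rpow_one] at this
  have hsplit : Set.Ioi (0:ℝ) = Set.Ioc 0 1 ∪ Set.Ioi 1 := by
    rw [Set.Ioc_union_Ioi_eq_Ioi]; norm_num
  rw [hsplit, lintegral_union measurableSet_Ioi (by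
    rw [Set.disjoint_left]; intro x hx hx'; exact absurd hx.2 (not_le.2 hx')),
    ENNReal.ofReal_add hT (by have : 0 < 1 - s := by linarith
                              positivity)]
  apply add_le_add
  · calc _ ≤ ∫⁻ t in Set.Ioc (0:ℝ) 1, ENNReal.ofReal T :=
          lintegral_mono fun t => (measure_mono (Set.subset_univ _)).trans hμ
      _ = _ := by simp
  · have hexp : -(1/s) < -1 := by
      rw [neg_lt_neg_iff, lt_div_iff₀ hs0]; linarith
    calc _ ≤ ∫⁻ t in Set.Ioi (1:ℝ), ENNReal.ofReal (K * t ^ (-(1/s))) := by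
          apply setLIntegral_mono (by fun_prop)
          intro t ht
          exact hsub t (lt_trans one_pos ht)
      _ = ENNReal.ofReal (∫ t in Set.Ioi (1:ℝ), K * t ^ (-(1/s))) := by
          rw [ofReal_integral_eq_lintegral_ofReal]
          · exact (integrableOn_Ioi_rpow_of_lt hexp one_pos).const_mul K
          · filter_upwards [ae_restrict_mem measurableSet_Ioi] with t ht
            have : 0 < t := lt_trans one_pos ht
            positivity
      _ ≤ _ := by
          rw [integral_const_mul, integral_Ioi_rpow_of_lt hexp one_pos]
          apply ENNReal.ofReal_le_ofReal
          apply le_of_eq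
          have : 1 - s ≠ 0 := by linarith
          have h2 : -1 + s ≠ 0 := by intro h; apply this; linarith
          rw [Real.one_rpow]
          congr 1
          rw [div_eq_div_iff (by intro h; linarith) this]
          field_simp
          ring

lemma geom (b c y r : ℝ) (hb : b ≠ 0) (hr : r = Real.sqrt (|c| / |b|)) :
    |b| * (|y - r| * |y + r|) ≤ |c - b * y ^ 2| := by
  have hb' := abs_pos.2 hb
  have hr2 : r ^ 2 = |c| / |b| := by rw [hr]; exact Real.sq_sqrt (by positivity)
  have h2 : |b| * (|y - r| * |y + r|) = abs (|b * y ^ 2| - |c|) := by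
    rw [← abs_mul, ← abs_of_pos hb', ← abs_mul, abs_mul b,
      abs_of_nonneg (sq_nonneg y)]
    congr 1
    have : (y - r) * (y + r) = y ^ 2 - |c| / |b| := by rw [← hr2]; ring
    rw [this]
    field_simp
  rw [h2, abs_sub_comm c]
  exact abs_abs_sub_abs_le _ _

lemma one_var (l c δ : ℝ) (hl : l ≠ 0) (hc : c ≠ 0) (hδ : 0 < δ) :
    volume {x : ℝ | |l * x ^ 2 - c| ≤ δ}
      ≤ ENNReal.ofReal (4 * δ * |l| ^ (-(1/2) : ℝ)) * (ENNReal.ofReal |c|) ^ (-(1/2) : ℝ) := by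
  have hl' := abs_pos.2 hl
  have hc' := abs_pos.2 hc
  set r := Real.sqrt (|c| / |l|) with hr
  have hr0 : 0 < r := Real.sqrt_pos.2 (by positivity)
  have hr2 : r ^ 2 = |c| / |l| := Real.sq_sqrt (by positivity)
  have hlr : |l| * r = |l| ^ (1/2 : ℝ) * |c| ^ (1/2 : ℝ) := by
    rw [← Real.sqrt_eq_rpow, ← Real.sqrt_eq_rpow, hr, Real.sqrt_div hc'.le]
    have := Real.sqrt_pos.2 hl'
    field_simp
    exact (Real.sq_sqrt hl'.le).symm
  set t := δ / (|l| * r) with ht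
  have ht0 : 0 < t := by positivity
  have hsub : {x : ℝ | |l * x ^ 2 - c| ≤ δ} ⊆ Set.Icc (r - t) (r + t) ∪ Set.Icc (-r - t) (-r + t) := by
    intro x hx
    simp only [Set.mem_ofPred_eq] at hx
    have h1 : |l| * (|x - r| * |x + r|) ≤ δ :=
      (geom l c x r hl hr).trans (by rwa [abs_sub_comm])
    have h3 : |x - r| ≤ t ∨ |x + r| ≤ t := by
      by_contra hcon
      push Not at hcon
      obtain ⟨h4, h5⟩ := hcon
      have hδt : δ = |l| * (t * r) := by rw [ht]; field_simp
      have h6 : |x - r| * |x + r| ≤ t * r := by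
        rw [hδt] at h1; exact le_of_mul_le_mul_left h1 hl'
      rcases le_total 0 x with h7 | h7
      · have : r ≤ |x + r| := le_trans (by linarith) (le_abs_self _)
        nlinarith
      · have : r ≤ |x - r| := le_trans (by linarith) (neg_le_abs _)
        nlinarith
    rcases h3 with h3 | h3
    · left; rw [abs_le] at h3; constructor <;> linarith [h3.1, h3.2]
    · right; rw [abs_le] at h3; constructor <;> linarith [h3.1, h3.2]
  refine (measure_mono hsub).trans ((measure_union_le _ _).trans ?_)
  rw [Real.volume_Icc, Real.volume_Icc, ← ENNReal.ofReal_add (by linarith) (by linarith),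
    ENNReal.ofReal_rpow_of_pos hc', ← ENNReal.ofReal_mul (by positivity)]
  apply ENNReal.ofReal_le_ofReal
  apply le_of_eq
  rw [ht, hlr, Real.rpow_neg hl'.le, Real.rpow_neg hc'.le]
  field_simp
  ring

lemma ptA (p q r B : ℝ) (hp : 0 < p) (hq : p ≤ q) (hr : 0 < r) (hqr : r ≤ q) (hB : 0 < B) :
    (B * (p * q)) ^ (-(1/2) : ℝ) ≤ B ^ (-(1/2) : ℝ) * r ^ (-(1/3) : ℝ) * p ^ (-(2/3) : ℝ) := by
  have hq0 : 0 < q := by linarith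
  rw [Real.mul_rpow hB.le (by positivity), Real.mul_rpow hp.le hq0.le, mul_assoc]
  refine mul_le_mul_of_nonneg_left ?_ (by positivity)
  have h1 : q ^ (-(1/2) : ℝ) = q ^ (-(1/3) : ℝ) * q ^ (-(1/6) : ℝ) := by
    rw [← Real.rpow_add hq0]; norm_num
  have h2 : p ^ (-(2/3) : ℝ) = p ^ (-(1/2) : ℝ) * p ^ (-(1/6) : ℝ) := by
    rw [← Real.rpow_add hp]; norm_num
  have h3 : q ^ (-(1/3) : ℝ) ≤ r ^ (-(1/3) : ℝ) := Real.rpow_le_rpow_of_nonpos hr hqr (by norm_num)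
  have h4 : q ^ (-(1/6) : ℝ) ≤ p ^ (-(1/6) : ℝ) := Real.rpow_le_rpow_of_nonpos hp hq (by norm_num)
  rw [h1, h2]
  calc _ ≤ p ^ (-(1/2) : ℝ) * (r ^ (-(1/3) : ℝ) * p ^ (-(1/6) : ℝ)) := by gcongr
    _ = _ := by ring

lemma ptB (p q B : ℝ) (hp : 0 < p) (hq : p ≤ q) (hB : 0 < B) :
    (B * (p * q)) ^ (-(1/6) : ℝ) ≤ B ^ (-(1/6) : ℝ) * p ^ (-(1/3) : ℝ) := by
  have hq0 : 0 < q := by linarith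
  rw [Real.mul_rpow hB.le (by positivity), Real.mul_rpow hp.le hq0.le]
  gcongr
  have h2 : p ^ (-(1/3) : ℝ) = p ^ (-(1/6) : ℝ) * p ^ (-(1/6) : ℝ) := by
    rw [← Real.rpow_add hp]; norm_num
  have h4 : q ^ (-(1/6) : ℝ) ≤ p ^ (-(1/6) : ℝ) := Real.rpow_le_rpow_of_nonpos hp hq (by norm_num)
  rw [h2]
  gcongr

lemma shiftInt (R a s : ℝ) (hR : 0 ≤ R) (hs0 : 0 < s) (hs1 : s < 1) :
    ∫⁻ y in Set.Icc (-R) R, (ENNReal.ofReal |y - a|) ^ (-s) ≤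
      ENNReal.ofReal (2 * R + 2 * (s / (1 - s))) := by
  apply layerL _ _ (by fun_prop) s _ _ hs0 hs1 (by linarith) (by norm_num)
  · rw [Measure.restrict_apply_univ, Real.volume_Icc]; apply le_of_eq; congr 1; ring
  · intro ε hε
    refine (Measure.restrict_apply_le _ _).trans ?_
    refine (measure_mono (t := Set.Icc (a - ε) (a + ε)) ?_).trans ?_
    · intro x hx
      simp only [Set.mem_ofPred_eq, abs_le] at hx
      constructor <;> linarith [hx.1, hx.2]
    · rw [Real.volume_Icc]; apply le_of_eq; congr 1; ring

/-- second variable -/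
lemma two_var (b c R : ℝ) (hb : b ≠ 0) (hR : 2 ≤ R) :
    ∫⁻ y in Set.Icc (-R) R, (ENNReal.ofReal |c - b * y ^ 2|) ^ (-(1/2) : ℝ) ≤
      ENNReal.ofReal (8 * R * |b| ^ (-(1/3) : ℝ)) * (ENNReal.ofReal |c|) ^ (-(1/6) : ℝ) := by
  have hb' := abs_pos.2 hb
  by_cases hc : c = 0
  · subst hc
    rw [abs_zero, ENNReal.ofReal_zero, ENNReal.zero_rpow_of_neg (by norm_num), ENNReal.mul_top]
    · exact le_top
    · have : 0 < 8 * R * |b| ^ (-(1/3) : ℝ) := by positivity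
      simpa using this
  have hc' := abs_pos.2 hc
  set r := Real.sqrt (|c| / |b|) with hr
  have hr0 : 0 < r := Real.sqrt_pos.2 (by positivity)
  set C := |b| ^ (-(1/2) : ℝ) * r ^ (-(1/3) : ℝ) with hC
  have hC0 : 0 < C := by positivity
  have hCe : C = |b| ^ (-(1/3) : ℝ) * |c| ^ (-(1/6) : ℝ) := by
    rw [hC, hr, Real.sqrt_eq_rpow, ← Real.rpow_mul (by positivity), Real.div_rpow hc'.le hb'.le,
      div_eq_mul_inv (|c| ^ _), ← Real.rpow_neg hb'.le, mul_comm (|c| ^ _), ← mul_assoc,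
      ← Real.rpow_add hb']
    norm_num
  have hpt : ∀ y : ℝ, (ENNReal.ofReal |c - b * y ^ 2|) ^ (-(1/2) : ℝ) ≤ ENNReal.ofReal C *
      ((ENNReal.ofReal |y - r|) ^ (-(2/3) : ℝ) + (ENNReal.ofReal |y - (-r)|) ^ (-(2/3) : ℝ)) := by
    intro y
    have hCne : ENNReal.ofReal C ≠ 0 := by simpa using hC0
    by_cases hp : y - r = 0
    · rw [hp, abs_zero, ENNReal.ofReal_zero, ENNReal.zero_rpow_of_neg (by norm_num), top_add,
        ENNReal.mul_top hCne]
      exact le_top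
    by_cases hq : y - (-r) = 0
    · rw [hq, abs_zero, ENNReal.ofReal_zero, ENNReal.zero_rpow_of_neg (by norm_num), add_top,
        ENNReal.mul_top hCne]
      exact le_top
    have hg := geom b c y r hb hr
    rw [sub_neg_eq_add] at hq ⊢
    have hp' := abs_pos.2 hp
    have hq' := abs_pos.2 hq
    have hpos : 0 < |b| * (|y - r| * |y + r|) := by positivity
    rw [ENNReal.ofReal_rpow_of_pos (hpos.trans_le hg), ENNReal.ofReal_rpow_of_pos hp',
      ENNReal.ofReal_rpow_of_pos hq', ← ENNReal.ofReal_add (by positivity) (by positivity),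
      ← ENNReal.ofReal_mul hC0.le]
    apply ENNReal.ofReal_le_ofReal
    refine (Real.rpow_le_rpow_of_nonpos hpos hg (by norm_num)).trans ?_
    rw [mul_add]
    have hsum : 2 * r ≤ |y - r| + |y + r| := by
      have h1 := neg_le_abs (y - r)
      have h2 := le_abs_self (y + r)
      linarith
    rcases le_total |y - r| |y + r| with h | h
    · refine (ptA _ _ r _ hp' h hr0 (by linarith) hb').trans ?_
      have : 0 ≤ C * |y + r| ^ (-(2/3) : ℝ) := by positivity
      linarith
    · rw [mul_comm |y - r|]
      refine (ptA _ _ r _ hq' h hr0 (by linarith) hb').trans ?_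
      have : 0 ≤ C * |y - r| ^ (-(2/3) : ℝ) := by positivity
      linarith
  refine (lintegral_mono hpt).trans ?_
  rw [lintegral_const_mul' _ _ ENNReal.ofReal_ne_top, lintegral_add_left (by fun_prop)]
  have i1 := shiftInt R r (2/3) (by linarith) (by norm_num) (by norm_num)
  have i2 := shiftInt R (-r) (2/3) (by linarith) (by norm_num) (by norm_num)
  refine (mul_le_mul_right (add_le_add i1 i2) _).trans ?_
  rw [← ENNReal.ofReal_add (by norm_num; linarith) (by norm_num; linarith), ← ENNReal.ofReal_mul hC0.le,
    ENNReal.ofReal_rpow_of_pos hc', ← ENNReal.ofReal_mul (by positivity)]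
  apply ENNReal.ofReal_le_ofReal
  have : 8 * R * |b| ^ (-(1/3) : ℝ) * |c| ^ (-(1/6) : ℝ) = C * (8 * R) := by rw [hCe]; ring
  rw [this]
  gcongr
  norm_num
  linarith

/-- third variable -/
lemma three_var (b c R : ℝ) (hb : b ≠ 0) (hR : 2 ≤ R) :
    ∫⁻ y in Set.Icc (-R) R, (ENNReal.ofReal |c - b * y ^ 2|) ^ (-(1/6) : ℝ) ≤
      ENNReal.ofReal (6 * R * |b| ^ (-(1/6) : ℝ)) := by
  have hb' := abs_pos.2 hb
  set r := Real.sqrt (|c| / |b|) with hr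
  set C := |b| ^ (-(1/6) : ℝ) with hC
  have hC0 : 0 < C := by positivity
  have hpt : ∀ y : ℝ, (ENNReal.ofReal |c - b * y ^ 2|) ^ (-(1/6) : ℝ) ≤ ENNReal.ofReal C *
      ((ENNReal.ofReal |y - r|) ^ (-(1/3) : ℝ) + (ENNReal.ofReal |y - (-r)|) ^ (-(1/3) : ℝ)) := by
    intro y
    have hCne : ENNReal.ofReal C ≠ 0 := by simpa using hC0
    by_cases hp : y - r = 0
    · rw [hp, abs_zero, ENNReal.ofReal_zero, ENNReal.zero_rpow_of_neg (by norm_num), top_add,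
        ENNReal.mul_top hCne]
      exact le_top
    by_cases hq : y - (-r) = 0
    · rw [hq, abs_zero, ENNReal.ofReal_zero, ENNReal.zero_rpow_of_neg (by norm_num), add_top,
        ENNReal.mul_top hCne]
      exact le_top
    have hg := geom b c y r hb hr
    rw [sub_neg_eq_add] at hq ⊢
    have hp' := abs_pos.2 hp
    have hq' := abs_pos.2 hq
    have hpos : 0 < |b| * (|y - r| * |y + r|) := by positivity
    rw [ENNReal.ofReal_rpow_of_pos (hpos.trans_le hg), ENNReal.ofReal_rpow_of_pos hp',
      ENNReal.ofReal_rpow_of_pos hq', ← ENNReal.ofReal_add (by positivity) (by positivity),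
      ← ENNReal.ofReal_mul hC0.le]
    apply ENNReal.ofReal_le_ofReal
    refine (Real.rpow_le_rpow_of_nonpos hpos hg (by norm_num)).trans ?_
    rw [mul_add]
    rcases le_total |y - r| |y + r| with h | h
    · refine (ptB _ _ _ hp' h hb').trans ?_
      have : 0 ≤ C * |y + r| ^ (-(1/3) : ℝ) := by positivity
      linarith
    · rw [mul_comm |y - r|]
      refine (ptB _ _ _ hq' h hb').trans ?_
      have : 0 ≤ C * |y - r| ^ (-(1/3) : ℝ) := by positivity
      linarith
  refine (lintegral_mono hpt).trans ?_
  rw [lintegral_const_mul' _ _ ENNReal.ofReal_ne_top, lintegral_add_left (by fun_prop)]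
  have i1 := shiftInt R r (1/3) (by linarith) (by norm_num) (by norm_num)
  have i2 := shiftInt R (-r) (1/3) (by linarith) (by norm_num) (by norm_num)
  refine (mul_le_mul_right (add_le_add i1 i2) _).trans ?_
  rw [← ENNReal.ofReal_add (by norm_num; linarith) (by norm_num; linarith), ← ENNReal.ofReal_mul hC0.le]
  apply ENNReal.ofReal_le_ofReal
  rw [mul_comm _ C]
  gcongr
  norm_num
  linarith

/-- uniform bound for a diagonal quadratic form, two variables integrated out -/
lemma diag_core {ι : Type*} [Fintype ι] [DecidableEq ι] (l : ι → ℝ) (c δ R : ℝ) (hδ : 0 < δ)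
    (hR : 2 ≤ R) (i j : ι) (hij : i ≠ j) (hi : l i ≠ 0) (hj : l j ≠ 0) (x₀ : ι → ℝ) :
    volume ((Set.univ.pi fun _ : ι => Set.Icc (-R) R) ∩ {x : ι → ℝ | |∑ k, l k * x k ^ 2 - c| ≤ δ})
    ≤ (∫⋯∫⁻_((Finset.univ.erase i).erase j), (fun x : ι → ℝ =>
        ENNReal.ofReal (4 * δ * |l i| ^ (-(1/2) : ℝ)) * (ENNReal.ofReal (8 * R * |l j| ^ (-(1/3) : ℝ)) *
        (ENNReal.ofReal |c - ∑ k ∈ (Finset.univ.erase i).erase j, l k * x k ^ 2|) ^ (-(1/6) : ℝ)))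
        ∂(fun _ : ι => (volume : Measure ℝ).restrict (Set.Icc (-R) R))) x₀ := by
  set S := {x : ι → ℝ | |∑ k, l k * x k ^ 2 - c| ≤ δ} with hS
  have hSm : MeasurableSet S := measurableSet_le (by fun_prop) (by fun_prop)
  set A := ENNReal.ofReal (4 * δ * |l i| ^ (-(1/2) : ℝ)) with hA
  have hA0 : A ≠ 0 := by
    have := abs_pos.2 hi
    have : 0 < 4 * δ * |l i| ^ (-(1/2) : ℝ) := by positivity
    simpa [hA] using this
  have e1 : volume ((Set.univ.pi fun _ : ι => Set.Icc (-R) R) ∩ S) =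
      (∫⋯∫⁻_Finset.univ, S.indicator 1 ∂(fun _ : ι => (volume : Measure ℝ).restrict (Set.Icc (-R) R)))
        x₀ := by
    rw [← lintegral_eq_lmarginal_univ, lintegral_indicator_one hSm, ← Measure.restrict_pi_pi,
      Measure.restrict_apply hSm, Set.inter_comm]
    rfl
  rw [e1, lmarginal_erase' _ (measurable_one.indicator hSm) (Finset.mem_univ i)]
  have step1 : (fun x : ι → ℝ => ∫⁻ t, S.indicator (1 : (ι → ℝ) → ENNReal) (Function.update x i t)
        ∂((volume : Measure ℝ).restrict (Set.Icc (-R) R))) ≤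
      fun x => A * (ENNReal.ofReal |c - ∑ k ∈ Finset.univ.erase i, l k * x k ^ 2|) ^ (-(1/2) : ℝ) := by
    intro x
    set c' := c - ∑ k ∈ Finset.univ.erase i, l k * x k ^ 2 with hc'
    by_cases h0 : c' = 0
    · show _ ≤ A * (ENNReal.ofReal |c'|) ^ (-(1/2) : ℝ)
      rw [h0, abs_zero, ENNReal.ofReal_zero, ENNReal.zero_rpow_of_neg (by norm_num), ENNReal.mul_top hA0]
      exact le_top
    refine le_trans ?_ (one_var (l i) c' δ hi h0 hδ)
    have hm : MeasurableSet {t : ℝ | |l i * t ^ 2 - c'| ≤ δ} :=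
      measurableSet_le (by fun_prop) (by fun_prop)
    rw [← lintegral_indicator_one hm]
    refine (lintegral_mono' Measure.restrict_le_self le_rfl).trans (lintegral_mono fun t => ?_)
    have : ∑ k, l k * (Function.update x i t) k ^ 2 - c = l i * t ^ 2 - c' := by
      rw [← Finset.add_sum_erase _ _ (Finset.mem_univ i), hc']
      rw [Finset.sum_congr rfl (g := fun k => l k * x k ^ 2)]
      · simp; ring
      · intro k hk
        rw [Function.update_of_ne (Finset.ne_of_mem_erase hk)]
    apply le_of_eq
    simp only [Set.indicator, hS, Set.mem_ofPred_eq, this, Pi.one_apply]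
  refine le_trans (lmarginal_mono step1 x₀) ?_
  rw [lmarginal_erase' _ (by fun_prop) (Finset.mem_erase.2 ⟨hij.symm, Finset.mem_univ j⟩)]
  refine lmarginal_mono ?_ x₀
  intro x
  simp only
  rw [lintegral_const_mul' _ _ ENNReal.ofReal_ne_top]
  gcongr
  refine le_trans (le_of_eq ?_) (two_var (l j) _ R hj hR)
  apply lintegral_congr
  intro t
  congr 3
  rw [← Finset.add_sum_erase (Finset.univ.erase i) _ (Finset.mem_erase.2 ⟨hij.symm, Finset.mem_univ j⟩)]
  rw [Finset.sum_congr rfl (g := fun k => l k * x k ^ 2)]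
  · simp; ring
  · intro k hk
    rw [Function.update_of_ne (Finset.ne_of_mem_erase hk)]

lemma lmarg_const {ι : Type*} [Fintype ι] [DecidableEq ι] (R : ℝ) (hR : 0 ≤ R) (s : Finset ι)
    (C : ENNReal) (x₀ : ι → ℝ) :
    (∫⋯∫⁻_s, (fun _ : ι → ℝ => C) ∂(fun _ : ι => (volume : Measure ℝ).restrict (Set.Icc (-R) R))) x₀
     = C * ENNReal.ofReal ((2 * R) ^ s.card) := by
  simp only [lmarginal, lintegral_const, Measure.pi_univ, Measure.restrict_apply_univ,
    Real.volume_Icc, Finset.prod_const, Finset.card_univ, Fintype.card_coe]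
  rw [ENNReal.ofReal_pow (by linarith)]
  congr 3; ring

lemma diag_two (l : Fin 2 → ℝ) (c δ R : ℝ) (hδ : 0 < δ) (hc : 1 ≤ c)
    (hR : 2 ≤ R) (hd : ∏ i, l i ≠ 0) :
    volume ((Set.univ.pi fun _ : Fin 2 => Set.Icc (-R) R) ∩ {x | |∑ k, l k * x k ^ 2 - c| ≤ δ})
    ≤ ENNReal.ofReal (12 * δ * (2 * R) ^ 2 * |∏ i, l i| ^ (-(5/12) : ℝ)) := by
  have hne : ∀ i, l i ≠ 0 := fun i => (Finset.prod_ne_zero_iff.1 hd) i (Finset.mem_univ i)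
  obtain ⟨i, j, hij, hle⟩ : ∃ i j : Fin 2, i ≠ j ∧ |l j| ≤ |l i| := by
    rcases le_total |l 0| |l 1| with h | h
    · exact ⟨1, 0, by decide, h⟩
    · exact ⟨0, 1, by decide, h⟩
  have hs : (Finset.univ.erase i).erase j = ∅ := by
    clear hle; revert i j; decide
  have hp : |∏ k, l k| = |l i| * |l j| := by
    rw [Fin.prod_univ_two, abs_mul]
    fin_cases i <;> fin_cases j <;> simp_all [mul_comm]
  refine (diag_core l c δ R hδ hR i j hij (hne i) (hne j) 0).trans ?_
  rw [hs, lmarginal_empty]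
  simp only [Finset.sum_empty, sub_zero]
  have hi := abs_pos.2 (hne i)
  have hj := abs_pos.2 (hne j)
  have hc0 : 0 < c := by linarith
  rw [abs_of_pos hc0, ENNReal.ofReal_rpow_of_pos hc0,
    ← ENNReal.ofReal_mul (by positivity), ← ENNReal.ofReal_mul (by positivity)]
  apply ENNReal.ofReal_le_ofReal
  have h1 : c ^ (-(1/6) : ℝ) ≤ 1 := Real.rpow_le_one_of_one_le_of_nonpos hc (by norm_num)
  have h2 : |l i| ^ (-(1/2) : ℝ) * |l j| ^ (-(1/3) : ℝ) ≤ |∏ i, l i| ^ (-(5/12) : ℝ) := by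
    rw [hp, Real.mul_rpow hi.le hj.le]
    have a1 : |l i| ^ (-(1/2) : ℝ) = |l i| ^ (-(5/12) : ℝ) * |l i| ^ (-(1/12) : ℝ) := by
      rw [← Real.rpow_add hi]; norm_num
    have a2 : |l j| ^ (-(5/12) : ℝ) = |l j| ^ (-(1/12) : ℝ) * |l j| ^ (-(1/3) : ℝ) := by
      rw [← Real.rpow_add hj]; norm_num
    rw [a1, a2, ← mul_assoc]
    have a3 : |l i| ^ (-(1/12) : ℝ) ≤ |l j| ^ (-(1/12) : ℝ) :=
      Real.rpow_le_rpow_of_nonpos hj hle (by norm_num)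
    gcongr
  calc _ = (32 * R * δ) * (|l i| ^ (-(1/2) : ℝ) * |l j| ^ (-(1/3) : ℝ)) * c ^ (-(1/6) : ℝ) := by ring
    _ ≤ (12 * δ * (2 * R) ^ 2) * |∏ i, l i| ^ (-(5/12) : ℝ) * 1 := by
      have h3 : 32 * R * δ ≤ 12 * δ * (2 * R) ^ 2 := by
        nlinarith [mul_le_mul_of_nonneg_left hR (mul_nonneg hδ.le (by linarith : 0 ≤ R)),
          mul_nonneg hδ.le (by linarith : 0 ≤ R)]
      gcongr
    _ = _ := by ring

lemma pick3 {n : ℕ} (hn : 3 ≤ n) (f : Fin n → ℝ) (hf : ∀ i, 0 < f i) :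
    ∃ i j k : Fin n, i ≠ j ∧ k ∈ (Finset.univ.erase i).erase j ∧
      f i ^ (-(1/2) : ℝ) * f j ^ (-(1/3) : ℝ) * f k ^ (-(1/6) : ℝ) ≤ (∏ i, f i) ^ (-(1/n) : ℝ) := by
  have h1 : (Finset.univ : Finset (Fin n)).Nonempty := by
    rw [← Finset.card_pos]; simp; omega
  obtain ⟨i, -, hi⟩ := Finset.exists_max_image _ f h1
  have c1 : (Finset.univ.erase i : Finset (Fin n)).card = n - 1 := by
    rw [Finset.card_erase_of_mem (Finset.mem_univ _)]; simp
  have h2 : (Finset.univ.erase i : Finset (Fin n)).Nonempty := by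
    rw [← Finset.card_pos]; omega
  obtain ⟨j, hjm, hj⟩ := Finset.exists_max_image _ f h2
  have c2 : ((Finset.univ.erase i).erase j : Finset (Fin n)).card = n - 2 := by
    rw [Finset.card_erase_of_mem hjm]; omega
  have h3 : ((Finset.univ.erase i).erase j : Finset (Fin n)).Nonempty := by
    rw [← Finset.card_pos]; omega
  obtain ⟨k, hkm, hk⟩ := Finset.exists_max_image _ f h3
  refine ⟨i, j, k, (Finset.ne_of_mem_erase hjm).symm, hkm, ?_⟩
  have hprod : ∏ i, f i ≤ f i * (f j * f k ^ (n - 2)) := by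
    rw [← Finset.mul_prod_erase _ _ (Finset.mem_univ i), ← Finset.mul_prod_erase _ _ hjm, ← c2]
    gcongr
    · exact (hf i).le
    · exact (hf j).le
    · rw [← Finset.prod_const]
      exact Finset.prod_le_prod (fun i _ => (hf i).le) hk
  have hP : 0 < ∏ i, f i := Finset.prod_pos fun i _ => hf i
  have hlog : Real.log (∏ i, f i) ≤ Real.log (f i) + (Real.log (f j) + ((n:ℝ) - 2) * Real.log (f k)) := by
    have := Real.log_le_log hP hprod
    rw [Real.log_mul (hf i).ne' (mul_pos (hf j) (pow_pos (hf k) _)).ne',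
      Real.log_mul (hf j).ne' (pow_pos (hf k) _).ne', Real.log_pow, Nat.cast_sub (by omega)] at this
    simpa using this
  have l1 : Real.log (f j) ≤ Real.log (f i) := Real.log_le_log (hf j) (hi j (Finset.mem_univ _))
  have l2 : Real.log (f k) ≤ Real.log (f j) :=
    Real.log_le_log (hf k) (hj k (Finset.mem_of_mem_erase hkm))
  rw [Real.rpow_def_of_pos (hf i), Real.rpow_def_of_pos (hf j), Real.rpow_def_of_pos (hf k),
    Real.rpow_def_of_pos hP, ← Real.exp_add, ← Real.exp_add, Real.exp_le_exp]
  have hn' : (3:ℝ) ≤ n := by exact_mod_cast hn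
  set a := Real.log (f i)
  set b := Real.log (f j)
  set d := Real.log (f k)
  have hinv : (1:ℝ)/n ≤ 1/3 := one_div_le_one_div_of_le (by norm_num) hn'
  have hinv0 : 0 < (1:ℝ)/n := by positivity
  have h4 : (1/n:ℝ) * Real.log (∏ i, f i) ≤ (1/n:ℝ) * (a + (b + (n-2) * d)) := by gcongr
  have h5 : (1/n:ℝ) * (a + (b + (n-2) * d)) = (1/n:ℝ) * (a - d) + (1/n:ℝ) * (b - d) + d := by
    field_simp
    try ring
  have h6 : (1/n:ℝ) * (a - d) ≤ 1/3 * (a-d) :=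
    mul_le_mul_of_nonneg_right hinv (by linarith)
  have h7 : (1/n:ℝ) * (b - d) ≤ 1/3 * (b-d) :=
    mul_le_mul_of_nonneg_right hinv (by linarith)
  linarith

lemma diag_three {n : ℕ} (hn : 3 ≤ n) (l : Fin n → ℝ) (c δ R : ℝ) (hδ : 0 < δ)
    (hR : 2 ≤ R) (hd : ∏ i, l i ≠ 0) :
    volume ((Set.univ.pi fun _ : Fin n => Set.Icc (-R) R) ∩ {x | |∑ k, l k * x k ^ 2 - c| ≤ δ})
    ≤ ENNReal.ofReal (12 * δ * (2 * R) ^ n * |∏ i, l i| ^ (-(1/n) : ℝ)) := by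
  have hne : ∀ i, l i ≠ 0 := fun i => (Finset.prod_ne_zero_iff.1 hd) i (Finset.mem_univ i)
  obtain ⟨i, j, k, hij, hk, hle⟩ := pick3 hn (fun i => |l i|) (fun i => abs_pos.2 (hne i))
  refine (diag_core l c δ R hδ hR i j hij (hne i) (hne j) 0).trans ?_
  rw [lmarginal_erase' _ (by fun_prop) hk]
  have step : (fun x : Fin n → ℝ => ∫⁻ t, (fun x : Fin n → ℝ =>
        ENNReal.ofReal (4 * δ * |l i| ^ (-(1/2) : ℝ)) * (ENNReal.ofReal (8 * R * |l j| ^ (-(1/3) : ℝ)) *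
        (ENNReal.ofReal |c - ∑ k ∈ (Finset.univ.erase i).erase j, l k * x k ^ 2|) ^ (-(1/6) : ℝ)))
        (Function.update x k t) ∂((volume : Measure ℝ).restrict (Set.Icc (-R) R))) ≤
      fun _ => ENNReal.ofReal (4 * δ * |l i| ^ (-(1/2) : ℝ)) *
        (ENNReal.ofReal (8 * R * |l j| ^ (-(1/3) : ℝ)) * ENNReal.ofReal (6 * R * |l k| ^ (-(1/6) : ℝ))) := by
    intro x
    simp only
    rw [lintegral_const_mul' _ _ ENNReal.ofReal_ne_top, lintegral_const_mul' _ _ ENNReal.ofReal_ne_top]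
    gcongr
    refine le_trans (le_of_eq ?_) (three_var (l k)
      (c - ∑ k ∈ ((Finset.univ.erase i).erase j).erase k, l k * x k ^ 2) R (hne k) hR)
    apply lintegral_congr
    intro t
    congr 3
    rw [← Finset.add_sum_erase ((Finset.univ.erase i).erase j) _ hk]
    rw [Finset.sum_congr rfl (g := fun k => l k * x k ^ 2)]
    · simp; ring
    · intro k' hk'
      rw [Function.update_of_ne (Finset.ne_of_mem_erase hk')]
  refine le_trans (lmarginal_mono step 0) ?_
  rw [lmarg_const R (by linarith)]
  have hcard : (((Finset.univ.erase i).erase j).erase k : Finset (Fin n)).card = n - 3 := by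
    rw [Finset.card_erase_of_mem hk, Finset.card_erase_of_mem (by simp [hij.symm]),
      Finset.card_erase_of_mem (Finset.mem_univ _)]; simp; omega
  rw [hcard, ← ENNReal.ofReal_mul (by positivity), ← ENNReal.ofReal_mul (by positivity),
    ← ENNReal.ofReal_mul (by positivity)]
  apply ENNReal.ofReal_le_ofReal
  have hpow : (2 * R) ^ n = (2 * R) ^ (n - 3) * (8 * R ^ 3) := by
    conv_lhs => rw [show n = (n - 3) + 3 by omega, pow_add]
    ring
  rw [Finset.abs_prod]
  calc _ = (192 * R ^ 2 * δ * (2 * R) ^ (n - 3)) *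
        (|l i| ^ (-(1/2) : ℝ) * |l j| ^ (-(1/3) : ℝ) * |l k| ^ (-(1/6) : ℝ)) := by ring
    _ ≤ (12 * δ * (2 * R) ^ n) * (∏ i, |l i|) ^ (-(1/n) : ℝ) := by
      refine mul_le_mul ?_ hle (by positivity) (by positivity)
      rw [hpow]
      have : 192 * R ^ 2 ≤ 12 * (8 * R ^ 3) := by nlinarith [sq_nonneg R]
      calc _ = 192 * R ^ 2 * (δ * (2 * R) ^ (n - 3)) := by ring
        _ ≤ 12 * (8 * R ^ 3) * (δ * (2 * R) ^ (n - 3)) := by gcongr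
        _ = _ := by ring

lemma diag_all {n : ℕ} (hn : 2 ≤ n) : ∃ p : ℝ, 0 < p ∧ p < 1 ∧ 1 / p ≤ 2 * n ∧
    ∀ (l : Fin n → ℝ) (c δ R : ℝ), 0 < δ → 1 ≤ c → 2 ≤ R → ∏ i, l i ≠ 0 →
    volume ((Set.univ.pi fun _ : Fin n => Set.Icc (-R) R) ∩ {x | |∑ k, l k * x k ^ 2 - c| ≤ δ})
    ≤ ENNReal.ofReal (12 * δ * (2 * R) ^ n * |∏ i, l i| ^ (-p)) := by
  rcases Nat.lt_or_ge n 3 with h | h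
  · obtain rfl : n = 2 := by omega
    refine ⟨5/12, by norm_num, by norm_num, by norm_num, ?_⟩
    intro l c δ R hδ hc hR hd
    exact diag_two l c δ R hδ hc hR hd
  · have hn' : (3:ℝ) ≤ n := by exact_mod_cast h
    refine ⟨1/n, by positivity, ?_, ?_, ?_⟩
    · rw [div_lt_one (by linarith)]; linarith
    · rw [one_div_one_div]; linarith
    intro l c δ R hδ hc hR hd
    exact diag_three h l c δ R hδ hR hd

open Matrix in
lemma quad {n : ℕ} (N : Matrix (Fin n) (Fin n) ℝ) (hN : N.IsHermitian) (c δ Q : ℝ) (hQ : 0 ≤ Q) :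
    volume ((Set.univ.pi fun _ : Fin n => Set.Icc (-Q) Q) ∩ {v | |v ⬝ᵥ (N *ᵥ v) - c| ≤ δ}) ≤
    volume ((Set.univ.pi fun _ : Fin n => Set.Icc (-(n * Q)) (n * Q)) ∩
      {x | |∑ k, hN.eigenvalues k * x k ^ 2 - c| ≤ δ}) := by
  set U : Matrix (Fin n) (Fin n) ℝ := (hN.eigenvectorUnitary : Matrix (Fin n) (Fin n) ℝ) with hU
  have hUU : Uᵀ * U = 1 := by
    have := (Matrix.mem_unitaryGroup_iff').1 hN.eigenvectorUnitary.2
    rwa [Matrix.star_eq_conjTranspose, conjTranspose_eq_transpose_of_trivial] at this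
  have hdet : |U.det| = 1 := by
    have h := congrArg Matrix.det hUU
    rw [det_mul, det_transpose, det_one] at h
    rcases mul_self_eq_one_iff.1 h with h | h <;> simp [h]
  have hdet0 : U.det ≠ 0 := by intro h; simp [h] at hdet
  have hNd : Uᵀ * N * U = diagonal hN.eigenvalues := by
    have h1 := hN.conjStarAlgAut_star_eigenvectorUnitary
    rw [Unitary.conjStarAlgAut_apply] at h1
    simpa [Matrix.star_eq_conjTranspose, conjTranspose_eq_transpose_of_trivial, Function.comp_def] using h1
  have hmap := Real.map_matrix_volume_pi_eq_smul_volume_pi hdet0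
  rw [abs_inv, hdet, inv_one, ENNReal.ofReal_one, one_smul] at hmap
  set S := (Set.univ.pi fun _ : Fin n => Set.Icc (-Q) Q) ∩ {v | |v ⬝ᵥ (N *ᵥ v) - c| ≤ δ} with hS
  have hSm : MeasurableSet S := by
    apply MeasurableSet.inter
    · exact MeasurableSet.univ_pi fun _ => measurableSet_Icc
    · apply measurableSet_le _ (by fun_prop)
      simp only [dotProduct, mulVec]
      fun_prop
  rw [← hmap, Measure.map_apply (LinearMap.continuous_of_finiteDimensional _).measurable hSm, hmap]
  apply measure_mono
  intro x hx
  simp only [hS, Set.mem_preimage, Set.mem_inter_iff, Set.mem_ofPred_eq, toLin'_apply, Set.mem_pi,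
    Set.mem_univ, forall_true_left] at hx ⊢
  obtain ⟨h1, h2⟩ := hx
  constructor
  · have hnorm : ∑ i, x i ^ 2 = ∑ i, (U *ᵥ x) i ^ 2 := by
      have : (U *ᵥ x) ⬝ᵥ (U *ᵥ x) = x ⬝ᵥ x := by
        rw [dotProduct_mulVec, ← mulVec_transpose, mulVec_mulVec, hUU, one_mulVec]
      simp only [dotProduct, ← sq] at this
      exact this.symm
    have hb : ∑ i, (U *ᵥ x) i ^ 2 ≤ n * Q ^ 2 := by
      calc _ ≤ ∑ i : Fin n, Q ^ 2 := Finset.sum_le_sum fun i _ => sq_le_sq' (h1 i).1 (h1 i).2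
        _ = _ := by simp
    intro i
    have hn : (1:ℝ) ≤ n := by exact_mod_cast (Fin.pos i)
    have hi : x i ^ 2 ≤ ∑ i, x i ^ 2 :=
      Finset.single_le_sum (f := fun i => x i ^ 2) (fun _ _ => sq_nonneg _) (Finset.mem_univ i)
    rw [Set.mem_Icc, ← abs_le]
    apply abs_le_of_sq_le_sq _ (by positivity)
    nlinarith [mul_nonneg (by linarith : (0:ℝ) ≤ n) (sq_nonneg Q)]
  · have : (U *ᵥ x) ⬝ᵥ (N *ᵥ (U *ᵥ x)) = ∑ k, hN.eigenvalues k * x k ^ 2 := by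
      have : (U *ᵥ x) ⬝ᵥ (N *ᵥ (U *ᵥ x)) = x ⬝ᵥ ((Uᵀ * N * U) *ᵥ x) := by
        rw [← mulVec_mulVec, ← mulVec_mulVec, dotProduct_mulVec x, ← mulVec_transpose,
          transpose_transpose]
      rw [this, hNd]
      simp only [dotProduct, mulVec_diagonal]
      exact Finset.sum_congr rfl fun _ _ => by ring
    rwa [this] at h2

lemma upperTri_symm_apply {m : ℕ} (dg : Fin m → ℝ) (u : StrIdx m → ℝ) (i j : Fin m) :
    (upperTri dg u + (upperTri dg u).transpose) i j =
      if h : i < j then u ⟨(i, j), h⟩ else if h : j < i then u ⟨(j, i), h⟩ else 2 * dg i := by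
  simp only [Matrix.add_apply, Matrix.transpose_apply, upperTri]
  rcases lt_trichotomy i j with h | h | h
  · simp [h, h.ne, h.ne', h.not_gt]
  · subst h; simp; ring
  · simp [h, h.ne, h.ne', h.not_gt]

def splitFun (n : ℕ) : StrIdx n ⊕ Fin n → StrIdx (n + 1) :=
  Sum.elim (fun p => ⟨(p.1.1.castSucc, p.1.2.castSucc), Fin.castSucc_lt_castSucc_iff.2 p.2⟩)
    (fun i => ⟨(i.castSucc, Fin.last n), Fin.castSucc_lt_last i⟩)

lemma splitFun_bij (n : ℕ) : Function.Bijective (splitFun n) := by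
  constructor
  · rintro (⟨⟨a, b⟩, h⟩ | i) (⟨⟨a', b'⟩, h'⟩ | i') heq
    · simpa [splitFun] using heq
    · have := congrArg (fun p : StrIdx (n+1) => p.1.2) heq
      simp [splitFun] at this
    · have := congrArg (fun p : StrIdx (n+1) => p.1.2) heq
      simp [splitFun] at this
      exact absurd this.symm (Fin.castSucc_lt_last _).ne
    · simpa [splitFun] using heq
  · rintro ⟨⟨a, b⟩, h⟩
    have h : a < b := h
    have ha : a ≠ Fin.last n := (h.trans_le (Fin.le_last b)).ne
    obtain ⟨a, rfl⟩ := Fin.exists_castSucc_eq.2 ha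
    by_cases hb : b = Fin.last n
    · subst hb; exact ⟨.inr a, rfl⟩
    · obtain ⟨b, rfl⟩ := Fin.exists_castSucc_eq.2 hb
      exact ⟨.inl ⟨(a, b), Fin.castSucc_lt_castSucc_iff.1 h⟩, rfl⟩

def splitEquiv (n : ℕ) : StrIdx n ⊕ Fin n ≃ StrIdx (n + 1) := Equiv.ofBijective _ (splitFun_bij n)

def glue (n : ℕ) : (StrIdx n → ℝ) × (Fin n → ℝ) ≃ᵐ (StrIdx (n + 1) → ℝ) :=
  (MeasurableEquiv.sumPiEquivProdPi (fun _ : StrIdx n ⊕ Fin n => ℝ)).symm.trans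
    (MeasurableEquiv.piCongrLeft (fun _ => ℝ) (splitEquiv n))

lemma glue_mp (n : ℕ) : MeasurePreserving (glue n) (volume.prod volume) volume :=
  (volume_measurePreserving_sumPiEquivProdPi_symm (fun _ : StrIdx n ⊕ Fin n => ℝ)).trans
    (volume_measurePreserving_piCongrLeft (fun _ => ℝ) (splitEquiv n))

lemma glue_apply (n : ℕ) (w : (StrIdx n → ℝ) × (Fin n → ℝ)) (q : StrIdx n ⊕ Fin n) :
    glue n w (splitFun n q) = Sum.elim w.1 w.2 q := by
  have := Equiv.piCongrLeft_apply_apply (fun _ : StrIdx (n+1) => ℝ) (splitEquiv n)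
    ((MeasurableEquiv.sumPiEquivProdPi (fun _ : StrIdx n ⊕ Fin n => ℝ)).symm w) q
  refine Eq.trans this ?_
  cases q <;> rfl

lemma glue_inl (n : ℕ) (w : (StrIdx n → ℝ) × (Fin n → ℝ)) (i j : Fin n) (h : i < j)
    (h' : i.castSucc < j.castSucc) :
    glue n w ⟨(i.castSucc, j.castSucc), h'⟩ = w.1 ⟨(i, j), h⟩ := glue_apply n w (.inl ⟨(i, j), h⟩)

lemma glue_inr (n : ℕ) (w : (StrIdx n → ℝ) × (Fin n → ℝ)) (i : Fin n)
    (h' : i.castSucc < Fin.last n) :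
    glue n w ⟨(i.castSucc, Fin.last n), h'⟩ = w.2 i := glue_apply n w (.inr i)

def symM {m : ℕ} (dg : Fin m → ℝ) (u : StrIdx m → ℝ) : Matrix (Fin m) (Fin m) ℝ :=
  upperTri dg u + (upperTri dg u).transpose

lemma symM_herm {m : ℕ} (dg : Fin m → ℝ) (u : StrIdx m → ℝ) : (symM dg u).IsHermitian := by
  rw [Matrix.IsHermitian, Matrix.conjTranspose_eq_transpose_of_trivial, symM,
    Matrix.transpose_add, Matrix.transpose_transpose, add_comm]

lemma measurable_det {m : ℕ} (dg : Fin m → ℝ) : Measurable fun u => (symM dg u).det := by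
  simp only [Matrix.det_apply]
  refine Finset.measurable_sum _ fun σ _ => ?_
  refine Measurable.const_smul (Finset.measurable_prod _ fun i _ => ?_) _
  simp only [symM, upperTri_symm_apply]
  split_ifs <;> fun_prop

open Matrix in
lemma det_step (n : ℕ) (dg : Fin (n+1) → ℝ) (u : StrIdx n → ℝ) (v : Fin n → ℝ)
    (hA : (symM (fun i => dg i.castSucc) u).det ≠ 0) :
    (symM dg (glue n (u, v))).det = (symM (fun i => dg i.castSucc) u).det *
      (2 * dg (Fin.last n) - v ⬝ᵥ ((symM (fun i => dg i.castSucc) u)⁻¹ *ᵥ v)) := by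
  set A := symM (fun i => dg i.castSucc) u with hAdef
  have : Invertible A := A.invertibleOfIsUnitDet (isUnit_iff_ne_zero.2 hA)
  have hsub : (symM dg (glue n (u, v))).submatrix (finSumFinEquiv : Fin n ⊕ Fin 1 ≃ _) finSumFinEquiv
      = fromBlocks A (replicateCol (Fin 1) v) (replicateRow (Fin 1) v)
        (Matrix.of fun _ _ => 2 * dg (Fin.last n)) := by
    have hca : ∀ i : Fin n, Fin.castAdd 1 i = i.castSucc := fun i => rfl
    have hna : ∀ i : Fin 1, Fin.natAdd n i = Fin.last n := fun i => by ext; simp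
    ext (i | i) (j | j)
    · simp only [submatrix_apply, finSumFinEquiv_apply_left, fromBlocks_apply₁₁, hca, hAdef, symM,
        upperTri_symm_apply, Fin.castSucc_lt_castSucc_iff]
      split_ifs with h1 h2
      · exact glue_inl n _ _ _ h1 _
      · exact glue_inl n _ _ _ h2 _
      · rfl
    · simp only [submatrix_apply, finSumFinEquiv_apply_left, finSumFinEquiv_apply_right,
        fromBlocks_apply₁₂, hca, hna, symM, upperTri_symm_apply, replicateCol_apply]
      rw [dif_pos (Fin.castSucc_lt_last i)]
      exact glue_inr n _ _ _
    · simp only [submatrix_apply, finSumFinEquiv_apply_left, finSumFinEquiv_apply_right,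
        fromBlocks_apply₂₁, hca, hna, symM, upperTri_symm_apply, replicateRow_apply]
      rw [dif_neg (Fin.castSucc_lt_last j).not_gt, dif_pos (Fin.castSucc_lt_last j)]
      exact glue_inr n _ _ _
    · simp only [submatrix_apply, finSumFinEquiv_apply_right,
        fromBlocks_apply₂₂, hna, symM, upperTri_symm_apply]
      simp
  rw [← det_submatrix_equiv_self (finSumFinEquiv : Fin n ⊕ Fin 1 ≃ _), hsub, det_fromBlocks₁₁]
  congr 1
  rw [det_unique, invOf_eq_nonsing_inv, Matrix.sub_apply, Matrix.mul_assoc]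
  congr 1

lemma card_split (n : ℕ) : Fintype.card (StrIdx (n+1)) = Fintype.card (StrIdx n) + n := by
  rw [← Fintype.card_congr (splitEquiv n), Fintype.card_sum, Fintype.card_fin]

def cube (ι : Type*) (Q : ℝ) : Set (ι → ℝ) := Set.univ.pi fun _ : ι => Set.Icc (-Q) Q

lemma cube_meas (ι : Type*) [Fintype ι] (Q : ℝ) : MeasurableSet (cube ι Q) :=
  MeasurableSet.univ_pi fun _ => measurableSet_Icc

lemma cube_vol (ι : Type*) [Fintype ι] (Q : ℝ) (hQ : 0 ≤ Q) :
    volume (cube ι Q) = ENNReal.ofReal ((2 * Q) ^ Fintype.card ι) := by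
  rw [cube, volume_pi_pi]
  simp only [Real.volume_Icc, Finset.prod_const, Finset.card_univ]
  rw [ENNReal.ofReal_pow (by linarith)]
  congr 2; ring

def Bd (m : ℕ) (K : ℝ) : Prop := ∀ Q δ : ℝ, 1 ≤ Q → 0 < δ →
    ∀ dg : Fin m → ℝ, (∀ i, 1 ≤ dg i) →
    volume (cube (StrIdx m) Q ∩ {u | |(symM dg u).det| ≤ δ}) ≤
      ENNReal.ofReal (K * δ * (2 * Q) ^ Fintype.card (StrIdx m))

lemma Bd_two : Bd 2 1 := by
  intro Q δ hQ hδ dg hdg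
  let p₀ : StrIdx 2 := ⟨(0, 1), by decide⟩
  have hall : ∀ p : StrIdx 2, p = p₀ := by decide
  haveI : Unique (StrIdx 2) := ⟨⟨p₀⟩, hall⟩
  have hdet : ∀ u, (symM dg u).det = 4 * dg 0 * dg 1 - u p₀ ^ 2 := by
    intro u
    rw [Matrix.det_fin_two]
    simp only [symM, upperTri_symm_apply]
    simp [p₀]; ring
  have hc : 4 ≤ 4 * dg 0 * dg 1 := by nlinarith [hdg 0, hdg 1]
  have hcard : Fintype.card (StrIdx 2) = 1 := Fintype.card_unique
  set c := 4 * dg 0 * dg 1 with hcdef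
  have hm : MeasurableSet {x : ℝ | |1 * x ^ 2 - c| ≤ δ} := measurableSet_le (by fun_prop) (by fun_prop)
  have h1 : volume {u : StrIdx 2 → ℝ | |(symM dg u).det| ≤ δ} = volume {x : ℝ | |1 * x ^ 2 - c| ≤ δ} := by
    have hmp : MeasurePreserving (MeasurableEquiv.funUnique (StrIdx 2) ℝ) volume volume := by
      convert volume_preserving_funUnique (StrIdx 2) ℝ
    rw [← hmp.measure_preimage hm.nullMeasurableSet]
    congr 1
    ext u
    simp only [Set.mem_ofPred_eq, Set.mem_preimage, hdet, one_mul]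
    rw [abs_sub_comm, ← hall default]
    rfl
  refine (measure_mono Set.inter_subset_right).trans ?_
  rw [h1]
  refine (one_var 1 c δ one_ne_zero (by linarith) hδ).trans ?_
  have hc0 : 0 < c := by linarith
  rw [abs_of_pos hc0, ENNReal.ofReal_rpow_of_pos hc0, ← ENNReal.ofReal_mul (by positivity), hcard]
  apply ENNReal.ofReal_le_ofReal
  have h2 : c ^ (-(1/2) : ℝ) ≤ 1/2 := by
    rw [Real.rpow_neg hc0.le, ← Real.sqrt_eq_rpow, ← one_div]
    apply one_div_le_one_div_of_le (by norm_num)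
    rw [Real.le_sqrt (by norm_num) hc0.le]; linarith
  rw [abs_one, Real.one_rpow]
  nlinarith

lemma Bd_step (n : ℕ) (hn : 2 ≤ n) (K : ℝ) (hK : 1 ≤ K) (h : Bd n K) :
    Bd (n+1) (36 * n ^ (n + 1) * K) := by
  obtain ⟨p, hp0, hp1, hpn, hdiag⟩ := diag_all hn
  intro Q δ hQ hδ dg hdg
  have hn' : (2:ℝ) ≤ n := by exact_mod_cast hn
  have hR : 2 ≤ n * Q := by nlinarith
  set dg' : Fin n → ℝ := fun i => dg i.castSucc with hdg'
  have hb := h Q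
  set S := cube (StrIdx (n+1)) Q ∩ {u | |(symM dg u).det| ≤ δ} with hS
  have hSm : MeasurableSet S := (cube_meas _ _).inter
    (measurableSet_le (measurable_det dg).abs measurable_const)
  rw [← (glue_mp n).measure_preimage hSm.nullMeasurableSet,
    Measure.prod_apply ((glue n).measurable hSm)]
  set C := 12 * δ * (2 * (n * Q)) ^ n with hC
  have hC0 : 0 ≤ C := by positivity
  -- pointwise bound
  have hpt : ∀ u : StrIdx n → ℝ, volume (Prod.mk u ⁻¹' (glue n ⁻¹' S)) ≤
      (cube (StrIdx n) Q).indicator (fun u => ENNReal.ofReal C *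
        (ENNReal.ofReal |(symM dg' u).det|) ^ (-(1 - p))) u := by
    intro u
    by_cases hu : u ∈ cube (StrIdx n) Q
    swap
    · rw [Set.indicator_of_notMem hu, nonpos_iff_eq_zero]
      convert measure_empty
      · rw [Set.eq_empty_iff_forall_notMem]
        intro v hv
        apply hu
        intro q _
        have := hv.1 (splitFun n (.inl q)) (Set.mem_univ _)
        rwa [glue_apply] at this
      · infer_instance
    rw [Set.indicator_of_mem hu]
    by_cases hA : (symM dg' u).det = 0
    · rw [hA, abs_zero, ENNReal.ofReal_zero, ENNReal.zero_rpow_of_neg (by linarith), ENNReal.mul_top]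
      · exact le_top
      · have : 0 < C := by positivity
        simpa using this
    have hA' := abs_pos.2 hA
    have hN : ((symM dg' u)⁻¹).IsHermitian := (symM_herm dg' u).inv
    have hprod : ∏ i, hN.eigenvalues i = ((symM dg' u).det)⁻¹ := by
      have := hN.det_eq_prod_eigenvalues
      rw [Matrix.det_nonsing_inv, Ring.inverse_eq_inv'] at this
      simpa using this.symm
    have h1 := quad _ hN (2 * dg (Fin.last n)) (δ / |(symM dg' u).det|) Q (by linarith)
    have h2 := hdiag hN.eigenvalues (2 * dg (Fin.last n)) (δ / |(symM dg' u).det|) (n * Q)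
      (by positivity) (by linarith [hdg (Fin.last n)]) hR (by rw [hprod]; exact inv_ne_zero hA)
    refine (measure_mono ?_).trans ((h1.trans h2).trans ?_)
    · intro v hv
      refine ⟨?_, ?_⟩
      · intro i _
        have := hv.1 (splitFun n (.inr i)) (Set.mem_univ _)
        rwa [glue_apply] at this
      · have := hv.2
        simp only [Set.mem_ofPred_eq] at this ⊢
        rw [det_step n dg u v hA, abs_mul] at this
        rw [le_div_iff₀ hA', mul_comm, abs_sub_comm]
        exact this
    · rw [ENNReal.ofReal_rpow_of_pos hA', ← ENNReal.ofReal_mul hC0]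
      apply ENNReal.ofReal_le_ofReal
      apply le_of_eq
      rw [hprod, abs_inv, Real.inv_rpow hA'.le, Real.rpow_neg hA'.le, inv_inv,
        show -(1 - p) = p - 1 by ring, Real.rpow_sub hA', Real.rpow_one, hC]
      field_simp
  refine (lintegral_mono hpt).trans ?_
  rw [lintegral_indicator (cube_meas _ _), lintegral_const_mul' _ _ ENNReal.ofReal_ne_top]
  set T := (2 * Q) ^ Fintype.card (StrIdx n) with hT
  have hT0 : 0 ≤ T := by positivity
  have hl := layerL (volume.restrict (cube (StrIdx n) Q)) (fun u => (symM dg' u).det)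
    (measurable_det dg') (1 - p) T (K * T) (by linarith) (by linarith) hT0 (by positivity)
    (by rw [Measure.restrict_apply_univ, cube_vol _ _ (by linarith)])
    (by
      intro ε hε
      rw [Measure.restrict_apply (measurableSet_le (measurable_det dg').abs measurable_const),
        Set.inter_comm]
      refine (h Q ε hQ hε dg' (fun i => hdg _)).trans (le_of_eq ?_)
      congr 1; ring)
  refine (mul_le_mul_right hl _).trans ?_
  rw [← ENNReal.ofReal_mul hC0, card_split]
  apply ENNReal.ofReal_le_ofReal
  have hfrac : (1 - p) / (1 - (1 - p)) ≤ 2 * n := by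
    rw [sub_sub_cancel]
    refine le_trans ?_ hpn
    gcongr
    linarith
  have hKn : 1 ≤ n * K := by nlinarith
  calc C * (T + K * T * ((1 - p) / (1 - (1 - p)))) ≤ C * (T + K * T * (2 * n)) := by gcongr
    _ = C * T * (1 + 2 * (n * K)) := by ring
    _ ≤ C * T * (3 * (n * K)) := by gcongr; linarith
    _ = _ := by
      rw [hC, hT, show 2 * ((n:ℝ) * Q) = n * (2 * Q) by ring, mul_pow, pow_add (2 * Q)]
      ring

lemma Bd_mono {m : ℕ} {K K' : ℝ} (h : Bd m K) (hK : K ≤ K') : Bd m K' := by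
  intro Q δ hQ hδ dg hdg
  refine (h Q δ hQ hδ dg hdg).trans (ENNReal.ofReal_le_ofReal ?_)
  gcongr

lemma Bd_all (m : ℕ) (hm : 2 ≤ m) : Bd m ((m:ℝ) ^ (5 * m ^ 2)) := by
  induction m, hm using Nat.le_induction with
  | base => exact Bd_mono Bd_two (by norm_num)
  | succ n hn ih =>
    have hn' : (2:ℝ) ≤ n := by exact_mod_cast hn
    refine Bd_mono (Bd_step n hn _ (one_le_pow₀ (by linarith)) ih) ?_
    push_cast
    have e : 5 * (n + 1) ^ 2 = 4 + (n + 1) + (9 * n) + 5 * n ^ 2 := by ring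
    have e2 : ((n:ℝ) + 1) ^ (5 * (n + 1) ^ 2) =
        (n + 1) ^ 4 * (n + 1) ^ (n + 1) * (n + 1) ^ (9 * n) * (n + 1) ^ (5 * n ^ 2) := by
      rw [← pow_add, ← pow_add, ← pow_add, e]
    rw [e2]
    have h1 : (36:ℝ) ≤ (n + 1) ^ 4 := by
      calc (36:ℝ) ≤ 3 ^ 4 := by norm_num
        _ ≤ _ := by gcongr; linarith
    have h2 : (n:ℝ) ^ (n + 1) ≤ (n + 1) ^ (n + 1) := by gcongr; linarith
    have h3 : (1:ℝ) ≤ (n + 1) ^ (9 * n) := one_le_pow₀ (by linarith)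
    have h4 : (n:ℝ) ^ (5 * n ^ 2) ≤ (n + 1) ^ (5 * n ^ 2) := by gcongr; linarith
    calc (36:ℝ) * n ^ (n+1) * n ^ (5 * n ^ 2) = 36 * n ^ (n+1) * 1 * n ^ (5 * n ^ 2) := by ring
      _ ≤ _ := by gcongr

theorem statement16 :
    ∃ m₀ : ℕ, ∀ m : ℕ, m₀ ≤ m → ∀ Q δ : ℝ, 1 ≤ Q → 0 < δ →
    ∀ dg : Fin m → ℝ, (∀ i, 1 ≤ dg i ∧ dg i ≤ Q) →
    unifCube (StrIdx m) Q
        {u : StrIdx m → ℝ | |(upperTri dg u + (upperTri dg u).transpose).det| ≤ δ}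
      ≤ ENNReal.ofReal ((Q * m) ^ (5 * m ^ 2) * δ) := by
  refine ⟨2, fun m hm Q δ hQ hδ dg hdg => ?_⟩
  have h := Bd_all m hm Q δ hQ hδ dg (fun i => (hdg i).1)
  have hmeas : MeasurableSet {u : StrIdx m → ℝ | |(symM dg u).det| ≤ δ} :=
    measurableSet_le (measurable_det dg).abs measurable_const
  have hv := cube_vol (StrIdx m) Q (by linarith)
  set T := (2 * Q) ^ Fintype.card (StrIdx m) with hT
  have hT0 : 0 < T := by positivity
  change ((volume (cube (StrIdx m) Q))⁻¹ • volume.restrict (cube (StrIdx m) Q))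
    {u : StrIdx m → ℝ | |(symM dg u).det| ≤ δ} ≤ _
  rw [Measure.smul_apply, smul_eq_mul, Measure.restrict_apply hmeas, Set.inter_comm, hv,
    mul_comm, ← div_eq_mul_inv]
  apply ENNReal.div_le_of_le_mul
  rw [← ENNReal.ofReal_mul (by positivity)]
  refine h.trans (ENNReal.ofReal_le_ofReal ?_)
  have : (m:ℝ) ≤ Q * m := by nlinarith [(Nat.cast_nonneg m : (0:ℝ) ≤ m)]
  gcongr

end
end
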